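/- Let u ∈ W^{1,p}_{loc}(Ω; Λ^k ℝ^n ⊗ ℝ^N) be a local weak solution of δ(a(x)|du|^{p−2} du) = f in Ω. Then for any ball B_R ⊂⊂ Ω there exists a coclosed form ũ ∈ W^{1,p}(B_R; Λ^k ℝ^n ⊗ ℝ^N) which is also a local weak solution of the same system in B_R and satisfies δũ = 0 and dũ = du almost everywhere in B_R. -/

import Mathlib

open MeasureTheory Metric Filter
open scoped ENNReal NNReal

noncomputable section

/-- Euclidean space `ℝ^n`. -/
abbrev En (n : ℕ) : Type := EuclideanSpace ℝ (Fin n)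

/-- Index set for the coefficients of a `k`-form on `ℝ^n`: increasing multi-indices,
identified with `k`-element subsets of `Fin n`. -/
abbrev FormIdx (n k : ℕ) : Type := {s : Finset (Fin n) // s.card = k}

/-- An `ℝ^N`-valued `k`-covector on `ℝ^n`, described by its coefficients. -/
abbrev Form (n N k : ℕ) : Type := FormIdx n k × Fin N → ℝ

variable {n N k : ℕ}

/-- Euclidean inner product of two (vector-valued) forms. -/
def finner (v w : Form n N k) : ℝ := ∑ q, v q * w q

/-- Euclidean norm of a (vector-valued) form. -/
def fnorm (v : Form n N k) : ℝ := Real.sqrt (∑ q, v q ^ 2)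

/-- Euclidean norm of a full array of partial derivatives (a gradient). -/
def gnorm (H : Fin n → Form n N k) : ℝ := Real.sqrt (∑ i, ∑ q, H i q ^ 2)

/-- The pointwise exterior derivative of a `k`-form, assembled from the array
`G i = ∂_i u` of its partial derivatives. -/
def extD (G : Fin n → Form n N k) : Form n N (k + 1) := fun q =>
  ∑ i : Fin n,
    if h : i ∈ q.1.1 then
      (-1 : ℝ) ^ (q.1.1.filter (fun j => j < i)).card *
        G i (⟨q.1.1.erase i, by simp [Finset.card_erase_of_mem h, q.1.2]⟩, q.2)
    else 0

/-- The pointwise codifferential of a `(k+1)`-form, assembled from the array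
`G i = ∂_i u` of its partial derivatives. -/
def codiff (G : Fin n → Form n N (k + 1)) : Form n N k := fun q =>
  -∑ i : Fin n,
      if h : i ∈ q.1.1 then 0
      else
        (-1 : ℝ) ^ (q.1.1.filter (fun j => j < i)).card *
          G i (⟨insert i q.1.1, by simp [Finset.card_insert_of_notMem h, q.1.2]⟩, q.2)

/-- The nonlinearity `z ↦ t |z|^{p-2} z`. -/
def nl (p t : ℝ) (z : Form n N k) : Form n N k := fun q => t * fnorm z ^ (p - 2) * z q

/-- The auxiliary map `V(z) = |z|^{(p-2)/2} z`. -/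
def Vform (p : ℝ) (z : Form n N k) : Form n N k := fun q => fnorm z ^ ((p - 2) / 2) * z q

/-- The `i`-th standard basis vector of `ℝ^n`. -/
def basisVec (i : Fin n) : En n := EuclideanSpace.single i 1

/-- Scalar test functions: smooth and compactly supported inside `Ω`. -/
def IsTestFun (Ω : Set (En n)) (φ : En n → ℝ) : Prop :=
  ContDiff ℝ (⊤ : ℕ∞) φ ∧ HasCompactSupport φ ∧ tsupport φ ⊆ Ω

/-- Test `k`-forms: componentwise smooth and compactly supported inside `Ω`. -/
def IsTestForm (Ω : Set (En n)) (φ : En n → Form n N k) : Prop :=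
  (∀ q, ContDiff ℝ (⊤ : ℕ∞) fun x => φ x q) ∧ HasCompactSupport φ ∧ tsupport φ ⊆ Ω

/-- The (classical) array of partial derivatives of a form-valued map. -/
def smoothGrad (φ : En n → Form n N k) (x : En n) : Fin n → Form n N k := fun i q =>
  fderiv ℝ (fun y => φ y q) x (basisVec i)

/-- `g` is the weak (distributional) `i`-th partial derivative of `u` on `Ω`. -/
def HasWeakPartial (Ω : Set (En n)) (u g : En n → ℝ) (i : Fin n) : Prop :=
  ∀ φ : En n → ℝ, IsTestFun Ω φ →
    ∫ x in Ω, u x * fderiv ℝ φ x (basisVec i) = -∫ x in Ω, g x * φ x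

/-- `G` is the weak gradient (array of weak partial derivatives) of the form `u` on `Ω`. -/
def HasWeakGrad (Ω : Set (En n)) (u : En n → Form n N k)
    (G : En n → Fin n → Form n N k) : Prop :=
  ∀ i q, HasWeakPartial Ω (fun x => u x q) (fun x => G x i q) i

/-- Membership in `W^{1,p}(Ω)` for a form `u` with weak gradient `G`. -/
def MemW1p (Ω : Set (En n)) (p : ℝ) (u : En n → Form n N k)
    (G : En n → Fin n → Form n N k) : Prop :=
  HasWeakGrad Ω u G ∧
    (∀ q, AEStronglyMeasurable (fun x => u x q) (volume.restrict Ω)) ∧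
    (∀ i q, AEStronglyMeasurable (fun x => G x i q) (volume.restrict Ω)) ∧
    IntegrableOn (fun x => fnorm (u x) ^ p) Ω volume ∧
    IntegrableOn (fun x => gnorm (G x) ^ p) Ω volume

/-- Membership in `W^{1,p}_loc(Ω)` for a form `u` with weak gradient `G`. -/
def MemW1pLoc (Ω : Set (En n)) (p : ℝ) (u : En n → Form n N k)
    (G : En n → Fin n → Form n N k) : Prop :=
  HasWeakGrad Ω u G ∧
    (∀ q, AEStronglyMeasurable (fun x => u x q) (volume.restrict Ω)) ∧
    (∀ i q, AEStronglyMeasurable (fun x => G x i q) (volume.restrict Ω)) ∧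
    ∀ K, K ⊆ Ω → IsCompact K →
      IntegrableOn (fun x => fnorm (u x) ^ p) K volume ∧
      IntegrableOn (fun x => gnorm (G x) ^ p) K volume

/-- `δ f = 0` on `Ω` in the sense of distributions: `∫ ⟨f, dψ⟩ = 0` for every smooth
compactly supported form `ψ` of degree one less. (Vacuous for `0`-forms.) -/
def WeaklyCoclosed (Ω : Set (En n)) (f : En n → Form n N k) : Prop :=
  ∀ (j : ℕ) (h : j + 1 = k) (ψ : En n → Form n N j), IsTestForm Ω ψ →
    ∫ x in Ω, finner (f x) (cast (congrArg (Form n N) h) (extD (smoothGrad ψ x))) = 0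

/-- Weak formulation of the vanishing of the tangential part `ν ∧ u = 0` on `∂B`:
the integration-by-parts formula `∫_B ⟨du, ψ⟩ = ∫_B ⟨u, δψ⟩` holds without boundary
contribution for every smooth `(k+1)`-form `ψ`. -/
def TangentialZero (B : Set (En n)) (u : En n → Form n N k)
    (G : En n → Fin n → Form n N k) : Prop :=
  ∀ ψ : En n → Form n N (k + 1), (∀ q, ContDiff ℝ (⊤ : ℕ∞) fun x => ψ x q) →
    ∫ x in B, finner (extD (G x)) (ψ x) = ∫ x in B, finner (u x) (codiff (smoothGrad ψ x))

/-- The space `W^{1,p}_{δ,T}(B)`: `W^{1,p}` forms which are weakly coclosed in `B` and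
have vanishing tangential part on `∂B`. -/
def MemWdeltaT (B : Set (En n)) (p : ℝ) (u : En n → Form n N k)
    (G : En n → Fin n → Form n N k) : Prop :=
  MemW1p B p u G ∧ WeaklyCoclosed B u ∧ TangentialZero B u G

/-- `u` (with weak gradient `G`) is a local weak solution of
`δ(a(x) |du|^{p-2} du) = f` on `Ω`. -/
def IsLocalWeakSolution (Ω : Set (En n)) (p : ℝ) (a : En n → ℝ)
    (u : En n → Form n N k) (G : En n → Fin n → Form n N k)
    (f : En n → Form n N k) : Prop :=
  ∀ φ : En n → Form n N k, IsTestForm Ω φ →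
    ∫ x in Ω, finner (nl p (a x) (extD (G x))) (extD (smoothGrad φ x)) =
      ∫ x in Ω, finner (f x) (φ x)

/-- The Lorentz (quasi-)norm `‖g‖_{L^{(p,θ)}(μ)}`. -/
def lorentzNorm {α : Type*} [MeasurableSpace α] (μ : Measure α) (p : ℝ) (θ : ℝ≥0∞)
    (g : α → ℝ) : ℝ≥0∞ :=
  if θ = ⊤ then
    (⨆ t : ℝ, if 0 < t then ENNReal.ofReal (t ^ p) * μ {x | t < |g x|} else 0) ^ (1 / p)
  else
    (∫⁻ t in Set.Ioi (0 : ℝ),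
        (ENNReal.ofReal (t ^ p) * μ {x | t < |g x|}) ^ (θ.toReal / p) / ENNReal.ofReal t) ^
      (1 / θ.toReal)

/-- Membership in the Lorentz space `L^{(p,θ)}(s)`. -/
def MemLorentzOn {α : Type*} [MeasurableSpace α] (μ : Measure α) (p : ℝ) (θ : ℝ≥0∞)
    (g : α → ℝ) (s : Set α) : Prop :=
  AEStronglyMeasurable g (μ.restrict s) ∧ lorentzNorm (μ.restrict s) p θ g ≠ ⊤

/-- Local membership in the Lorentz space `L^{(p,θ)}` on the open set `Ω`. -/
def MemLorentzLoc (p : ℝ) (θ : ℝ≥0∞) (g : En n → ℝ) (Ω : Set (En n)) : Prop :=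
  ∀ K, K ⊆ Ω → IsCompact K → MemLorentzOn volume p θ g K

/-- The `L^s` norm of a scalar function on a set, valued in `ℝ≥0∞`. -/
def lpNormOn (s : ℝ) (g : En n → ℝ) (A : Set (En n)) : ℝ≥0∞ :=
  (∫⁻ x in A, ENNReal.ofReal (|g x| ^ s)) ^ (1 / s)

/-- A Dini modulus of continuity. -/
def IsDiniModulus (ω : ℝ → ℝ) : Prop :=
  (∀ t, 0 ≤ ω t) ∧ MonotoneOn ω (Set.Ici 0) ∧
    IntegrableOn (fun t => ω t / t) (Set.Ioc 0 1) volume ∧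
    Tendsto ω (nhdsWithin 0 (Set.Ioi 0)) (nhds 0)

/-- `ω` is a modulus of continuity for `a` on `Ω`. -/
def IsModulusFor (ω : ℝ → ℝ) (a : En n → ℝ) (Ω : Set (En n)) : Prop :=
  ∀ x ∈ Ω, ∀ y ∈ Ω, |a x - a y| ≤ ω ‖x - y‖

/-- Dini continuity on `Ω`. -/
def DiniContinuousOn (a : En n → ℝ) (Ω : Set (En n)) : Prop :=
  ∃ ω, IsDiniModulus ω ∧ IsModulusFor ω a Ω

/-- `a` is `α`-Hölder with constant `C` on `s`. -/
def HolderOn (α C : ℝ) (a : En n → ℝ) (s : Set (En n)) : Prop :=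
  ∀ x ∈ s, ∀ y ∈ s, |a x - a y| ≤ C * ‖x - y‖ ^ α

/-- `g` agrees a.e. on `Ω` with a function continuous on `Ω`. -/
def HasContinuousRepOn {V : Type*} [TopologicalSpace V] (Ω : Set (En n)) (g : En n → V) :
    Prop :=
  ∃ v : En n → V, ContinuousOn v Ω ∧ ∀ᵐ x ∂volume.restrict Ω, g x = v x

/-- `g` has locally vanishing mean oscillation in `Ω`. -/
def LocallyVMOOn {V : Type*} [NormedAddCommGroup V] [NormedSpace ℝ V] (Ω : Set (En n))
    (g : En n → V) : Prop :=
  ∀ K, K ⊆ Ω → IsCompact K → ∀ ε > 0, ∃ r₀ > 0, ∀ x ∈ K, ∀ r, 0 < r → r ≤ r₀ →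
    (⨍ y in ball x r, ‖g y - ⨍ z in ball x r, g z‖) ≤ ε

/-- `g` has locally bounded mean oscillation in `Ω`. -/
def LocallyBMOOn {V : Type*} [NormedAddCommGroup V] [NormedSpace ℝ V] (Ω : Set (En n))
    (g : En n → V) : Prop :=
  ∀ K, K ⊆ Ω → IsCompact K → ∃ C : ℝ, ∃ r₀ > 0, ∀ x ∈ K, ∀ r, 0 < r → r ≤ r₀ →
    (⨍ y in ball x r, ‖g y - ⨍ z in ball x r, g z‖) ≤ C

/-- The `p`-th power of the Campanato seminorm `[u]^p_{𝓛^{p,λ}(s)}`, valued in `ℝ≥0∞`. -/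
def campanatoSemi {V : Type*} [NormedAddCommGroup V] [NormedSpace ℝ V] (p lam : ℝ)
    (s : Set (En n)) (u : En n → V) : ℝ≥0∞ :=
  ⨆ (x₀ : En n) (_ : x₀ ∈ closure s) (ρ : ℝ) (_ : 0 < ρ),
    ENNReal.ofReal
      (ρ ^ (-lam) * ∫ y in ball x₀ ρ ∩ s, ‖u y - ⨍ z in ball x₀ ρ ∩ s, u z‖ ^ p)

/-- The Campanato norm `‖u‖_{𝓛^{p,λ}(s)} = ‖u‖_{L^p(s)} + [u]_{𝓛^{p,λ}(s)}`. -/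
def campanatoNorm {V : Type*} [NormedAddCommGroup V] [NormedSpace ℝ V] (p lam : ℝ)
    (s : Set (En n)) (u : En n → V) : ℝ≥0∞ :=
  (∫⁻ y in s, ENNReal.ofReal (‖u y‖ ^ p)) ^ (1 / p) + campanatoSemi p lam s u ^ (1 / p)

/-- Membership in the Campanato space `𝓛^{p,λ}(s)`. -/
def MemCampanatoOn {V : Type*} [NormedAddCommGroup V] [NormedSpace ℝ V] (p lam : ℝ)
    (s : Set (En n)) (u : En n → V) : Prop :=
  AEStronglyMeasurable u (volume.restrict s) ∧
    IntegrableOn (fun y => ‖u y‖ ^ p) s volume ∧ campanatoSemi p lam s u ≠ ⊤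

/-- Local membership in the Campanato space `𝓛^{p,λ}` on `Ω`. -/
def MemCampanatoLoc {V : Type*} [NormedAddCommGroup V] [NormedSpace ℝ V] (p lam : ℝ)
    (Ω : Set (En n)) (u : En n → V) : Prop :=
  ∀ K, K ⊆ Ω → IsCompact K → MemCampanatoOn p lam K u

/-- `v` is of class `C^{1,θ}` locally on `Ω`. -/
def C1HolderLocOn {V : Type*} [NormedAddCommGroup V] [NormedSpace ℝ V] (θ : ℝ)
    (Ω : Set (En n)) (v : En n → V) : Prop :=
  ∃ Dv : En n → En n →L[ℝ] V, (∀ x ∈ Ω, HasFDerivAt v (Dv x) x) ∧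
    ∀ K, K ⊆ Ω → IsCompact K →
      ∃ C : ℝ, 0 ≤ C ∧ ∀ x ∈ K, ∀ y ∈ K, ‖Dv x - Dv y‖ ≤ C * ‖x - y‖ ^ θ

/-- Local membership in `L^q` for a form-valued map. -/
def MemLqLoc (q : ℝ) (f : En n → Form n N k) (Ω : Set (En n)) : Prop :=
  (∀ r, AEStronglyMeasurable (fun x => f x r) (volume.restrict Ω)) ∧
    ∀ K, K ⊆ Ω → IsCompact K → IntegrableOn (fun x => fnorm (f x) ^ q) K volume

/-- `x` is a Lebesgue point of the form-valued map `g`. -/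
def IsLebesguePoint (g : En n → Form n N k) (x : En n) : Prop :=
  Tendsto (fun r => ⨍ y in ball x r, fnorm (g y - g x)) (nhdsWithin 0 (Set.Ioi 0)) (nhds 0)

theorem gf_tangent {p : ℝ} (hp : 1 ≤ p) (x a : ℝ) :
    |x| ^ p + p * (|x| ^ p / x) * a ≤ |x + a| ^ p := by
  rcases eq_or_ne x 0 with rfl | hx
  · have : (0:ℝ) ^ p = 0 := Real.zero_rpow (by linarith)
    simp [this]; positivity
  · have h1 : |x + a| = |x| * |1 + a / x| := by
      rw [← abs_mul]; congr 1; field_simp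
    rw [h1, Real.mul_rpow (abs_nonneg _) (abs_nonneg _)]
    have h2 : 1 + p * (a / x) ≤ |1 + a / x| ^ p := by
      rcases le_or_gt (-1) (a / x) with h | h
      · rw [abs_of_nonneg (by linarith)]
        exact one_add_mul_self_le_rpow_one_add h hp
      · have : 1 + p * (a / x) ≤ 0 := by nlinarith
        exact this.trans (by positivity)
    calc |x| ^ p + p * (|x| ^ p / x) * a = |x| ^ p * (1 + p * (a / x)) := by field_simp
      _ ≤ _ := by gcongr

theorem gf_clarkson {p : ℝ} (hp : 2 ≤ p) (α β : ℝ) :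
    2 * (|α| ^ p + |β| ^ p) ≤ |α + β| ^ p + |α - β| ^ p := by
  have key : ∀ z : ℝ, |z| ^ p = (z ^ 2) ^ (p / 2) := by
    intro z
    rw [← sq_abs, ← Real.rpow_natCast, ← Real.rpow_mul (abs_nonneg _)]
    congr 1; push_cast; ring
  simp only [key]
  have h1 := Real.add_rpow_le_rpow_add (p := p / 2) (sq_nonneg α) (sq_nonneg β) (by linarith)
  have hcv := (convexOn_rpow (p := p / 2) (by linarith)).2
  have h2 := @hcv ((α + β) ^ 2) (Set.mem_Ici.mpr (sq_nonneg _)) ((α - β) ^ 2) (Set.mem_Ici.mpr (sq_nonneg _)) (1 / 2) (1 / 2)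
    (by norm_num) (by norm_num) (by norm_num)
  simp only [smul_eq_mul] at h2
  have h3 : 1 / 2 * (α + β) ^ 2 + 1 / 2 * (α - β) ^ 2 = α ^ 2 + β ^ 2 := by ring
  rw [h3] at h2
  linarith

/-- strong convexity of `|x|^p`, `p ≥ 2`. -/
theorem gf_convex_p {p : ℝ} (hp : 2 ≤ p) : ∃ c : ℝ, 0 < c ∧ ∀ x a : ℝ,
    |x| ^ p + p * (|x| ^ p / x) * a + c * (|x| ^ (p - 2) * a ^ 2 + |a| ^ p) ≤ |x + a| ^ p := by
  have A1 : ∀ x a : ℝ, |x| ^ p + p * (|x| ^ p / x) * a + (2:ℝ) ^ (1 - p) * |a| ^ p ≤ |x + a| ^ p := by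
    intro x a
    have h1 := gf_clarkson hp (x + a / 2) (a / 2)
    have h2 := gf_tangent (p := p) (by linarith) x (a / 2)
    have h3 : |a / 2| ^ p = (2:ℝ) ^ (-p) * |a| ^ p := by
      rw [abs_div, Real.div_rpow (abs_nonneg _) (abs_nonneg _), Real.rpow_neg (by norm_num)]
      simp; field_simp
    have h4 : (2:ℝ) ^ (1 - p) = 2 * (2:ℝ) ^ (-p) := by
      rw [sub_eq_add_neg, Real.rpow_add (by norm_num)]; simp
    rw [show x + a / 2 + a / 2 = x + a by ring, show x + a / 2 - a / 2 = x by ring, h3] at h1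
    rw [h4]
    linarith
  have A2 : ∀ x a : ℝ, x ≠ 0 →
      |x| ^ p + p * (|x| ^ p / x) * a + (|x| ^ (p - 2) * a ^ 2) ≤ |x + a| ^ p := by
    intro x a hx
    have h1 : |x + a| = |x| * |1 + a / x| := by
      rw [← abs_mul]; congr 1; field_simp
    rw [h1, Real.mul_rpow (abs_nonneg _) (abs_nonneg _)]
    set t := a / x with ht
    have ha : a = t * x := by rw [ht]; field_simp
    have h2 : 1 + p * t + t ^ 2 ≤ |1 + t| ^ p := by
      have e : |1 + t| ^ p = (1 + (2 * t + t ^ 2)) ^ (p / 2) := by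
        rw [show 1 + (2 * t + t ^ 2) = |1 + t| ^ 2 by rw [sq_abs]; ring, ← Real.rpow_natCast,
          ← Real.rpow_mul (abs_nonneg _)]
        congr 1; push_cast; ring
      rw [e]
      have := one_add_mul_self_le_rpow_one_add (s := 2 * t + t ^ 2) (p := p / 2)
        (by nlinarith [sq_nonneg (1 + t)]) (by linarith)
      nlinarith [sq_nonneg t]
    have h3 : |x| ^ (p - 2) * a ^ 2 = |x| ^ p * t ^ 2 := by
      rw [ha, Real.rpow_sub (abs_pos.mpr hx)]
      have : |x| ^ (2:ℝ) = x ^ 2 := by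
        rw [show (2:ℝ) = ((2:ℕ):ℝ) by norm_num, Real.rpow_natCast, sq_abs]
      rw [this]; field_simp
    rw [h3]
    calc _ = |x| ^ p * (1 + p * t + t ^ 2) := by rw [ha]; field_simp
      _ ≤ _ := by gcongr
  have hc : (0:ℝ) < (2:ℝ) ^ (1 - p) := by positivity
  have hc1 : (2:ℝ) ^ (1 - p) ≤ 1 := Real.rpow_le_one_of_one_le_of_nonpos (by norm_num) (by linarith)
  refine ⟨(2:ℝ) ^ (1 - p) / 2, by positivity, fun x a => ?_⟩
  have h1 := A1 x a
  rcases eq_or_ne x 0 with rfl | hx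
  · have h0 : |(0:ℝ)| ^ (p - 2) * a ^ 2 ≤ |a| ^ p := by
      rcases eq_or_lt_of_le hp with rfl | h
      · simp
      · rw [abs_zero, Real.zero_rpow (by linarith)]; simp; positivity
    clear A1 A2
    generalize (2:ℝ) ^ (1 - p) = c at *
    generalize |(0:ℝ)| ^ (p - 2) * a ^ 2 = z at *
    generalize |(0:ℝ)| ^ p + p * (|(0:ℝ)| ^ p / 0) * a = z' at *
    nlinarith
  · have h2 := A2 x a hx
    have : 0 ≤ |x| ^ (p - 2) * a ^ 2 := by positivity
    nlinarith

theorem gf_B1 {q : ℝ} (hq : 1 < q) (hq2 : q ≤ 2) (t : ℝ) (ht : |t| ≤ 1 / 2) :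
    1 + q * t + (q * (q - 1) / 3) * t ^ 2 ≤ |1 + t| ^ q := by
  have ht' := abs_le.mp ht
  rw [abs_of_pos (by linarith)]
  set c := q * (q - 1) / 3 with hc
  have hcv : ConvexOn ℝ (Set.Icc (1/2 : ℝ) (3/2)) (fun s : ℝ => s ^ q - c * s ^ 2) := by
    apply convexOn_of_hasDerivWithinAt2_nonneg (convex_Icc _ _)
      (f' := fun s => q * s ^ (q - 1) - c * (2 * s))
      (f'' := fun s => q * ((q - 1) * s ^ (q - 2)) - c * 2)
    · apply ContinuousOn.sub
      · exact fun s hs => (Real.continuousAt_rpow_const _ _ (Or.inl (by linarith [hs.1]))).continuousWithinAt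
      · fun_prop
    · intro s hs
      rw [interior_Icc] at hs
      have h1 := Real.hasDerivAt_rpow_const (x := s) (p := q) (Or.inl (by linarith [hs.1]))
      have h2 := (hasDerivAt_pow 2 s).const_mul c
      have := h1.fun_sub h2
      simpa using this.hasDerivWithinAt
    · intro s hs
      rw [interior_Icc] at hs
      have h1 := (Real.hasDerivAt_rpow_const (x := s) (p := q - 1) (Or.inl (by linarith [hs.1]))).const_mul q
      have h2 := ((hasDerivAt_id s).const_mul 2).const_mul c
      have := h1.fun_sub h2
      rw [show q - 1 - 1 = q - 2 by ring] at this
      simpa using this.hasDerivWithinAt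
    · intro s hs
      rw [interior_Icc] at hs
      have hs0 : 0 < s := by linarith [hs.1]
      have h1 : (2/3 : ℝ) ≤ s ^ (q - 2) := by
        rcases le_or_gt s 1 with h | h
        · have := Real.one_le_rpow_of_pos_of_le_one_of_nonpos hs0 h (by linarith : q - 2 ≤ 0)
          linarith
        · have := Real.rpow_le_rpow_of_exponent_le h.le (by linarith : (-1:ℝ) ≤ q - 2)
          rw [Real.rpow_neg_one] at this
          have h2 : (2/3 : ℝ) ≤ s⁻¹ := by
            rw [le_inv_comm₀ (by norm_num) hs0]; norm_num; linarith [hs.2]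
          linarith
      have : 0 < q * (q - 1) := by nlinarith
      nlinarith
  have hd : HasDerivAt (fun s : ℝ => s ^ q - c * s ^ 2) (q - c * 2) 1 := by
    have h1 := Real.hasDerivAt_rpow_const (x := 1) (p := q) (Or.inl (by norm_num))
    have h2 := (hasDerivAt_pow 2 (1:ℝ)).const_mul c
    simpa using h1.fun_sub h2
  have m1 : (1:ℝ) ∈ Set.Icc (1/2 : ℝ) (3/2) := by constructor <;> norm_num
  have mt : (1 + t:ℝ) ∈ Set.Icc (1/2 : ℝ) (3/2) := by constructor <;> linarith
  have : 1 - c + (q - c * 2) * t ≤ (1 + t) ^ q - c * (1 + t) ^ 2 := by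
    rcases lt_trichotomy t 0 with h | h | h
    · have := hcv.slope_le_of_hasDerivAt mt m1 (by linarith) hd
      rw [slope_def_field, div_le_iff₀ (by linarith)] at this
      simp at this
      linarith
    · subst h; simp
    · have := hcv.le_slope_of_hasDerivAt m1 mt (by linarith) hd
      rw [slope_def_field, le_div_iff₀ (by linarith)] at this
      simp at this
      linarith
  nlinarith

theorem gf_B2 {q : ℝ} (hq : 1 < q) (hq2 : q ≤ 2) : ∃ c : ℝ, 0 < c ∧ ∀ t : ℝ, 1 / 2 ≤ |t| →
    1 + q * t + c * |t| ^ q ≤ |1 + t| ^ q := by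
  set c₁ := q * (q - 1) / 3 with hc₁
  have hc₁0 : 0 < c₁ := by have : 0 < q * (q - 1) := by nlinarith
                           positivity
  have lin : ∀ t : ℝ, 1 / 2 ≤ |t| → 1 + q * t + c₁ / 2 * |t| ≤ |1 + t| ^ q := by
    intro t ht
    have ht0 : 0 < |t| := by linarith
    set s := 1 / (2 * |t|) with hs
    have hs0 : 0 < s := by positivity
    have hs1 : s ≤ 1 := by rw [hs, div_le_one (by positivity)]; linarith
    have hst : s * |t| = 1 / 2 := by rw [hs]; field_simp
    have habs : |s * t| = 1 / 2 := by rw [abs_mul, abs_of_pos hs0, hst]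
    have h1 := gf_B1 hq hq2 (s * t) habs.le
    have h2 : (s * t) ^ 2 = 1 / 4 := by rw [← sq_abs, habs]; norm_num
    have hcv : |1 + s * t| ^ q ≤ (1 - s) * 1 + s * |1 + t| ^ q := by
      have hcv := (convexOn_rpow (p := q) hq.le).2
      have h3 := @hcv 1 (by simp) (|1 + t|) (Set.mem_Ici.mpr (abs_nonneg _)) (1 - s) s (by linarith) hs0.le (by ring)
      simp only [smul_eq_mul, Real.one_rpow] at h3
      refine le_trans ?_ h3
      apply Real.rpow_le_rpow (abs_nonneg _) _ (by linarith)
      calc |1 + s * t| = |(1 - s) * 1 + s * (1 + t)| := by congr 1; ring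
        _ ≤ |(1 - s) * 1| + |s * (1 + t)| := abs_add_le _ _
        _ = _ := by rw [abs_mul, abs_mul, abs_of_nonneg (by linarith : 0 ≤ 1 - s), abs_of_pos hs0]; simp
    rw [h2, ← hc₁] at h1
    have h5 : s * (1 + q * t + c₁ / 2 * |t|) ≤ s * |1 + t| ^ q := by
      have : s * (c₁ / 2 * |t|) = c₁ / 4 := by
        rw [show s * (c₁ / 2 * |t|) = c₁ / 2 * (s * |t|) by ring, hst]; ring
      nlinarith
    exact le_of_mul_le_mul_left h5 hs0
  set T : ℝ := 24 ^ (1 / (q - 1)) with hT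
  have hTq : T ^ (q - 1) = 24 := by
    rw [hT, ← Real.rpow_mul (by norm_num)]
    rw [one_div_mul_cancel (by linarith)]; simp
  have hT2 : 2 ≤ T := by
    rw [hT]
    calc (2:ℝ) ≤ 24 ^ (1:ℝ) := by norm_num
      _ ≤ _ := Real.rpow_le_rpow_of_exponent_le (by norm_num) (by
        rw [le_div_iff₀ (by linarith)]; linarith)
  refine ⟨min (c₁ / 48) (1 / 8), by positivity, fun t ht => ?_⟩
  have ht0 : 0 < |t| := by linarith
  have hsplit : |t| ^ q = |t| ^ (q - 1) * |t| := by
    conv_rhs => rw [← Real.rpow_one |t|, ← Real.rpow_mul ht0.le, one_mul, ← Real.rpow_add ht0]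
    congr 1; ring
  have hpos : 0 ≤ |t| ^ q := by positivity
  rcases le_or_gt |t| T with h | h
  · have h1 : |t| ^ (q - 1) ≤ 24 := hTq ▸ Real.rpow_le_rpow ht0.le h (by linarith)
    have h2 := lin t ht
    have h3 : min (c₁ / 48) (1 / 8) * |t| ^ q ≤ c₁ / 48 * |t| ^ q := by gcongr; exact min_le_left _ _
    have h4 : c₁ / 48 * |t| ^ q ≤ c₁ / 48 * (24 * |t|) := by
      rw [hsplit]; gcongr
    linarith
  · have h1 : 24 ≤ |t| ^ (q - 1) := hTq ▸ Real.rpow_le_rpow (by linarith) h.le (by linarith)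
    have h3 : min (c₁ / 48) (1 / 8) * |t| ^ q ≤ 1 / 8 * |t| ^ q := by gcongr; exact min_le_right _ _
    have h4 : |t| / 2 ≤ |1 + t| := by
      have : |t| - 1 ≤ |1 + t| := by
        have := abs_sub_abs_le_abs_sub t (-1)
        rw [abs_neg, abs_one, sub_neg_eq_add, add_comm t 1] at this
        exact this
      linarith
    have h5 : 1 / 4 * |t| ^ q ≤ |1 + t| ^ q := by
      calc 1 / 4 * |t| ^ q ≤ (1 / 2) ^ q * |t| ^ q := by
            gcongr
            have := Real.rpow_le_rpow_of_exponent_ge (x := 1/2) (by norm_num) (by norm_num) hq2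
            norm_num at this ⊢
            exact this
        _ = (|t| / 2) ^ q := by rw [← Real.mul_rpow (by norm_num) ht0.le]; congr 1; ring
        _ ≤ _ := Real.rpow_le_rpow (by positivity) h4 (by linarith)
    have h6 : 24 * |t| ≤ |t| ^ q := by rw [hsplit]; gcongr
    have h7 : q * t ≤ 2 * |t| := by
      calc q * t ≤ q * |t| := by gcongr; exact le_abs_self t
        _ ≤ _ := by gcongr
    nlinarith

/-- strong convexity of `|y|^q`, `1 < q ≤ 2`. -/
theorem gf_convex_q {q : ℝ} (hq : 1 < q) (hq2 : q ≤ 2) : ∃ c : ℝ, 0 < c ∧ ∀ y b : ℝ,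
    |y| ^ q + q * (|y| ^ q / y) * b + c * (if |b| ≤ |y| / 2 then |y| ^ (q - 2) * b ^ 2 else |b| ^ q)
      ≤ |y + b| ^ q := by
  obtain ⟨c₂, hc₂, h2⟩ := gf_B2 hq hq2
  set c₁ := q * (q - 1) / 3 with hc₁
  have hc₁0 : 0 < c₁ := by have : 0 < q * (q - 1) := by nlinarith
                           positivity
  refine ⟨min 1 (min c₁ c₂), by positivity, fun y b => ?_⟩
  set c := min 1 (min c₁ c₂) with hc
  have hc1 : c ≤ 1 := min_le_left _ _
  have hcc1 : c ≤ c₁ := (min_le_right _ _).trans (min_le_left _ _)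
  have hcc2 : c ≤ c₂ := (min_le_right _ _).trans (min_le_right _ _)
  rcases eq_or_ne y 0 with rfl | hy
  · have : (0:ℝ) ^ q = 0 := Real.zero_rpow (by linarith)
    simp only [abs_zero, this, zero_div, mul_zero, zero_mul, add_zero, zero_add]
    split_ifs with h
    · have : b = 0 := by simpa using h
      subst this; simp [this]
    · have : 0 ≤ |b| ^ q := by positivity
      nlinarith
  · set t := b / y with ht
    have hb : b = t * y := by rw [ht]; field_simp
    have hya : 0 < |y| := abs_pos.mpr hy
    have e1 : |y + b| ^ q = |y| ^ q * |1 + t| ^ q := by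
      rw [← Real.mul_rpow (abs_nonneg _) (abs_nonneg _), ← abs_mul]; congr 2; rw [hb]; ring
    have e2 : |y| ^ q + q * (|y| ^ q / y) * b = |y| ^ q * (1 + q * t) := by rw [hb]; field_simp
    have e3 : |y| ^ (q - 2) * b ^ 2 = |y| ^ q * t ^ 2 := by
      rw [hb, Real.rpow_sub hya]
      have : |y| ^ (2:ℝ) = y ^ 2 := by
        rw [show (2:ℝ) = ((2:ℕ):ℝ) by norm_num, Real.rpow_natCast, sq_abs]
      rw [this]; field_simp
    have e4 : |b| ^ q = |y| ^ q * |t| ^ q := by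
      rw [← Real.mul_rpow (abs_nonneg _) (abs_nonneg _), ← abs_mul, hb, mul_comm]
    have hbt : |b| = |t| * |y| := by rw [hb, abs_mul]
    rw [e1, e2]
    split_ifs with h
    · rw [e3]
      have ht2 : |t| ≤ 1 / 2 := by rw [hbt] at h; nlinarith
      have := gf_B1 hq hq2 t ht2
      have h5 : 1 + q * t + c * t ^ 2 ≤ |1 + t| ^ q := by
        rw [← hc₁] at this; nlinarith [sq_nonneg t]
      calc _ = |y| ^ q * (1 + q * t + c * t ^ 2) := by ring
        _ ≤ _ := by gcongr
    · rw [e4]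
      have ht2 : 1 / 2 ≤ |t| := by rw [hbt] at h; nlinarith
      have := h2 t ht2
      have h5 : 1 + q * t + c * |t| ^ q ≤ |1 + t| ^ q := by
        have : 0 ≤ |t| ^ q := by positivity
        nlinarith
      calc _ = |y| ^ q * (1 + q * t + c * |t| ^ q) := by ring
        _ ≤ _ := by gcongr

set_option maxHeartbeats 1000000 in
/-- lower bound for the mixed term `u² |v|^s`. -/
theorem gf_mixed {p q : ℝ} (hpq : p.HolderConjugate q) (hp : 2 ≤ p) (x y a b : ℝ)
    (hy : y ≠ 0) (hxy : |x| ≤ |y| ^ (q - 1)) :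
    x ^ 2 * |y| ^ (2 - q) + 2 * x * |y| ^ (2 - q) * a + (2 - q) * x ^ 2 * (|y| ^ (2 - q) / y) * b
      + (if |b| ≤ |y| / 2 then 1 / 4 * |y| ^ (2 - q) * a ^ 2 - 33 * (|y| ^ (q - 2) * b ^ 2)
          else - (14 * |b| ^ q + 2 * |a| ^ p))
      ≤ (x + a) ^ 2 * |y + b| ^ (2 - q) := by
  have hq1 : 1 < q := hpq.symm.lt
  have hq2 : q ≤ 2 := by
    have := hpq.inv_add_inv_eq_one
    have h2 : p⁻¹ ≤ 1 / 2 := by rw [inv_le_comm₀ (by linarith) (by norm_num)]; simpa using hp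
    have h3 : 1 / 2 ≤ q⁻¹ := by linarith
    rw [le_inv_comm₀ (by norm_num) (by linarith)] at h3
    simpa using h3
  have hya : 0 < |y| := abs_pos.mpr hy
  set s := 2 - q with hs
  have hs0 : 0 ≤ s := by linarith
  have hs1 : s ≤ 1 := by linarith
  set Y := |y| ^ s with hY
  have hY0 : 0 < Y := by positivity
  have hx2 : x ^ 2 * Y ≤ |y| ^ q := by
    calc x ^ 2 * Y = |x| ^ 2 * Y := by rw [sq_abs]
      _ ≤ (|y| ^ (q - 1)) ^ 2 * Y := by gcongr
      _ = |y| ^ q := by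
        rw [hY, ← Real.rpow_natCast, ← Real.rpow_mul hya.le, ← Real.rpow_add hya]
        congr 1; push_cast; rw [hs]; ring
  set t := b / y with ht
  have hb : b = t * y := by rw [ht]; field_simp
  have hbt : |b| = |t| * |y| := by rw [hb, abs_mul]
  split_ifs with h
  · have ht2 : |t| ≤ 1 / 2 := by rw [hbt] at h; nlinarith
    have ht2' := abs_le.mp ht2
    set τ := |1 + t| ^ s with hτ
    have e1 : |y + b| ^ s = Y * τ := by
      rw [hY, hτ, ← Real.mul_rpow (abs_nonneg _) (abs_nonneg _), ← abs_mul]; congr 2; rw [hb]; ring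
    have e2 : |y| ^ (q - 2) * b ^ 2 = |y| ^ q * t ^ 2 := by
      rw [hb, Real.rpow_sub hya]
      have : |y| ^ (2:ℝ) = y ^ 2 := by
        rw [show (2:ℝ) = ((2:ℕ):ℝ) by norm_num, Real.rpow_natCast, sq_abs]
      rw [this]; field_simp
    have habs : |1 + t| = 1 + t := abs_of_pos (by linarith)
    have τ1 : τ ≤ 1 + s * t := by
      rw [hτ, habs]; exact rpow_one_add_le_one_add_mul_self (by linarith) hs0 hs1
    have τ2 : 1 + s * t - t ^ 2 / 2 ≤ τ := by
      have hden : 0 < 1 + (1 - s) * t := by nlinarith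
      have h1 : (1 + t) ^ (1 - s) ≤ 1 + (1 - s) * t :=
        rpow_one_add_le_one_add_mul_self (by linarith) (by linarith) (by linarith)
      have h2 : (1 + t) = (1 + t) ^ s * (1 + t) ^ (1 - s) := by
        rw [← Real.rpow_add (by linarith)]; simp
      have h3 : 1 + t ≤ τ * (1 + (1 - s) * t) := by
        rw [hτ, habs]
        calc 1 + t = (1 + t) ^ s * (1 + t) ^ (1 - s) := h2
          _ ≤ _ := by gcongr; exact Real.rpow_nonneg (by linarith) _
      have h4 : (1 + s * t - t ^ 2 / 2) * (1 + (1 - s) * t) ≤ 1 + t := by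
        have : 1 / 2 ≤ 1 + (1 - s) * t := by nlinarith
        have h5 : s * (1 - s) ≤ 1 / 4 := by nlinarith [sq_nonneg (s - 1 / 2)]
        nlinarith [sq_nonneg t, mul_nonneg (sq_nonneg t) (by linarith : 0 ≤ 1 + (1 - s) * t - 1 / 2), mul_nonneg (sq_nonneg t) (by linarith : 0 ≤ 1 / 4 - s * (1 - s))]
      exact le_of_mul_le_mul_right (h4.trans h3) hden
    have hst : |s * t| ≤ |t| := by rw [abs_mul, abs_of_nonneg hs0]; nlinarith [abs_nonneg t]
    have hst' := abs_le.mp hst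
    have htt : t ^ 2 ≤ |t| / 2 := by rw [← sq_abs]; nlinarith [abs_nonneg t]
    have τ3 : 3 / 8 ≤ τ := by linarith
    have τ4 : |τ - 1| ≤ 2 * |t| := abs_le.mpr ⟨by linarith [abs_nonneg t], by linarith [abs_nonneg t]⟩
    rw [e1, e2]
    have k1 : - (a ^ 2 / 8 + 32 * (x ^ 2 * t ^ 2)) ≤ 2 * x * a * (τ - 1) := by
      have : |2 * x * a * (τ - 1)| ≤ 2 * |x| * |a| * (2 * |t|) := by
        rw [abs_mul, abs_mul, abs_mul, abs_two]; gcongr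
      have h2 := (abs_le.mp this).1
      have : 2 * |x| * |a| * (2 * |t|) ≤ a ^ 2 / 8 + 32 * (x ^ 2 * t ^ 2) := by
        have := sq_nonneg (|a| - 16 * (|x| * |t|))
        have e : (|a| - 16 * (|x| * |t|)) ^ 2
            = |a| ^ 2 - 32 * (|x| * |a| * |t|) + 256 * (|x| ^ 2 * |t| ^ 2) := by ring
        rw [e, sq_abs, sq_abs, sq_abs] at this
        linarith
      linarith
    have k2 : 1 / 4 * a ^ 2 - 33 * (x ^ 2 * t ^ 2) ≤
        a ^ 2 * τ + 2 * x * a * (τ - 1) + x ^ 2 * (τ - 1 - s * t) := by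
      have h1 : x ^ 2 * (- (t ^ 2 / 2)) ≤ x ^ 2 * (τ - 1 - s * t) := by gcongr; linarith
      have h2 : a ^ 2 * (3 / 8) ≤ a ^ 2 * τ := by gcongr
      linarith [mul_nonneg (sq_nonneg x) (sq_nonneg t)]
    have k3 := mul_le_mul_of_nonneg_left k2 hY0.le
    have k4 : 33 * (x ^ 2 * Y * t ^ 2) ≤ 33 * (|y| ^ q * t ^ 2) := by gcongr
    have e3 : s * x ^ 2 * (Y / y) * b = s * x ^ 2 * Y * t := by rw [hb]; field_simp
    rw [e3]
    linarith
  · have h' : |y| ≤ 2 * |b| := by linarith [not_le.mp h]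
    have hb0 : 0 < |b| := by linarith
    have b1 : |y| ^ q ≤ 4 * |b| ^ q := by
      calc |y| ^ q ≤ (2 * |b|) ^ q := Real.rpow_le_rpow hya.le h' (by linarith)
        _ = 2 ^ q * |b| ^ q := Real.mul_rpow (by norm_num) hb0.le
        _ ≤ 2 ^ (2:ℝ) * |b| ^ q := by gcongr; norm_num
        _ = _ := by norm_num
    have b2 : |x * Y * a| ≤ |a| ^ p + |y| ^ q := by
      have h1 : |x| * Y ≤ |y| := by
        calc |x| * Y ≤ |y| ^ (q - 1) * Y := by gcongr
          _ = |y| := by rw [hY, ← Real.rpow_add hya, hs]; ring_nf; simp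
      have h2 := Real.young_inequality_of_nonneg (abs_nonneg a) (abs_nonneg y) hpq
      have h3 : |a| ^ p / p ≤ |a| ^ p := div_le_self (by positivity) (by linarith)
      have h4 : |y| ^ q / q ≤ |y| ^ q := div_le_self (by positivity) (by linarith)
      calc |x * Y * a| = |x| * Y * |a| := by rw [abs_mul, abs_mul, abs_of_pos hY0]
        _ ≤ |y| * |a| := by gcongr
        _ ≤ _ := by linarith
    have b3 : |s * x ^ 2 * (Y / y) * b| ≤ 2 * |b| ^ q := by
      have h1 : |s * x ^ 2 * (Y / y) * b| = s * (x ^ 2 * Y / |y|) * |b| := by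
        rw [abs_mul, abs_mul, abs_mul, abs_div, abs_of_nonneg hs0, abs_of_pos hY0, abs_of_nonneg (sq_nonneg x)]
        ring
      have h2 : x ^ 2 * Y / |y| ≤ |y| ^ (q - 1) := by
        rw [div_le_iff₀ hya]
        refine hx2.trans (le_of_eq ?_)
        conv_rhs => rw [← Real.rpow_one |y|, ← Real.rpow_mul hya.le, one_mul, ← Real.rpow_add hya]
        congr 1; ring
      have h3 : |y| ^ (q - 1) ≤ 2 * |b| ^ (q - 1) := by
        calc |y| ^ (q-1) ≤ (2 * |b|) ^ (q-1) := Real.rpow_le_rpow hya.le h' (by linarith)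
          _ = 2 ^ (q-1) * |b| ^ (q-1) := Real.mul_rpow (by norm_num) hb0.le
          _ ≤ 2 ^ (1:ℝ) * |b| ^ (q-1) := by gcongr; norm_num; linarith
          _ = _ := by norm_num
      have h4 : |b| ^ (q - 1) * |b| = |b| ^ q := by
        conv_lhs => rw [← Real.rpow_one |b|, ← Real.rpow_mul hb0.le, one_mul, ← Real.rpow_add hb0]
        congr 1; ring
      rw [h1]
      calc s * (x ^ 2 * Y / |y|) * |b| ≤ 1 * (2 * |b| ^ (q - 1)) * |b| := by
            gcongr; exact h2.trans h3
        _ = _ := by rw [← h4]; ring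
    have hpos : 0 ≤ (x + a) ^ 2 * |y + b| ^ s := by positivity
    have c2 := (abs_le.mp b2).2
    have c3 := (abs_le.mp b3).2
    nlinarith

set_option maxHeartbeats 1000000 in
/-- The Bellman function. -/
theorem gf_bellman {p q : ℝ} (hpq : p.HolderConjugate q) (hp : 2 ≤ p) :
    ∃ (Q : ℝ → ℝ → ℝ) (c C : ℝ), 0 < c ∧ 0 < C ∧ Continuous (fun z : ℝ × ℝ => Q z.1 z.2) ∧
      (∀ x y, 0 ≤ Q x y) ∧ (∀ x y, Q x y ≤ C * (|x| ^ p + |y| ^ q)) ∧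
      ∀ x y, ∃ l m : ℝ, ∀ a b, Q x y + l * a + m * b + c * (|a| * |b|) ≤ Q (x + a) (y + b) := by
  have hq1 : 1 < q := hpq.symm.lt
  have hq2 : q ≤ 2 := by
    have := hpq.inv_add_inv_eq_one
    have h2 : p⁻¹ ≤ 1 / 2 := by rw [inv_le_comm₀ (by linarith) (by norm_num)]; simpa using hp
    have h3 : 1 / 2 ≤ q⁻¹ := by linarith
    rw [le_inv_comm₀ (by norm_num) (by linarith)] at h3
    simpa using h3
  have hexp : (q - 1) * (p - 2) = 2 - q := by
    have := hpq.mul_eq_add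
    nlinarith
  obtain ⟨c₁, hc₁, H1⟩ := gf_convex_p hp
  obtain ⟨c₂, hc₂, H2⟩ := gf_convex_q hq1 hq2
  set δ := min (c₁ / 4) (c₂ / 66) with hδ
  have hδ0 : 0 < δ := by positivity
  have hδ1 : δ ≤ c₁ / 4 := min_le_left _ _
  have hδ2 : δ ≤ c₂ / 66 := min_le_right _ _
  set c := min (min (c₁ / 2) (c₂ / 2)) (δ / 4) with hc
  have hc0 : 0 < c := by positivity
  have hcc1 : c ≤ c₁ / 2 := (min_le_left _ _).trans (min_le_left _ _)
  have hcc2 : c ≤ c₂ / 2 := (min_le_left _ _).trans (min_le_right _ _)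
  have hcc3 : c ≤ δ / 4 := min_le_right _ _
  have young : ∀ a b : ℝ, |a| * |b| ≤ |a| ^ p + |b| ^ q := by
    intro a b
    have h2 := Real.young_inequality_of_nonneg (abs_nonneg a) (abs_nonneg b) hpq
    have h3 : |a| ^ p / p ≤ |a| ^ p := div_le_self (by positivity) (by linarith)
    have h4 : |b| ^ q / q ≤ |b| ^ q := div_le_self (by positivity) (by linarith)
    linarith
  refine ⟨fun u v => |u| ^ p + |v| ^ q + δ * max (|u| ^ p) (u ^ 2 * |v| ^ (2 - q)), c, 1 + δ, hc0,
    by positivity, ?_, fun x y => by positivity, ?_, ?_⟩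
  · have h1 : Continuous fun z : ℝ × ℝ => |z.1| ^ p :=
      (continuous_abs.comp continuous_fst).rpow_const fun _ => Or.inr (by linarith)
    have h2 : Continuous fun z : ℝ × ℝ => |z.2| ^ q :=
      (continuous_abs.comp continuous_snd).rpow_const fun _ => Or.inr (by linarith)
    have h3 : Continuous fun z : ℝ × ℝ => |z.2| ^ (2 - q) :=
      (continuous_abs.comp continuous_snd).rpow_const fun _ => Or.inr (by linarith)
    fun_prop
  · intro x y
    have : max (|x| ^ p) (x ^ 2 * |y| ^ (2 - q)) ≤ |x| ^ p + |y| ^ q := by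
      apply max_le
      · have : 0 ≤ |y| ^ q := by positivity
        linarith
      · rcases le_total (|y| ^ (q - 1)) |x| with h | h
        · have h1 : |y| ^ (2 - q) ≤ |x| ^ (p - 2) := by
            rw [← hexp, Real.rpow_mul (abs_nonneg _)]
            exact Real.rpow_le_rpow (by positivity) h (by linarith)
          have h2 : x ^ 2 * |x| ^ (p - 2) ≤ |x| ^ p := by
            rcases eq_or_ne x 0 with rfl | hx
            · simp; positivity
            · rw [← sq_abs, ← Real.rpow_natCast, ← Real.rpow_add (abs_pos.mpr hx)]
              apply le_of_eq; congr 1; push_cast; ring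
          calc x ^ 2 * |y| ^ (2 - q) ≤ x ^ 2 * |x| ^ (p - 2) := by gcongr
            _ ≤ |x| ^ p := h2
            _ ≤ _ := by have : 0 ≤ |y| ^ q := by positivity
                        linarith
        · have h2 : x ^ 2 * |y| ^ (2 - q) ≤ |y| ^ q := by
            rcases eq_or_ne y 0 with rfl | hy
            · rw [abs_zero, Real.zero_rpow (by linarith : q - 1 ≠ 0)] at h
              have : x = 0 := by simpa using h
              subst this; simp; positivity
            · calc x ^ 2 * |y| ^ (2 - q) = |x| ^ 2 * |y| ^ (2 - q) := by rw [sq_abs]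
                _ ≤ (|y| ^ (q - 1)) ^ 2 * |y| ^ (2 - q) := by gcongr
                _ = |y| ^ q := by
                  rw [← Real.rpow_natCast, ← Real.rpow_mul (abs_nonneg _), ← Real.rpow_add (abs_pos.mpr hy)]
                  congr 1; push_cast; ring
          have : 0 ≤ |x| ^ p := by positivity
          linarith
    nlinarith
  · intro x y
    rcases le_or_gt (|y| ^ (q - 1)) |x| with hreg | hreg
    · -- region 1
      have h1 : |y| ^ (2 - q) ≤ |x| ^ (p - 2) := by
        rw [← hexp, Real.rpow_mul (abs_nonneg _)]
        exact Real.rpow_le_rpow (by positivity) hreg (by linarith)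
      have hmax : max (|x| ^ p) (x ^ 2 * |y| ^ (2 - q)) = |x| ^ p := by
        apply max_eq_left
        rcases eq_or_ne x 0 with rfl | hx
        · simp; positivity
        · calc x ^ 2 * |y| ^ (2 - q) ≤ x ^ 2 * |x| ^ (p - 2) := by gcongr
            _ = |x| ^ p := by
              rw [← sq_abs, ← Real.rpow_natCast, ← Real.rpow_add (abs_pos.mpr hx)]
              congr 1; push_cast; ring
      refine ⟨(1 + δ) * (p * (|x| ^ p / x)), q * (|y| ^ q / y), fun a b => ?_⟩
      simp only [hmax]
      have A1 := H1 x a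
      have A2 := H2 y b
      have A3 := gf_tangent (p := p) (by linarith) x a
      have A4 := le_max_left (|x + a| ^ p) ((x + a) ^ 2 * |y + b| ^ (2 - q))
      have A5 : c * (|a| * |b|) ≤ c₁ * (|x| ^ (p - 2) * a ^ 2 + |a| ^ p)
          + c₂ * (if |b| ≤ |y| / 2 then |y| ^ (q - 2) * b ^ 2 else |b| ^ q) := by
        split_ifs with hb
        · have hpa : 0 ≤ |a| ^ p := by positivity
          have : |a| * |b| ≤ |x| ^ (p - 2) * a ^ 2 + |y| ^ (q - 2) * b ^ 2 := by
            rcases eq_or_ne y 0 with rfl | hy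
            · have : b = 0 := by simpa using hb
              subst this; simp; positivity
            · have hya : 0 < |y| := abs_pos.mpr hy
              have e : |y| ^ (q - 2) = (|y| ^ (2 - q))⁻¹ := by rw [← Real.rpow_neg hya.le]; congr 1; ring
              have hY : 0 < |y| ^ (2 - q) := by positivity
              have h2 : |y| ^ (2 - q) * a ^ 2 ≤ |x| ^ (p - 2) * a ^ 2 := by gcongr
              have h3 : |a| * |b| ≤ |y| ^ (2 - q) * a ^ 2 + |y| ^ (q - 2) * b ^ 2 := by
                rw [e, ← sq_abs a, ← sq_abs b, ← sub_nonneg]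
                have : |y| ^ (2 - q) * |a| ^ 2 + (|y| ^ (2 - q))⁻¹ * |b| ^ 2 - |a| * |b|
                    = (|y| ^ (2 - q))⁻¹ * ((|y| ^ (2 - q) * |a| - |b|) ^ 2 + (|y| ^ (2 - q) * |a|) * |b|) := by
                  field_simp; ring
                rw [this]; positivity
              linarith
          have z1 : 0 ≤ |x| ^ (p - 2) * a ^ 2 := by positivity
          have z2 : 0 ≤ |y| ^ (q - 2) * b ^ 2 := by positivity
          nlinarith
        · have := young a b
          have z1 : 0 ≤ |x| ^ (p - 2) * a ^ 2 := by positivity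
          have z2 : 0 ≤ |a| ^ p := by positivity
          have z3 : 0 ≤ |b| ^ q := by positivity
          nlinarith
      have A6 : δ * (|x| ^ p + p * (|x| ^ p / x) * a) ≤ δ * max (|x + a| ^ p) ((x + a) ^ 2 * |y + b| ^ (2 - q)) := by
        gcongr; exact A3.trans A4
      linarith
    · -- region 2
      have hy : y ≠ 0 := by
        rintro rfl
        rw [abs_zero, Real.zero_rpow (by linarith : q - 1 ≠ 0)] at hreg
        linarith [abs_nonneg x]
      have hya : 0 < |y| := abs_pos.mpr hy
      have hmax : max (|x| ^ p) (x ^ 2 * |y| ^ (2 - q)) = x ^ 2 * |y| ^ (2 - q) := by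
        apply max_eq_right
        rcases eq_or_ne x 0 with rfl | hx
        · rw [abs_zero, Real.zero_rpow (by linarith)]; simp
        · have h1 : |x| ^ (p - 2) ≤ |y| ^ (2 - q) := by
            rw [← hexp, Real.rpow_mul (abs_nonneg _)]
            exact Real.rpow_le_rpow (by positivity) hreg.le (by linarith)
          calc |x| ^ p = x ^ 2 * |x| ^ (p - 2) := by
                rw [← sq_abs x, ← Real.rpow_natCast, ← Real.rpow_add (abs_pos.mpr hx)]
                congr 1; push_cast; ring
            _ ≤ _ := by gcongr
      refine ⟨p * (|x| ^ p / x) + δ * (2 * x * |y| ^ (2 - q)),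
        q * (|y| ^ q / y) + δ * ((2 - q) * x ^ 2 * (|y| ^ (2 - q) / y)), fun a b => ?_⟩
      simp only [hmax]
      have A1 := H1 x a
      have A2 := H2 y b
      have A3 := gf_mixed hpq hp x y a b hy hreg.le
      have A4 := le_max_right (|x + a| ^ p) ((x + a) ^ 2 * |y + b| ^ (2 - q))
      have A5 := mul_le_mul_of_nonneg_left (A3.trans A4) hδ0.le
      have A6 : c * (|a| * |b|) ≤ c₁ * (|x| ^ (p - 2) * a ^ 2 + |a| ^ p)
          + c₂ * (if |b| ≤ |y| / 2 then |y| ^ (q - 2) * b ^ 2 else |b| ^ q)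
          + δ * (if |b| ≤ |y| / 2 then 1 / 4 * |y| ^ (2 - q) * a ^ 2 - 33 * (|y| ^ (q - 2) * b ^ 2)
              else - (14 * |b| ^ q + 2 * |a| ^ p)) := by
        have z1 : 0 ≤ |x| ^ (p - 2) * a ^ 2 := by positivity
        have z2 : 0 ≤ |a| ^ p := by positivity
        split_ifs with hb
        · have e : |y| ^ (q - 2) = (|y| ^ (2 - q))⁻¹ := by rw [← Real.rpow_neg hya.le]; congr 1; ring
          have hY : 0 < |y| ^ (2 - q) := by positivity
          have h3 : |a| * |b| ≤ |y| ^ (2 - q) * a ^ 2 + |y| ^ (q - 2) * b ^ 2 := by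
            rw [e, ← sq_abs a, ← sq_abs b, ← sub_nonneg]
            have : |y| ^ (2 - q) * |a| ^ 2 + (|y| ^ (2 - q))⁻¹ * |b| ^ 2 - |a| * |b|
                = (|y| ^ (2 - q))⁻¹ * ((|y| ^ (2 - q) * |a| - |b|) ^ 2 + (|y| ^ (2 - q) * |a|) * |b|) := by
              field_simp; ring
            rw [this]; positivity
          have z3 : 0 ≤ |y| ^ (2 - q) * a ^ 2 := by positivity
          have z4 : 0 ≤ |y| ^ (q - 2) * b ^ 2 := by positivity
          have e5 : 1 / 4 * |y| ^ (2 - q) * a ^ 2 = 1 / 4 * (|y| ^ (2 - q) * a ^ 2) := by ring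
          rw [e5]
          clear A1 A2 A3 A4 A5 e5 e hY
          generalize |y| ^ (2 - q) * a ^ 2 = Z3 at *
          generalize |y| ^ (q - 2) * b ^ 2 = Z4 at *
          generalize |a| * |b| = Z5 at *
          nlinarith
        · have := young a b
          have z3 : 0 ≤ |b| ^ q := by positivity
          nlinarith
      linarith

/-- discrete averaging operator -/
def gP {ι : Type} [Fintype ι] (w : ι → ℝ) (z : ι → En n) (f : En n → ℝ) : En n → ℝ :=
  fun x => ∑ i, w i * f (x + z i)

/-- discrete difference -/
def gD {ι : Type} [Fintype ι] (w : ι → ℝ) (z : ι → En n) (i : ι) (f : En n → ℝ) : En n → ℝ :=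
  fun x => f (x + z i) - gP w z f x

theorem gf_shift_memLp {f : En n → ℝ} {p : ℝ≥0∞} (hf : MemLp f p) (a : En n) :
    MemLp (fun x => f (x + a)) p :=
  hf.comp_measurePreserving (measurePreserving_add_right volume a)

section
variable {ι : Type} [Fintype ι] {w : ι → ℝ} {z : ι → En n}

theorem gP_memLp {f : En n → ℝ} {p : ℝ≥0∞} (hf : MemLp f p) : MemLp (gP w z f) p := by
  unfold gP
  exact memLp_finsetSum _ fun i _ => (gf_shift_memLp hf (z i)).const_mul (w i)

theorem gPk_memLp {f : En n → ℝ} {p : ℝ≥0∞} (hf : MemLp f p) (m : ℕ) :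
    MemLp ((gP w z)^[m] f) p := by
  induction m with
  | zero => simpa
  | succ m ih => rw [Function.iterate_succ_apply']; exact gP_memLp ih

theorem gD_memLp {f : En n → ℝ} {p : ℝ≥0∞} (hf : MemLp f p) (i : ι) : MemLp (gD w z i f) p :=
  (gf_shift_memLp hf (z i)).sub (gP_memLp hf)

theorem gf_integrable_mul {p q : ℝ} (hpq : p.HolderConjugate q) {f g : En n → ℝ}
    (hf : MemLp f (ENNReal.ofReal p)) (hg : MemLp g (ENNReal.ofReal q)) :
    Integrable (fun x => f x * g x) := by
  have : ENNReal.HolderConjugate (ENNReal.ofReal p) (ENNReal.ofReal q) := hpq.ennrealOfReal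
  exact hf.integrable_mul hg

theorem gf_memLp_abs_pow {p : ℝ} (hp : 1 < p) {f : En n → ℝ}
    (hf : MemLp f (ENNReal.ofReal p)) : Integrable (fun x => |f x| ^ p) := by
  have := hf.integrable_norm_rpow (by simp; linarith) (by simp)
  rw [ENNReal.toReal_ofReal (by linarith)] at this
  simpa using this

/-- real valued `L^p` norm -/
def lpn (p : ℝ) (f : En n → ℝ) : ℝ := (eLpNorm f (ENNReal.ofReal p) volume).toReal

theorem lpn_pow {p : ℝ} (hp : 1 < p) {f : En n → ℝ}
    (hf : MemLp f (ENNReal.ofReal p)) : lpn p f ^ p = ∫ x, |f x| ^ p := by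
  unfold lpn
  rw [hf.eLpNorm_eq_integral_rpow_norm (by simp; linarith) (by simp),
    ENNReal.toReal_ofReal (by positivity), ENNReal.toReal_ofReal (by linarith),
    ← Real.rpow_mul (by positivity), inv_mul_cancel₀ (by linarith), Real.rpow_one]
  simp

theorem gD_smul (c : ℝ) (f : En n → ℝ) (i : ι) : gD w z i (fun x => c * f x) = fun x => c * gD w z i f x := by
  funext x
  simp only [gD, gP, mul_sub, Finset.mul_sum]
  congr 1
  exact Finset.sum_congr rfl fun _ _ => by ring

theorem gP_smul (c : ℝ) (f : En n → ℝ) : gP w z (fun x => c * f x) = fun x => c * gP w z f x := by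
  funext x
  simp only [gP, Finset.mul_sum]
  exact Finset.sum_congr rfl fun _ _ => by ring

theorem gPk_smul (c : ℝ) (f : En n → ℝ) (m : ℕ) :
    (gP w z)^[m] (fun x => c * f x) = fun x => c * (gP w z)^[m] f x := by
  induction m with
  | zero => rfl
  | succ m ih => simp only [Function.iterate_succ_apply', ih, gP_smul]

theorem gf_bellman_pt {Q : ℝ → ℝ → ℝ} {c : ℝ} 
    (hQ : ∀ x y, ∃ l m, ∀ a b, Q x y + l*a + m*b + c * (|a| * |b|) ≤ Q (x+a) (y+b))
    (hw : ∀ i, 0 ≤ w i) (hw1 : ∑ i, w i = 1) (f g : En n → ℝ) (x : En n) :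
    Q (gP w z f x) (gP w z g x) + c * ∑ i, w i * (|gD w z i f x| * |gD w z i g x|)
      ≤ ∑ i, w i * Q (f (x + z i)) (g (x + z i)) := by
  obtain ⟨l, m, h⟩ := hQ (gP w z f x) (gP w z g x)
  have h0 : ∀ f : En n → ℝ, ∑ i, w i * gD w z i f x = 0 := by
    intro f
    simp only [gD, mul_sub, Finset.sum_sub_distrib, ← Finset.sum_mul, hw1]
    simp [gP]
  calc _ = ∑ i, w i * (Q (gP w z f x) (gP w z g x) + l * gD w z i f x + m * gD w z i g x
          + c * (|gD w z i f x| * |gD w z i g x|)) := by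
        simp only [mul_add, Finset.sum_add_distrib, ← Finset.sum_mul, hw1]
        have e1 : ∑ i, w i * (l * gD w z i f x) = l * ∑ i, w i * gD w z i f x := by
          rw [Finset.mul_sum]; exact Finset.sum_congr rfl fun _ _ => by ring
        have e2 : ∑ i, w i * (m * gD w z i g x) = m * ∑ i, w i * gD w z i g x := by
          rw [Finset.mul_sum]; exact Finset.sum_congr rfl fun _ _ => by ring
        rw [e1, e2, h0, h0, Finset.mul_sum]
        simp only [mul_zero, add_zero, one_mul]
        congr 1
        exact Finset.sum_congr rfl fun _ _ => by ring
    _ ≤ _ := by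
        refine Finset.sum_le_sum fun i _ => mul_le_mul_of_nonneg_left ?_ (hw i)
        have := h (gD w z i f x) (gD w z i g x)
        simpa [gD] using this

/-- the form controlled by the Bellman function -/
def gA (w : ι → ℝ) (z : ι → En n) (m : ℕ) (f g : En n → ℝ) : ℝ :=
  ∑ k ∈ Finset.range m, ∑ i, w i * ∫ x, |gD w z i ((gP w z)^[k] f) x| * |gD w z i ((gP w z)^[k] g) x|

theorem gf_abs_integrable {p q : ℝ} (hpq : p.HolderConjugate q) {f g : En n → ℝ}
    (hf : MemLp f (ENNReal.ofReal p)) (hg : MemLp g (ENNReal.ofReal q)) (i : ι) :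
    Integrable (fun x => |gD w z i f x| * |gD w z i g x|) := by
  have := (gf_integrable_mul hpq (gD_memLp (w := w) (z := z) hf i) (gD_memLp (w := w) (z := z) hg i)).abs
  simpa [abs_mul] using this

theorem gf_telescope {p q : ℝ} (hpq : p.HolderConjugate q) {Q : ℝ → ℝ → ℝ} {c C : ℝ}
    (hcont : Continuous (fun z : ℝ × ℝ => Q z.1 z.2)) (h0 : ∀ x y, 0 ≤ Q x y)
    (hC : ∀ x y, Q x y ≤ C * (|x| ^ p + |y| ^ q))
    (hQ : ∀ x y, ∃ l m, ∀ a b, Q x y + l*a + m*b + c * (|a| * |b|) ≤ Q (x+a) (y+b))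
    (hw : ∀ i, 0 ≤ w i) (hw1 : ∑ i, w i = 1) {f g : En n → ℝ}
    (hf : MemLp f (ENNReal.ofReal p)) (hg : MemLp g (ENNReal.ofReal q)) (m : ℕ) :
    c * gA w z m f g ≤ C * ((∫ x, |f x| ^ p) + ∫ x, |g x| ^ q) := by
  have hInteg : ∀ f g : En n → ℝ, MemLp f (ENNReal.ofReal p) → MemLp g (ENNReal.ofReal q) →
      Integrable (fun x => Q (f x) (g x)) := by
    intro f g hf hg
    refine Integrable.mono' (((gf_memLp_abs_pow hpq.lt hf).add
      (gf_memLp_abs_pow hpq.symm.lt hg)).const_mul C) ?_ (Eventually.of_forall fun x => ?_)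
    · exact hcont.comp_aestronglyMeasurable (hf.1.prodMk hg.1)
    · rw [Real.norm_of_nonneg (h0 _ _)]; exact hC _ _
  have hstep : ∀ f g : En n → ℝ, MemLp f (ENNReal.ofReal p) → MemLp g (ENNReal.ofReal q) →
      (∫ x, Q (gP w z f x) (gP w z g x)) + c * ∑ i, w i * ∫ x, |gD w z i f x| * |gD w z i g x|
        ≤ ∫ x, Q (f x) (g x) := by
    intro f g hf hg
    have e1 : ∫ x, Q (f x) (g x) = ∫ x, ∑ i, w i * Q (f (x + z i)) (g (x + z i)) := by
      rw [integral_finset_sum _ fun i _ => (hInteg _ _ (gf_shift_memLp hf (z i)) (gf_shift_memLp hg (z i))).const_mul _]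
      simp only [integral_const_mul]
      have : ∀ i, ∫ x, Q (f (x + z i)) (g (x + z i)) = ∫ x, Q (f x) (g x) := fun i =>
        integral_add_right_eq_self (fun x => Q (f x) (g x)) (z i)
      simp only [this, ← Finset.sum_mul, hw1, one_mul]
    have I2 : Integrable fun x => ∑ i, w i * (|gD w z i f x| * |gD w z i g x|) :=
      integrable_finset_sum _ fun i _ => (gf_abs_integrable hpq hf hg i).const_mul _
    have e2 : ∑ i, w i * ∫ x, |gD w z i f x| * |gD w z i g x|
        = ∫ x, ∑ i, w i * (|gD w z i f x| * |gD w z i g x|) := by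
      rw [integral_finset_sum _ fun i _ => (gf_abs_integrable hpq hf hg i).const_mul _]
      simp only [integral_const_mul]
    rw [e1, e2, ← integral_const_mul, ← integral_add (hInteg _ _ (gP_memLp hf) (gP_memLp hg)) (I2.const_mul _)]
    refine integral_mono ((hInteg _ _ (gP_memLp hf) (gP_memLp hg)).add (I2.const_mul _)) ?_ ?_
    · exact integrable_finset_sum _ fun i _ =>
        (hInteg _ _ (gf_shift_memLp hf (z i)) (gf_shift_memLp hg (z i))).const_mul _
    · intro x
      exact gf_bellman_pt hQ hw hw1 f g x
  have key : ∀ m, (∫ x, Q ((gP w z)^[m] f x) ((gP w z)^[m] g x)) + c * gA w z m f g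
      ≤ ∫ x, Q (f x) (g x) := by
    intro m
    induction m with
    | zero => simp [gA]
    | succ m ih =>
      have := hstep _ _ (gPk_memLp (w := w) (z := z) hf m) (gPk_memLp (w := w) (z := z) hg m)
      simp only [gA, Finset.sum_range_succ, Function.iterate_succ_apply'] at *
      linarith
  have h1 := key m
  have h2 : 0 ≤ ∫ x, Q ((gP w z)^[m] f x) ((gP w z)^[m] g x) := integral_nonneg fun x => h0 _ _
  have h3 : ∫ x, Q (f x) (g x) ≤ C * ((∫ x, |f x| ^ p) + ∫ x, |g x| ^ q) := by
    rw [← integral_add (gf_memLp_abs_pow hpq.lt hf) (gf_memLp_abs_pow hpq.symm.lt hg), ← integral_const_mul]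
    exact integral_mono (hInteg _ _ hf hg) (((gf_memLp_abs_pow hpq.lt hf).add
      (gf_memLp_abs_pow hpq.symm.lt hg)).const_mul C) fun x => hC _ _
  linarith

theorem gA_smul (m : ℕ) (f g : En n → ℝ) {a b : ℝ} (ha : 0 ≤ a) (hb : 0 ≤ b) :
    gA w z m (fun x => a * f x) (fun x => b * g x) = a * b * gA w z m f g := by
  simp only [gA, gPk_smul, gD_smul, Finset.mul_sum, abs_mul, abs_of_nonneg ha, abs_of_nonneg hb]
  refine Finset.sum_congr rfl fun k _ => Finset.sum_congr rfl fun i _ => ?_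
  rw [mul_left_comm, ← integral_const_mul (a * b)]
  congr 2
  funext x; ring

theorem gA_comm (m : ℕ) (f g : En n → ℝ) : gA w z m f g = gA w z m g f := by
  simp only [gA, mul_comm]

theorem lpn_nonneg (p : ℝ) (f : En n → ℝ) : 0 ≤ lpn p f := ENNReal.toReal_nonneg

theorem gf_gA_bound_aux {p q : ℝ} (hpq : p.HolderConjugate q) (hp : 2 ≤ p) :
    ∃ C : ℝ, 0 < C ∧ ∀ {n : ℕ} {ι : Type} [Fintype ι] (w : ι → ℝ) (z : ι → En n),
      (∀ i, 0 ≤ w i) → (∑ i, w i = 1) → ∀ (f g : En n → ℝ),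
      MemLp f (ENNReal.ofReal p) → MemLp g (ENNReal.ofReal q) → ∀ m : ℕ,
      gA w z m f g ≤ C * (lpn p f * lpn q g) := by
  obtain ⟨Q, c, C, hc, hC, hcont, h0, hCb, hQ⟩ := gf_bellman hpq hp
  refine ⟨2 * C / c, by positivity, ?_⟩
  intro n ι _ w z hw hw1 f g hf hg m
  have main : ∀ ε : ℝ, 0 < ε → gA w z m f g ≤ 2 * C / c * ((lpn p f + ε) * (lpn q g + ε)) := by
    intro ε hε
    have ha : 0 < lpn p f + ε := by have := lpn_nonneg p f; linarith
    have hb : 0 < lpn q g + ε := by have := lpn_nonneg q g; linarith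
    set a := lpn p f + ε
    set b := lpn q g + ε
    have h1 := gf_telescope hpq hcont h0 hCb hQ hw hw1 (z := z) (hf.const_mul a⁻¹) (hg.const_mul b⁻¹) m
    rw [gA_smul m f g (by positivity) (by positivity)] at h1
    have h2 : ∫ x, |a⁻¹ * f x| ^ p ≤ 1 := by
      have : ∀ x, |a⁻¹ * f x| ^ p = (a⁻¹) ^ p * |f x| ^ p := fun x => by
        rw [abs_mul, Real.mul_rpow (abs_nonneg _) (abs_nonneg _), abs_of_pos (by positivity)]
      simp only [this, integral_const_mul]
      rw [← lpn_pow hpq.lt hf, ← Real.mul_rpow (by positivity) (lpn_nonneg _ _)]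
      refine Real.rpow_le_one (mul_nonneg (by positivity) (lpn_nonneg _ _)) ?_ (by linarith)
      rw [inv_mul_le_one₀ ha]; simp only [a]; linarith
    have h3 : ∫ x, |b⁻¹ * g x| ^ q ≤ 1 := by
      have : ∀ x, |b⁻¹ * g x| ^ q = (b⁻¹) ^ q * |g x| ^ q := fun x => by
        rw [abs_mul, Real.mul_rpow (abs_nonneg _) (abs_nonneg _), abs_of_pos (by positivity)]
      simp only [this, integral_const_mul]
      rw [← lpn_pow hpq.symm.lt hg, ← Real.mul_rpow (by positivity) (lpn_nonneg _ _)]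
      refine Real.rpow_le_one (mul_nonneg (by positivity) (lpn_nonneg _ _)) ?_ hpq.symm.nonneg
      rw [inv_mul_le_one₀ hb]; simp only [b]; linarith
    have h4 : c * (a⁻¹ * b⁻¹ * gA w z m f g) ≤ 2 * C := by nlinarith
    have h5 : gA w z m f g = (c * (a⁻¹ * b⁻¹ * gA w z m f g)) * (a * b / c) := by
      field_simp
    rw [h5]
    calc _ ≤ 2 * C * (a * b / c) := by gcongr
      _ = _ := by ring
  have : Tendsto (fun ε : ℝ => 2 * C / c * ((lpn p f + ε) * (lpn q g + ε))) (nhdsWithin 0 (Set.Ioi 0))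
      (nhds (2 * C / c * ((lpn p f + 0) * (lpn q g + 0)))) := by
    apply Tendsto.mono_left _ nhdsWithin_le_nhds
    apply Continuous.tendsto'
    · fun_prop
    · rfl
  simp only [add_zero] at this
  exact ge_of_tendsto this (eventually_nhdsWithin_of_forall fun ε hε => main ε hε)

theorem gf_gA_bound {p q : ℝ} (hpq : p.HolderConjugate q) :
    ∃ C : ℝ, 0 < C ∧ ∀ {n : ℕ} {ι : Type} [Fintype ι] (w : ι → ℝ) (z : ι → En n),
      (∀ i, 0 ≤ w i) → (∑ i, w i = 1) → ∀ (f g : En n → ℝ),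
      MemLp f (ENNReal.ofReal p) → MemLp g (ENNReal.ofReal q) → ∀ m : ℕ,
      gA w z m f g ≤ C * (lpn p f * lpn q g) := by
  rcases le_total 2 p with hp | hp
  · exact gf_gA_bound_aux hpq hp
  · have hq : 2 ≤ q := by
      have h1 := hpq.inv_add_inv_eq_one
      have h2 : (1:ℝ)/2 ≤ p⁻¹ := by
        rw [one_div]; exact inv_anti₀ hpq.pos hp
      have h3 : q⁻¹ ≤ 2⁻¹ := by linarith
      exact (inv_le_inv₀ hpq.symm.pos (by norm_num)).mp h3
    obtain ⟨C, hC, h⟩ := gf_gA_bound_aux hpq.symm hq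
    refine ⟨C, hC, ?_⟩
    intro n ι _ w z hw hw1 f g hf hg m
    rw [gA_comm, mul_comm (lpn p f)]
    exact h w z hw hw1 g f hg hf m
end

section
open scoped FourierTransform SchwartzMap
variable {ι : Type} [Fintype ι]

/-- discrete bilinear form -/
def gT (σ w : ι → ℝ) (z : ι → En n) (m : ℕ) (f g : En n → ℝ) : ℝ :=
  ∑ k ∈ Finset.range m, ∑ i, σ i * w i * ∫ x, gD w z i ((gP w z)^[k] f) x * gD w z i ((gP w z)^[k] g) x

/-- averaging on Schwartz functions -/
def sP (w : ι → ℝ) (z : ι → En n) (F : 𝓢(En n, ℂ)) : 𝓢(En n, ℂ) :=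
  ∑ i, (w i : ℂ) • F.compSubConstCLM ℂ (-(z i))

/-- differences on Schwartz functions -/
def sD (w : ι → ℝ) (z : ι → En n) (i : ι) (F : 𝓢(En n, ℂ)) : 𝓢(En n, ℂ) :=
  F.compSubConstCLM ℂ (-(z i)) - sP w z F

theorem sP_apply {w : ι → ℝ} {z : ι → En n} {F : 𝓢(En n, ℂ)} {f : En n → ℝ}
    (h : ∀ x, F x = f x) (x : En n) : sP w z F x = gP w z f x := by
  simp [sP, gP, SchwartzMap.sum_apply, h]

theorem sPk_apply {w : ι → ℝ} {z : ι → En n} {F : 𝓢(En n, ℂ)} {f : En n → ℝ}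
    (h : ∀ x, F x = f x) (m : ℕ) : ∀ x : En n, (sP w z)^[m] F x = ((gP w z)^[m] f x : ℝ) := by
  induction m with
  | zero => exact h
  | succ m ih =>
    intro x
    rw [Function.iterate_succ_apply', Function.iterate_succ_apply']
    exact sP_apply ih x

theorem sD_apply {w : ι → ℝ} {z : ι → En n} {F : 𝓢(En n, ℂ)} {f : En n → ℝ}
    (h : ∀ x, F x = f x) (i : ι) (x : En n) : sD w z i F x = gD w z i f x := by
  simp [sD, gD, sP_apply h, h]

/-- character -/
def ehat (a ξ : En n) : ℂ := Complex.exp ((2 * Real.pi * inner ℝ a ξ : ℝ) * Complex.I)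

/-- symbol of the average -/
def phat (w : ι → ℝ) (z : ι → En n) (ξ : En n) : ℂ := ∑ i, (w i : ℂ) * ehat (z i) ξ

theorem fourier_shift (F : 𝓢(En n, ℂ)) (a ξ : En n) :
    𝓕 (F.compSubConstCLM ℂ (-a)) ξ = ehat a ξ * 𝓕 F ξ := by
  rw [SchwartzMap.fourier_coe, SchwartzMap.fourier_coe]
  have := congrFun (VectorFourier.fourierIntegral_comp_add_right Real.fourierChar volume
    (innerₗ (En n)) (F : En n → ℂ) a) ξ
  have e : (F.compSubConstCLM ℂ (-a) : En n → ℂ) = (F : En n → ℂ) ∘ fun v => v + a := by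
    funext x; simp
  rw [e]
  refine Eq.trans this ?_
  rw [Circle.smul_def, Real.fourierChar_apply]
  simp only [smul_eq_mul]
  rfl

theorem fourier_sP (w : ι → ℝ) (z : ι → En n) (F : 𝓢(En n, ℂ)) (ξ : En n) :
    𝓕 (sP w z F) ξ = phat w z ξ * 𝓕 F ξ := by
  unfold sP phat
  rw [← SchwartzMap.fourierTransformCLM_apply ℂ, map_sum]
  simp only [map_smul, SchwartzMap.fourierTransformCLM_apply, SchwartzMap.sum_apply,
    SchwartzMap.smul_apply, fourier_shift, Finset.sum_mul, smul_eq_mul, mul_assoc]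

theorem fourier_sPk (w : ι → ℝ) (z : ι → En n) (F : 𝓢(En n, ℂ)) (m : ℕ) (ξ : En n) :
    𝓕 ((sP w z)^[m] F) ξ = phat w z ξ ^ m * 𝓕 F ξ := by
  induction m with
  | zero => simp
  | succ m ih => rw [Function.iterate_succ_apply', fourier_sP, ih]; ring

theorem fourier_sD (w : ι → ℝ) (z : ι → En n) (i : ι) (F : 𝓢(En n, ℂ)) (ξ : En n) :
    𝓕 (sD w z i F) ξ = (ehat (z i) ξ - phat w z ξ) * 𝓕 F ξ := by
  unfold sD
  rw [← SchwartzMap.fourierTransformCLM_apply ℂ, map_sub]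
  simp only [SchwartzMap.fourierTransformCLM_apply, SchwartzMap.sub_apply, fourier_shift, fourier_sP, sub_mul]

/-- multiplier of the discrete form -/
def gM (σ w : ι → ℝ) (z : ι → En n) (m : ℕ) (ξ : En n) : ℝ :=
  ∑ k ∈ Finset.range m, ∑ i, σ i * w i * (‖ehat (z i) ξ - phat w z ξ‖ ^ 2 * (‖phat w z ξ‖ ^ 2) ^ k)

theorem schwartz_inner_integrable (F G : 𝓢(En n, ℂ)) : Integrable (fun x => inner ℂ (F x) (G x)) := by
  have h := (F.memLp 2 volume).integrable_mul (q := 2) (G.memLp 2 volume) 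
  have h2 := ((F.memLp 2 volume).star).integrable_mul (q := 2) (G.memLp 2 volume)
  refine h2.congr (Eventually.of_forall fun x => ?_)
  simp [mul_comm]

theorem gT_fourier (σ w : ι → ℝ) (z : ι → En n) (m : ℕ) {F G : 𝓢(En n, ℂ)} {f g : En n → ℝ}
    (hF : ∀ x, F x = f x) (hG : ∀ x, G x = g x) :
    (gT σ w z m f g : ℂ) = ∫ ξ, (gM σ w z m ξ : ℂ) * inner ℂ (𝓕 F ξ) (𝓕 G ξ) := by
  have key : ∀ k i, ((∫ x, gD w z i ((gP w z)^[k] f) x * gD w z i ((gP w z)^[k] g) x : ℝ) : ℂ)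
      = ∫ ξ, inner ℂ (𝓕 (sD w z i ((sP w z)^[k] F)) ξ) (𝓕 (sD w z i ((sP w z)^[k] G)) ξ) := by
    intro k i
    rw [SchwartzMap.integral_inner_fourier_fourier, ← integral_complex_ofReal]
    congr 1
    funext x
    rw [sD_apply (sPk_apply hF k), sD_apply (sPk_apply hG k)]
    simp [mul_comm]
  have key2 : ∀ k i ξ, inner ℂ (𝓕 (sD w z i ((sP w z)^[k] F)) ξ) (𝓕 (sD w z i ((sP w z)^[k] G)) ξ)
      = ((‖ehat (z i) ξ - phat w z ξ‖ ^ 2 * (‖phat w z ξ‖ ^ 2) ^ k : ℝ) : ℂ) * inner ℂ (𝓕 F ξ) (𝓕 G ξ) := by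
    intro k i ξ
    rw [fourier_sD, fourier_sD, fourier_sPk, fourier_sPk]
    push_cast
    rw [← Complex.conj_mul', ← Complex.conj_mul']
    simp only [RCLike.inner_apply, map_mul, map_sub, map_pow]
    ring
  unfold gT gM
  push_cast
  simp only [Finset.sum_mul]
  have hI : ∀ k i, Integrable fun ξ => (σ i : ℂ) * (w i) * ((‖ehat (z i) ξ - phat w z ξ‖ : ℂ) ^ 2 * ((‖phat w z ξ‖ : ℂ) ^ 2) ^ k) * inner ℂ (𝓕 F ξ) (𝓕 G ξ) := by
    intro k i
    have := (schwartz_inner_integrable (𝓕 (sD w z i ((sP w z)^[k] F))) (𝓕 (sD w z i ((sP w z)^[k] G)))).const_mul ((σ i : ℂ) * (w i))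
    refine this.congr (Eventually.of_forall fun ξ => ?_)
    simp only [key2]
    push_cast; ring
  rw [integral_finsetSum _ fun k _ => integrable_finsetSum _ fun i _ => hI k i]
  refine Finset.sum_congr rfl fun k _ => ?_
  rw [integral_finsetSum _ fun i _ => hI k i]
  refine Finset.sum_congr rfl fun i _ => ?_
  rw [key, ← integral_const_mul]
  congr 1
  funext ξ
  rw [key2]
  push_cast; ring

theorem ehat_norm (a ξ : En n) : ‖ehat a ξ‖ = 1 := by
  unfold ehat; exact Complex.norm_exp_ofReal_mul_I _

theorem gf_var_aux {σ : ι → ℝ} {w : ι → ℝ} {z : ι → En n} (ξ : En n) :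
    ∑ i, σ i * w i * ‖ehat (z i) ξ - phat w z ξ‖ ^ 2 
      = (1 + ‖phat w z ξ‖ ^ 2) * (∑ i, σ i * w i) - 2 * (∑ i, ((σ i * w i : ℝ) : ℂ) * ehat (z i) ξ * (starRingEnd ℂ) (phat w z ξ)).re := by
  rw [Complex.re_sum, Finset.mul_sum, Finset.mul_sum, ← Finset.sum_sub_distrib]
  refine Finset.sum_congr rfl fun i _ => ?_
  have h1 : ‖ehat (z i) ξ - phat w z ξ‖ ^ 2 = 1 + ‖phat w z ξ‖ ^ 2 - 2 * (ehat (z i) ξ * (starRingEnd ℂ) (phat w z ξ)).re := by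
    have := Complex.normSq_sub (ehat (z i) ξ) (phat w z ξ)
    rw [Complex.normSq_eq_norm_sq, Complex.normSq_eq_norm_sq, Complex.normSq_eq_norm_sq, ehat_norm] at this
    linarith
  rw [h1, mul_assoc (((σ i * w i : ℝ)) : ℂ), Complex.re_ofReal_mul]
  ring

theorem gf_var {w : ι → ℝ} {z : ι → En n} (hw1 : ∑ i, w i = 1) (ξ : En n) :
    ∑ i, w i * ‖ehat (z i) ξ - phat w z ξ‖ ^ 2 = 1 - ‖phat w z ξ‖ ^ 2 := by
  have := gf_var_aux (σ := fun _ => 1) (w := w) (z := z) ξ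
  simp only [one_mul, hw1, ← Finset.sum_mul] at this
  rw [this]
  have e : ∑ i, ((w i : ℝ) : ℂ) * ehat (z i) ξ = phat w z ξ := rfl
  rw [e, Complex.mul_conj, Complex.normSq_eq_norm_sq, Complex.ofReal_re]
  ring

theorem gM_eq (σ w : ι → ℝ) (z : ι → En n) (m : ℕ) (ξ : En n) : gM σ w z m ξ
    = (∑ i, σ i * w i * ‖ehat (z i) ξ - phat w z ξ‖ ^ 2) * ∑ k ∈ Finset.range m, (‖phat w z ξ‖ ^ 2) ^ k := by
  rw [gM, Finset.mul_sum]
  refine Finset.sum_congr rfl fun k _ => ?_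
  rw [Finset.sum_mul]
  exact Finset.sum_congr rfl fun i _ => by ring

theorem phat_le_one {w : ι → ℝ} {z : ι → En n} (hw : ∀ i, 0 ≤ w i) (hw1 : ∑ i, w i = 1) (ξ : En n) :
    ‖phat w z ξ‖ ^ 2 ≤ 1 := by
  have h := gf_var (z := z) hw1 ξ
  have : 0 ≤ ∑ i, w i * ‖ehat (z i) ξ - phat w z ξ‖ ^ 2 :=
    Finset.sum_nonneg fun i _ => mul_nonneg (hw i) (by positivity)
  linarith

theorem gM_bound {σ w : ι → ℝ} {z : ι → En n} {s : ℝ} (hs : ∀ i, |σ i| ≤ s) (hs0 : 0 ≤ s)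
    (hw : ∀ i, 0 ≤ w i) (hw1 : ∑ i, w i = 1) (m : ℕ) (ξ : En n) : |gM σ w z m ξ| ≤ s := by
  rw [gM_eq, abs_mul, abs_of_nonneg (a := ∑ k ∈ Finset.range m, (‖phat w z ξ‖ ^ 2) ^ k) (by positivity)]
  have h1 : |∑ i, σ i * w i * ‖ehat (z i) ξ - phat w z ξ‖ ^ 2| ≤ s * (1 - ‖phat w z ξ‖ ^ 2) := by
    rw [← gf_var hw1, Finset.mul_sum]
    refine (Finset.abs_sum_le_sum_abs _ _).trans (Finset.sum_le_sum fun i _ => ?_)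
    rw [abs_mul, abs_mul, abs_of_nonneg (hw i), abs_of_nonneg (sq_nonneg ‖_‖), mul_assoc]
    exact mul_le_mul_of_nonneg_right (hs i) (mul_nonneg (hw i) (sq_nonneg _))
  calc _ ≤ s * (1 - ‖phat w z ξ‖ ^ 2) * ∑ k ∈ Finset.range m, (‖phat w z ξ‖ ^ 2) ^ k := by gcongr
    _ = s * (1 - (‖phat w z ξ‖ ^ 2) ^ m) := by rw [mul_assoc, mul_neg_geom_sum]
    _ ≤ s * 1 := by
      gcongr
      have : 0 ≤ (‖phat w z ξ‖ ^ 2) ^ m := by positivity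
      linarith
    _ = s := mul_one s

end

section
open scoped FourierTransform SchwartzMap
variable {ι : Type} [Fintype ι]

/-- step size -/
def hstep (j : ℕ) : ℝ := 1 / ((j : ℝ) + 1)

theorem hstep_pos (j : ℕ) : 0 < hstep j := by unfold hstep; positivity

theorem hstep_tendsto : Tendsto hstep atTop (nhds 0) := tendsto_one_div_add_atTop_nhds_zero_nat

theorem gf_exp2 (θ : ℝ) : Tendsto (fun j => (Complex.exp ((hstep j * θ : ℝ) * Complex.I) - 1
    - (hstep j * θ : ℝ) * Complex.I) / (hstep j : ℂ) ^ 2) atTop (nhds (-(θ : ℂ) ^ 2 / 2)) := by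
  rw [tendsto_iff_norm_sub_tendsto_zero]
  have hb : ∀ j, ‖(Complex.exp ((hstep j * θ : ℝ) * Complex.I) - 1
    - (hstep j * θ : ℝ) * Complex.I) / (hstep j : ℂ) ^ 2 - (-(θ : ℂ) ^ 2 / 2)‖
      ≤ hstep j * |θ| ^ 3 * Real.exp (hstep j * |θ|) := by
    intro j
    have hp := hstep_pos j
    have h0 : (hstep j : ℂ) ≠ 0 := by exact_mod_cast hp.ne'
    have h1 := Complex.norm_exp_sub_sum_le_norm_mul_exp ((hstep j * θ : ℝ) * Complex.I) 3
    have e0 : ‖((hstep j * θ : ℝ) : ℂ) * Complex.I‖ = hstep j * |θ| := by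
      rw [norm_mul, Complex.norm_I, mul_one, Complex.norm_real, Real.norm_eq_abs, abs_mul, abs_of_pos hp]
    rw [e0] at h1
    have e1 : (Complex.exp ((hstep j * θ : ℝ) * Complex.I) - 1
        - (hstep j * θ : ℝ) * Complex.I) / (hstep j : ℂ) ^ 2 - (-(θ : ℂ) ^ 2 / 2)
        = (Complex.exp ((hstep j * θ : ℝ) * Complex.I) - ∑ m ∈ Finset.range 3, (((hstep j * θ : ℝ) : ℂ) * Complex.I) ^ m / (m.factorial : ℂ)) / (hstep j : ℂ) ^ 2 := by
      simp only [Finset.sum_range_succ, Finset.sum_range_zero]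
      field_simp
      push_cast
      simp only [Nat.factorial, Complex.I_sq, mul_pow]
      push_cast
      ring
    rw [e1, norm_div, norm_pow, Complex.norm_real, Real.norm_of_nonneg hp.le, div_le_iff₀ (by positivity)]
    refine h1.trans (le_of_eq ?_)
    ring
  refine squeeze_zero (fun _ => norm_nonneg _) hb ?_
  have : Tendsto (fun j => hstep j * |θ| ^ 3 * Real.exp (hstep j * |θ|)) atTop
      (nhds (0 * |θ| ^ 3 * Real.exp (0 * |θ|))) :=
    (hstep_tendsto.mul_const _).mul ((Real.continuous_exp.tendsto _).comp (hstep_tendsto.mul_const _))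
  simpa using this

theorem gf_comb (c θ : ι → ℝ) (h1 : ∑ i, c i * θ i = 0) :
    Tendsto (fun j => (∑ i, (c i : ℂ) * Complex.exp ((hstep j * θ i : ℝ) * Complex.I) - ((∑ i, c i : ℝ) : ℂ))
      / (hstep j : ℂ) ^ 2) atTop (nhds ((-(∑ i, c i * θ i ^ 2) / 2 : ℝ) : ℂ)) := by
  have := tendsto_finset_sum Finset.univ fun i _ => (gf_exp2 (θ i)).const_mul (c i : ℂ)
  have e : ∑ i, (c i : ℂ) * (-(θ i : ℂ) ^ 2 / 2) = ((-(∑ i, c i * θ i ^ 2) / 2 : ℝ) : ℂ) := by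
    push_cast
    rw [← Finset.sum_neg_distrib, Finset.sum_div]
    exact Finset.sum_congr rfl fun i _ => by ring
  rw [e] at this
  refine this.congr fun j => ?_
  have h2 : ∑ i, (c i : ℂ) * ((hstep j * θ i : ℝ) * Complex.I) = 0 := by
    have : ∑ i, (c i : ℂ) * ((hstep j * θ i : ℝ) * Complex.I) = ((∑ i, c i * θ i : ℝ) : ℂ) * (hstep j * Complex.I) := by
      push_cast; rw [Finset.sum_mul]; exact Finset.sum_congr rfl fun i _ => by ring
    rw [this, h1]; simp
  simp only [mul_div_assoc', mul_sub, ← Finset.sum_div, Finset.sum_sub_distrib, h2]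
  push_cast
  simp

theorem gM_tendsto {σ w : ι → ℝ} {v : ι → En n} (hw : ∀ i, 0 ≤ w i) (hw1 : ∑ i, w i = 1)
    (hσ : ∑ i, σ i * w i = 0) (ξ : En n) (hv : ∑ i, w i * inner ℝ (v i) ξ = 0)
    (hσv : ∑ i, σ i * w i * inner ℝ (v i) ξ = 0) (hpos : 0 < ∑ i, w i * (inner ℝ (v i) ξ) ^ 2) :
    Tendsto (fun j => gM σ w (fun i => hstep j • v i) ((j + 1) ^ 3) ξ) atTop
      (nhds ((∑ i, σ i * w i * (inner ℝ (v i) ξ) ^ 2) / ∑ i, w i * (inner ℝ (v i) ξ) ^ 2)) := by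
  set θ : ι → ℝ := fun i => 2 * Real.pi * inner ℝ (v i) ξ with hθ
  have heh : ∀ j i, ehat (hstep j • v i) ξ = Complex.exp ((hstep j * θ i : ℝ) * Complex.I) := by
    intro j i
    unfold ehat
    rw [real_inner_smul_left]
    congr 3
    simp only [hθ]; ring
  set K := ∑ i, w i * θ i ^ 2 with hK
  set L := ∑ i, σ i * w i * θ i ^ 2 with hL
  have hKe : K = (2 * Real.pi) ^ 2 * ∑ i, w i * (inner ℝ (v i) ξ) ^ 2 := by
    rw [hK, Finset.mul_sum]; exact Finset.sum_congr rfl fun i _ => by simp only [hθ]; ring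
  have hLe : L = (2 * Real.pi) ^ 2 * ∑ i, σ i * w i * (inner ℝ (v i) ξ) ^ 2 := by
    rw [hL, Finset.mul_sum]; exact Finset.sum_congr rfl fun i _ => by simp only [hθ]; ring
  have hKpos : 0 < K := by rw [hKe]; have := Real.pi_pos; positivity
  have hlim : (∑ i, σ i * w i * (inner ℝ (v i) ξ) ^ 2) / ∑ i, w i * (inner ℝ (v i) ξ) ^ 2 = L / K := by
    rw [hKe, hLe, mul_div_mul_left]; have := Real.pi_pos; positivity
  rw [hlim]
  set P : ℕ → ℂ := fun j => phat w (fun i => hstep j • v i) ξ with hP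
  have A1 : Tendsto (fun j => (P j - 1) / (hstep j : ℂ) ^ 2) atTop (nhds ((-K / 2 : ℝ) : ℂ)) := by
    have := gf_comb w θ (by simp only [hθ]; rw [← mul_zero (2 * Real.pi), ← hv, Finset.mul_sum]; exact Finset.sum_congr rfl fun i _ => by ring)
    refine this.congr fun j => ?_
    rw [hw1]
    simp only [hP, phat, heh, Complex.ofReal_one]
  set q : ℕ → ℂ := fun j => ∑ i, ((σ i * w i : ℝ) : ℂ) * ehat (hstep j • v i) ξ with hq
  have A2 : Tendsto (fun j => q j / (hstep j : ℂ) ^ 2) atTop (nhds ((-L / 2 : ℝ) : ℂ)) := by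
    have := gf_comb (fun i => σ i * w i) θ (by simp only [hθ]; rw [← mul_zero (2 * Real.pi), ← hσv, Finset.mul_sum]; exact Finset.sum_congr rfl fun i _ => by ring)
    refine this.congr fun j => ?_
    rw [hσ]
    simp only [hq, heh, Complex.ofReal_zero, sub_zero]
  have hh : Tendsto (fun j => (hstep j : ℂ) ^ 2) atTop (nhds 0) := by
    have : Tendsto (fun j => (hstep j : ℂ) ^ 2) atTop (nhds (((0 : ℝ) : ℂ) ^ 2)) :=
      ((Complex.continuous_ofReal.tendsto _).comp hstep_tendsto).pow 2
    simpa using this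
  have hne : ∀ j, (hstep j : ℂ) ≠ 0 := fun j => by exact_mod_cast (hstep_pos j).ne'
  have A3 : Tendsto (fun j => P j - 1) atTop (nhds 0) := by
    have := A1.mul hh
    rw [mul_zero] at this
    refine this.congr fun j => ?_
    have := hne j; field_simp
  have A3' : Tendsto P atTop (nhds 1) := by
    have := A3.add_const 1; simpa using this
  have A4 : Tendsto (fun j => (1 - ‖P j‖ ^ 2) / hstep j ^ 2) atTop (nhds K) := by
    have h1 := ((Complex.continuous_re.tendsto _).comp A1).const_mul (-2)
    have h2 := A1.norm.mul A3.norm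
    have h3 := h1.sub h2
    have e : -2 * ((-K / 2 : ℝ) : ℂ).re - ‖((-K / 2 : ℝ) : ℂ)‖ * ‖(0 : ℂ)‖ = K := by
      rw [Complex.ofReal_re, norm_zero]; ring
    rw [e] at h3
    refine h3.congr fun j => ?_
    have hp := hstep_pos j
    have e1 : ‖P j‖ ^ 2 = 1 + 2 * (P j - 1).re + ‖P j - 1‖ ^ 2 := by
      rw [← Complex.normSq_eq_norm_sq, ← Complex.normSq_eq_norm_sq, Complex.normSq_apply, Complex.normSq_apply]
      simp; ring
    simp only [Function.comp]
    rw [e1, norm_div, norm_pow, Complex.norm_real, Real.norm_of_nonneg hp.le, ← Complex.ofReal_pow, Complex.div_ofReal_re]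
    field_simp
    ring
  have A5 : Tendsto (fun j => (∑ i, σ i * w i * ‖ehat (hstep j • v i) ξ - P j‖ ^ 2) / hstep j ^ 2) atTop (nhds L) := by
    have h1 := (((Complex.continuous_re.tendsto _).comp (A2.mul ((Complex.continuous_conj.tendsto _).comp A3')))).const_mul (-2)
    have e : -2 * (((-L / 2 : ℝ) : ℂ) * (starRingEnd ℂ) 1).re = L := by
      rw [map_one, mul_one, Complex.ofReal_re]; ring
    rw [e] at h1
    refine h1.congr fun j => ?_
    have hp := hstep_pos j
    have := gf_var_aux (σ := σ) (w := w) (z := fun i => hstep j • v i) ξ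
    simp only [hP]
    rw [this, hσ, ← Finset.sum_mul]
    simp only [Function.comp, hq]
    rw [← Complex.ofReal_pow, div_mul_eq_mul_div, Complex.div_ofReal_re]
    ring
  have A6 : Tendsto (fun j => (‖P j‖ ^ 2) ^ ((j + 1) ^ 3)) atTop (nhds 0) := by
    have hb : ∀ j, (‖P j‖ ^ 2) ^ ((j + 1) ^ 3) ≤ Real.exp (-((1 - ‖P j‖ ^ 2) / hstep j ^ 2 * ((j : ℝ) + 1))) := by
      intro j
      have h1 : ‖P j‖ ^ 2 ≤ Real.exp (-(1 - ‖P j‖ ^ 2)) := by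
        have := Real.add_one_le_exp (-(1 - ‖P j‖ ^ 2)); linarith
      calc _ ≤ (Real.exp (-(1 - ‖P j‖ ^ 2))) ^ ((j + 1) ^ 3) := by gcongr
        _ = _ := by
          rw [← Real.exp_nat_mul]
          congr 1
          unfold hstep
          push_cast
          field_simp
    refine squeeze_zero (fun j => by positivity) hb ?_
    apply Real.tendsto_exp_neg_atTop_nhds_zero.comp
    refine A4.pos_mul_atTop hKpos ?_
    exact tendsto_atTop_add_const_right _ _ tendsto_natCast_atTop_atTop
  have A7 := (A5.div A4 hKpos.ne').mul (A6.const_sub 1)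
  rw [sub_zero, mul_one] at A7
  refine A7.congr' ?_
  filter_upwards [A4.eventually_ne hKpos.ne'] with j hj
  have hp := hstep_pos j
  have hj' : 1 - ‖P j‖ ^ 2 ≠ 0 := fun h => hj (by rw [h, zero_div])
  simp only [Pi.div_apply]
  rw [gM_eq, ← mul_neg_geom_sum (‖P j‖ ^ 2) ((j + 1) ^ 3)]
  change _ = (∑ i, σ i * w i * ‖ehat (hstep j • v i) ξ - P j‖ ^ 2) * ∑ k ∈ Finset.range ((j+1)^3), (‖P j‖ ^ 2) ^ k
  rw [div_div_div_cancel_right₀ (by positivity)]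
  field_simp

theorem phat_cont (w : ι → ℝ) (z : ι → En n) : Continuous (phat w z) := by
  unfold phat ehat
  fun_prop

theorem gM_cont (σ w : ι → ℝ) (z : ι → En n) (m : ℕ) : Continuous (gM σ w z m) := by
  have := phat_cont w z
  unfold gM ehat
  fun_prop

/-- the discrete forms converge on Schwartz functions -/
theorem gT_tendsto {σ w : ι → ℝ} {v : ι → En n} (hw : ∀ i, 0 ≤ w i) (hw1 : ∑ i, w i = 1)
    (hσ : ∑ i, σ i * w i = 0) (hv : ∀ ξ : En n, ∑ i, w i * inner ℝ (v i) ξ = 0)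
    (hσv : ∀ ξ : En n, ∑ i, σ i * w i * inner ℝ (v i) ξ = 0)
    (mul : En n → ℝ)
    (hmul : ∀ ξ : En n, ξ ≠ 0 → 0 < ∑ i, w i * (inner ℝ (v i) ξ) ^ 2 ∧
      (∑ i, σ i * w i * (inner ℝ (v i) ξ) ^ 2) / (∑ i, w i * (inner ℝ (v i) ξ) ^ 2) = mul ξ)
    (hn : 0 < n)
    {F G : 𝓢(En n, ℂ)} {f g : En n → ℝ} (hF : ∀ x, F x = f x) (hG : ∀ x, G x = g x) :
    Tendsto (fun j => gT σ w (fun i => hstep j • v i) ((j + 1) ^ 3) f g) atTop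
      (nhds (∫ ξ, (mul ξ : ℂ) * inner ℂ (𝓕 F ξ) (𝓕 G ξ)).re) := by
  have key : Tendsto (fun j => (gT σ w (fun i => hstep j • v i) ((j + 1) ^ 3) f g : ℂ)) atTop
      (nhds (∫ ξ, (mul ξ : ℂ) * inner ℂ (𝓕 F ξ) (𝓕 G ξ))) := by
    simp only [gT_fourier σ w _ _ hF hG]
    set s := ∑ i, |σ i|
    have hs : ∀ i, |σ i| ≤ s := fun i => Finset.single_le_sum (f := fun i => |σ i|) (fun i _ => abs_nonneg _) (Finset.mem_univ i)
    have hs0 : 0 ≤ s := Finset.sum_nonneg fun i _ => abs_nonneg _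
    refine tendsto_integral_of_dominated_convergence (fun ξ => s * ‖(inner ℂ (𝓕 F ξ) (𝓕 G ξ) : ℂ)‖) ?_ ?_ ?_ ?_
    · intro j
      exact ((Complex.continuous_ofReal.comp (gM_cont σ w _ _)).aestronglyMeasurable).mul
        (schwartz_inner_integrable (𝓕 F) (𝓕 G)).1
    · exact (schwartz_inner_integrable (𝓕 F) (𝓕 G)).norm.const_mul s
    · intro j
      refine Eventually.of_forall fun ξ => ?_
      rw [norm_mul, Complex.norm_real, Real.norm_eq_abs]
      gcongr
      exact gM_bound hs hs0 hw hw1 _ _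
    · haveI : Nonempty (Fin n) := ⟨⟨0, hn⟩⟩
      have h0 : ∀ᵐ ξ : En n, ξ ≠ 0 := by
        rw [ae_iff]; simp
      filter_upwards [h0] with ξ hξ
      refine Tendsto.mul_const _ ?_
      refine (Complex.continuous_ofReal.tendsto _).comp ?_
      rw [← (hmul ξ hξ).2]
      exact gM_tendsto hw hw1 hσ ξ (hv ξ) (hσv ξ) (hmul ξ hξ).1
  have := (Complex.continuous_re.tendsto _).comp key
  exact this
end

section
variable {ι : Type} [Fintype ι] {w : ι → ℝ} {z : ι → En n}

theorem gP_lin (a b : ℝ) (f g : En n → ℝ) :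
    gP w z (fun x => a * f x + b * g x) = fun x => a * gP w z f x + b * gP w z g x := by
  funext x
  simp only [gP, Finset.mul_sum, ← Finset.sum_add_distrib]
  exact Finset.sum_congr rfl fun _ _ => by ring

theorem gPk_lin (a b : ℝ) (f g : En n → ℝ) (m : ℕ) :
    (gP w z)^[m] (fun x => a * f x + b * g x) = fun x => a * (gP w z)^[m] f x + b * (gP w z)^[m] g x := by
  induction m with
  | zero => rfl
  | succ m ih => simp only [Function.iterate_succ_apply', ih, gP_lin]

theorem gD_lin (a b : ℝ) (f g : En n → ℝ) (i : ι) :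
    gD w z i (fun x => a * f x + b * g x) = fun x => a * gD w z i f x + b * gD w z i g x := by
  funext x
  simp only [gD, gP_lin]; ring

theorem gDP_int {p q : ℝ} (hpq : p.HolderConjugate q) {f g : En n → ℝ}
    (hf : MemLp f (ENNReal.ofReal p)) (hg : MemLp g (ENNReal.ofReal q)) (m : ℕ) (i : ι) :
    Integrable fun x => gD w z i ((gP w z)^[m] f) x * gD w z i ((gP w z)^[m] g) x :=
  gf_integrable_mul hpq (gD_memLp (gPk_memLp hf m) i) (gD_memLp (gPk_memLp hg m) i)

theorem gT_lin {p q : ℝ} (hpq : p.HolderConjugate q) {σ : ι → ℝ} {f₁ f₂ g : En n → ℝ}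
    (hf₁ : MemLp f₁ (ENNReal.ofReal p)) (hf₂ : MemLp f₂ (ENNReal.ofReal p))
    (hg : MemLp g (ENNReal.ofReal q)) (a b : ℝ) (m : ℕ) :
    gT σ w z m (fun x => a * f₁ x + b * f₂ x) g = a * gT σ w z m f₁ g + b * gT σ w z m f₂ g := by
  simp only [gT, Finset.mul_sum, ← Finset.sum_add_distrib]
  refine Finset.sum_congr rfl fun k _ => Finset.sum_congr rfl fun i _ => ?_
  have h1 := gDP_int (w := w) (z := z) hpq hf₁ hg k i
  have h2 := gDP_int (w := w) (z := z) hpq hf₂ hg k i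
  have : ∫ x, gD w z i ((gP w z)^[k] fun x => a * f₁ x + b * f₂ x) x * gD w z i ((gP w z)^[k] g) x
      = a * (∫ x, gD w z i ((gP w z)^[k] f₁) x * gD w z i ((gP w z)^[k] g) x)
        + b * (∫ x, gD w z i ((gP w z)^[k] f₂) x * gD w z i ((gP w z)^[k] g) x) := by
    rw [← integral_const_mul, ← integral_const_mul, ← integral_add (h1.const_mul a) (h2.const_mul b)]
    congr 1
    funext x
    rw [gPk_lin, gD_lin]; ring
  rw [this]; ring

theorem gT_comm (σ : ι → ℝ) (m : ℕ) (f g : En n → ℝ) : gT σ w z m f g = gT σ w z m g f := by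
  simp only [gT, mul_comm]

theorem gT_le_gA {σ : ι → ℝ} {s : ℝ} (hs : ∀ i, |σ i| ≤ s) (hw : ∀ i, 0 ≤ w i) (m : ℕ) (f g : En n → ℝ) :
    |gT σ w z m f g| ≤ s * gA w z m f g := by
  unfold gT gA
  rw [Finset.mul_sum]
  refine (Finset.abs_sum_le_sum_abs _ _).trans (Finset.sum_le_sum fun k _ => ?_)
  rw [Finset.mul_sum]
  refine (Finset.abs_sum_le_sum_abs _ _).trans (Finset.sum_le_sum fun i _ => ?_)
  rw [abs_mul, abs_mul, abs_of_nonneg (hw i), mul_assoc]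
  refine mul_le_mul (hs i) ?_ (by have := hw i; positivity) ((abs_nonneg _).trans (hs i))
  refine mul_le_mul_of_nonneg_left ?_ (hw i)
  refine (abs_integral_le_integral_abs).trans (le_of_eq ?_)
  simp only [abs_mul]

/-- weak derivative on the whole space -/
def WD (v g : En n → ℝ) (l : Fin n) : Prop :=
  ∀ ψ : En n → ℝ, IsTestFun Set.univ ψ → ∫ x, v x * fderiv ℝ ψ x (basisVec l) = -∫ x, g x * ψ x

theorem test_shift {ψ : En n → ℝ} (h : IsTestFun Set.univ ψ) (a : En n) :
    IsTestFun Set.univ (fun x => ψ (x + a)) := by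
  refine ⟨h.1.comp (contDiff_id.add contDiff_const), ?_, Set.subset_univ _⟩
  exact h.2.1.comp_homeomorph (Homeomorph.addRight a)

theorem test_lin {φ ψ : En n → ℝ} (h : IsTestFun Set.univ φ) (h' : IsTestFun Set.univ ψ) (a b : ℝ) :
    IsTestFun Set.univ (fun x => a * φ x + b * ψ x) :=
  ⟨(contDiff_const.mul h.1).add (contDiff_const.mul h'.1), (h.2.1.mul_left).add (h'.2.1.mul_left),
    Set.subset_univ _⟩

theorem test_zero : IsTestFun Set.univ (fun _ : En n => (0 : ℝ)) :=
  ⟨contDiff_const, HasCompactSupport.zero, Set.subset_univ _⟩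

theorem test_gP {ψ : En n → ℝ} (h : IsTestFun Set.univ ψ) : IsTestFun Set.univ (gP w z ψ) := by
  classical
  unfold gP
  have : ∀ s : Finset ι, IsTestFun Set.univ (fun x => ∑ i ∈ s, w i * ψ (x + z i)) := by
    intro s
    induction s using Finset.induction_on with
    | empty => simpa using test_zero
    | insert i s hi ih =>
      simp only [Finset.sum_insert hi]
      have := test_lin (test_shift h (z i)) ih (w i) 1
      simpa using this
  exact this Finset.univ

theorem test_gD {ψ : En n → ℝ} (h : IsTestFun Set.univ ψ) (i : ι) : IsTestFun Set.univ (gD w z i ψ) := by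
  have := test_lin (test_shift h (z i)) (test_gP (w := w) (z := z) h) 1 (-1)
  unfold gD
  simpa [sub_eq_add_neg] using this

theorem test_gPk {ψ : En n → ℝ} (h : IsTestFun Set.univ ψ) (m : ℕ) : IsTestFun Set.univ ((gP w z)^[m] ψ) := by
  induction m with
  | zero => simpa
  | succ m ih => rw [Function.iterate_succ_apply']; exact test_gP ih

theorem test_diff {ψ : En n → ℝ} (h : IsTestFun Set.univ ψ) : Differentiable ℝ ψ :=
  h.1.differentiable (by simp)

theorem test_deriv {ψ : En n → ℝ} (h : IsTestFun Set.univ ψ) (e : En n) :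
    IsTestFun Set.univ (fun x => fderiv ℝ ψ x e) := by
  refine ⟨?_, ?_, Set.subset_univ _⟩
  · have : ContDiff ℝ (⊤ : ℕ∞) (fderiv ℝ ψ) := h.1.fderiv_right (by simp)
    exact this.clm_apply contDiff_const
  · exact h.2.1.fderiv_apply ℝ e

theorem test_memLp {ψ : En n → ℝ} (h : IsTestFun Set.univ ψ) (q : ℝ≥0∞) : MemLp ψ q :=
  h.1.continuous.memLp_of_hasCompactSupport h.2.1

theorem fderiv_gP {ψ : En n → ℝ} (h : IsTestFun Set.univ ψ) (e : En n) :
    (fun x => fderiv ℝ (gP w z ψ) x e) = gP w z (fun x => fderiv ℝ ψ x e) := by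
  funext x
  have h1 : HasFDerivAt (gP w z ψ) (∑ i, w i • fderiv ℝ ψ (x + z i)) x := by
    unfold gP
    refine HasFDerivAt.fun_sum fun i _ => ?_
    have := ((test_diff h) (x + z i)).hasFDerivAt
    have h2 : HasFDerivAt (fun x => ψ (x + z i)) (fderiv ℝ ψ (x + z i)) x :=
      (hasFDerivAt_comp_add_right (z i)).mpr this
    exact h2.const_mul (w i)
  rw [h1.fderiv]
  simp [gP]

theorem fderiv_gD {ψ : En n → ℝ} (h : IsTestFun Set.univ ψ) (i : ι) (e : En n) :
    (fun x => fderiv ℝ (gD w z i ψ) x e) = gD w z i (fun x => fderiv ℝ ψ x e) := by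
  funext x
  have h2 : HasFDerivAt (fun x => ψ (x + z i)) (fderiv ℝ ψ (x + z i)) x :=
      (hasFDerivAt_comp_add_right (z i)).mpr ((test_diff h) (x + z i)).hasFDerivAt
  have h3 := (test_diff (test_gP (w := w) (z := z) h) x).hasFDerivAt
  have h4 : HasFDerivAt (gD w z i ψ) _ x := h2.fun_sub h3
  rw [h4.fderiv]
  have := congrFun (fderiv_gP (w := w) (z := z) h e) x
  simp only [ContinuousLinearMap.sub_apply, gD, ← this]

theorem fderiv_gPk {ψ : En n → ℝ} (h : IsTestFun Set.univ ψ) (e : En n) (m : ℕ) :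
    (fun x => fderiv ℝ ((gP w z)^[m] ψ) x e) = (gP w z)^[m] (fun x => fderiv ℝ ψ x e) := by
  induction m with
  | zero => rfl
  | succ m ih => rw [Function.iterate_succ_apply', fderiv_gP (test_gPk h m), ih, Function.iterate_succ_apply']

theorem WD_shift {v g : En n → ℝ} {l : Fin n} (h : WD v g l) (a : En n) :
    WD (fun x => v (x + a)) (fun x => g (x + a)) l := by
  intro ψ hψ
  have h1 := h (fun x => ψ (x + -a)) (test_shift hψ (-a))
  rw [← integral_add_right_eq_self _ a, ← integral_add_right_eq_self (fun x => g x * ψ (x + -a)) a] at h1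
  simp only [add_neg_cancel_right] at h1
  rw [← h1]
  congr 1; funext x
  rw [fderiv_comp_add_right]
  simp

theorem WD_lin {p q : ℝ} (hpq : p.HolderConjugate q) {v g v' g' : En n → ℝ} {l : Fin n}
    (hv : MemLp v (ENNReal.ofReal p)) (hg : MemLp g (ENNReal.ofReal p))
    (hv' : MemLp v' (ENNReal.ofReal p)) (hg' : MemLp g' (ENNReal.ofReal p))
    (h : WD v g l) (h' : WD v' g' l) (a b : ℝ) :
    WD (fun x => a * v x + b * v' x) (fun x => a * g x + b * g' x) l := by
  intro ψ hψ
  have I1 := gf_integrable_mul hpq hv (test_memLp (test_deriv hψ (basisVec l)) _)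
  have I2 := gf_integrable_mul hpq hv' (test_memLp (test_deriv hψ (basisVec l)) _)
  have I3 := gf_integrable_mul hpq hg (test_memLp hψ _)
  have I4 := gf_integrable_mul hpq hg' (test_memLp hψ _)
  have e1 : ∫ x, (a * v x + b * v' x) * fderiv ℝ ψ x (basisVec l)
      = a * (∫ x, v x * fderiv ℝ ψ x (basisVec l)) + b * ∫ x, v' x * fderiv ℝ ψ x (basisVec l) := by
    rw [← integral_const_mul, ← integral_const_mul, ← integral_add (I1.const_mul a) (I2.const_mul b)]
    congr 1; funext x; ring
  have e2 : ∫ x, (a * g x + b * g' x) * ψ x = a * (∫ x, g x * ψ x) + b * ∫ x, g' x * ψ x := by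
    rw [← integral_const_mul, ← integral_const_mul, ← integral_add (I3.const_mul a) (I4.const_mul b)]
    congr 1; funext x; ring
  rw [e1, e2, h ψ hψ, h' ψ hψ]; ring

theorem WD_gP {p q : ℝ} (hpq : p.HolderConjugate q) {v g : En n → ℝ} {l : Fin n}
    (hv : MemLp v (ENNReal.ofReal p)) (hg : MemLp g (ENNReal.ofReal p)) (h : WD v g l) :
    WD (gP w z v) (gP w z g) l := by
  classical
  have : ∀ s : Finset ι, WD (fun x => ∑ i ∈ s, w i * v (x + z i)) (fun x => ∑ i ∈ s, w i * g (x + z i)) l := by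
    intro s
    induction s using Finset.induction_on with
    | empty => intro ψ _; simp
    | insert i s hi ih =>
      simp only [Finset.sum_insert hi]
      have := WD_lin hpq (gf_shift_memLp hv (z i)) (gf_shift_memLp hg (z i))
        (memLp_finsetSum s fun i _ => (gf_shift_memLp hv (z i)).const_mul (w i))
        (memLp_finsetSum s fun i _ => (gf_shift_memLp hg (z i)).const_mul (w i))
        (WD_shift h (z i)) ih (w i) 1
      simpa using this
  exact this Finset.univ

theorem WD_gPk {p q : ℝ} (hpq : p.HolderConjugate q) {v g : En n → ℝ} {l : Fin n}
    (hv : MemLp v (ENNReal.ofReal p)) (hg : MemLp g (ENNReal.ofReal p)) (h : WD v g l) (m : ℕ) :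
    WD ((gP w z)^[m] v) ((gP w z)^[m] g) l := by
  induction m with
  | zero => exact h
  | succ m ih =>
    rw [Function.iterate_succ_apply', Function.iterate_succ_apply']
    exact WD_gP hpq (gPk_memLp hv m) (gPk_memLp hg m) ih

theorem WD_gD {p q : ℝ} (hpq : p.HolderConjugate q) {v g : En n → ℝ} {l : Fin n}
    (hv : MemLp v (ENNReal.ofReal p)) (hg : MemLp g (ENNReal.ofReal p)) (h : WD v g l) (i : ι) :
    WD (gD w z i v) (gD w z i g) l := by
  have := WD_lin hpq (gf_shift_memLp hv (z i)) (gf_shift_memLp hg (z i)) (gP_memLp (w := w) (z := z) hv)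
    (gP_memLp (w := w) (z := z) hg) (WD_shift h (z i)) (WD_gP hpq hv hg h) 1 (-1)
  unfold gD
  simpa [sub_eq_add_neg] using this

theorem gT_weak {p q : ℝ} (hpq : p.HolderConjugate q) {σ : ι → ℝ} {v g ψ : En n → ℝ} {l : Fin n}
    (hv : MemLp v (ENNReal.ofReal p)) (hg : MemLp g (ENNReal.ofReal p)) (h : WD v g l)
    (hψ : IsTestFun Set.univ ψ) (m : ℕ) :
    gT σ w z m v (fun x => fderiv ℝ ψ x (basisVec l)) = - gT σ w z m g ψ := by
  simp only [gT, ← Finset.sum_neg_distrib]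
  refine Finset.sum_congr rfl fun k _ => Finset.sum_congr rfl fun i _ => ?_
  rw [← mul_neg, ← fderiv_gPk hψ, ← fderiv_gD (test_gPk hψ k)]
  congr 1
  exact WD_gD hpq (gPk_memLp hv k) (gPk_memLp hg k) (WD_gPk hpq hv hg h k) i _ (test_gD (test_gPk hψ k) i)
end

section
open scoped FourierTransform SchwartzMap

/-- lattice index -/
abbrev LJ (n : ℕ) : Type := Fin n × Fin n × Bool × Bool

/-- sign -/
def sg (b : Bool) : ℝ := if b then 1 else -1

/-- lattice directions -/
def vv (J : LJ n) : En n := sg J.2.2.1 • basisVec J.1 + sg J.2.2.2 • basisVec J.2.1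

/-- weights -/
def ww (_ : LJ n) : ℝ := 1 / (4 * (n : ℝ) ^ 2)

/-- signs for the second order Riesz transform -/
def ss (i j : Fin n) (J : LJ n) : ℝ := if J.1 = i ∧ J.2.1 = j then (n : ℝ) * (sg J.2.2.1 * sg J.2.2.2) else 0

theorem vv_inner (J : LJ n) (ξ : En n) : inner ℝ (vv J) ξ = sg J.2.2.1 * ξ J.1 + sg J.2.2.2 * ξ J.2.1 := by
  simp [vv, basisVec, inner_add_left, real_inner_smul_left, EuclideanSpace.inner_single_left]

theorem ww_nonneg (J : LJ n) : 0 ≤ ww J := by unfold ww; positivity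

theorem ww_sum (hn : 0 < n) : ∑ J : LJ n, ww J = 1 := by
  have : (n : ℝ) ≠ 0 := by positivity
  simp [ww, Fintype.card_prod]
  field_simp

theorem sum_LJ (F : LJ n → ℝ) : ∑ J : LJ n, F J = ∑ i, ∑ j, (F (i, j, true, true) + F (i, j, true, false)
    + F (i, j, false, true) + F (i, j, false, false)) := by
  simp only [Fintype.sum_prod_type, Fintype.sum_bool]
  refine Finset.sum_congr rfl fun i _ => Finset.sum_congr rfl fun j _ => by ring

theorem ss_sum (i j : Fin n) : ∑ J : LJ n, ss i j J * ww J = 0 := by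
  rw [sum_LJ]
  refine Finset.sum_eq_zero fun a _ => Finset.sum_eq_zero fun b _ => ?_
  by_cases h : a = i ∧ b = j <;> simp [ss, sg, ww, h]

theorem vv_sum (ξ : En n) : ∑ J : LJ n, ww J * inner ℝ (vv J) ξ = 0 := by
  rw [sum_LJ]
  refine Finset.sum_eq_zero fun a _ => Finset.sum_eq_zero fun b _ => ?_
  simp only [vv_inner, sg, ww]; simp; ring

theorem ssvv_sum (i j : Fin n) (ξ : En n) : ∑ J : LJ n, ss i j J * ww J * inner ℝ (vv J) ξ = 0 := by
  rw [sum_LJ]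
  refine Finset.sum_eq_zero fun a _ => Finset.sum_eq_zero fun b _ => ?_
  by_cases h : a = i ∧ b = j <;> simp [vv_inner, ss, sg, ww, h]
  ring

theorem vv_sq (hn : 0 < n) (ξ : En n) : ∑ J : LJ n, ww J * (inner ℝ (vv J) ξ) ^ 2 = 2 / n * ‖ξ‖ ^ 2 := by
  have hn' : (n : ℝ) ≠ 0 := by positivity
  rw [sum_LJ, EuclideanSpace.norm_sq_eq]
  have : ∀ i j : Fin n, (ww (i, j, true, true) * (inner ℝ (vv (i, j, true, true)) ξ) ^ 2
    + ww (i, j, true, false) * (inner ℝ (vv (i, j, true, false)) ξ) ^ 2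
    + ww (i, j, false, true) * (inner ℝ (vv (i, j, false, true)) ξ) ^ 2
    + ww (i, j, false, false) * (inner ℝ (vv (i, j, false, false)) ξ) ^ 2) = 1 / (n : ℝ) ^ 2 * (ξ i ^ 2 + ξ j ^ 2) := by
    intro i j
    simp only [vv_inner, sg, ww]
    simp only [if_true]
    field_simp
    simp
    ring
  simp only [this]
  simp only [← Finset.mul_sum, Finset.sum_add_distrib, Finset.sum_const, Finset.card_univ, Fintype.card_fin, nsmul_eq_mul, Real.norm_eq_abs, sq_abs]
  field_simp
  ring

theorem ssvv_sq (hn : 0 < n) (i j : Fin n) (ξ : En n) :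
    ∑ J : LJ n, ss i j J * ww J * (inner ℝ (vv J) ξ) ^ 2 = 2 / n * (ξ i * ξ j) := by
  have hn' : (n : ℝ) ≠ 0 := by positivity
  rw [sum_LJ, Finset.sum_eq_single i, Finset.sum_eq_single j]
  · simp only [vv_inner, ss, sg, ww]
    simp
    field_simp
    ring
  · intro b _ hb
    simp [ss, hb]
  · simp
  · intro a _ ha
    refine Finset.sum_eq_zero fun b _ => ?_
    simp [ss, ha]
  · simp

theorem ss_bound (i j : Fin n) (J : LJ n) : |ss i j J| ≤ n := by
  unfold ss
  split_ifs
  · rw [abs_mul, abs_mul, Nat.abs_cast]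
    have : ∀ b, |sg b| = 1 := by intro b; cases b <;> simp [sg]
    simp [this]
  · simp

/-- approximating forms -/
def fBm (i j : Fin n) (m : ℕ) (f g : En n → ℝ) : ℝ :=
  gT (ss i j) ww (fun J => hstep m • vv J) ((m + 1) ^ 3) f g

/-- limiting form -/
def fB (i j : Fin n) (f g : En n → ℝ) : ℝ :=
  limUnder ((hyperfilter ℕ : Ultrafilter ℕ) : Filter ℕ) (fun m => fBm i j m f g)

theorem fBm_bound (hn : 0 < n) {p q : ℝ} (hpq : p.HolderConjugate q) : ∃ C : ℝ, 0 < C ∧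
    ∀ (i j : Fin n) (f g : En n → ℝ), MemLp f (ENNReal.ofReal p) → MemLp g (ENNReal.ofReal q) →
      ∀ m, |fBm i j m f g| ≤ C * (lpn p f * lpn q g) := by
  obtain ⟨C, hC, h⟩ := gf_gA_bound hpq
  refine ⟨n * C, by positivity, fun i j f g hf hg m => ?_⟩
  refine (gT_le_gA (ss_bound i j) ww_nonneg _ f g).trans ?_
  rw [mul_assoc]
  exact mul_le_mul_of_nonneg_left (h ww _ ww_nonneg (ww_sum hn) f g hf hg _) (by positivity)

theorem fB_tendsto (hn : 0 < n) {p q : ℝ} (hpq : p.HolderConjugate q) (i j : Fin n) {f g : En n → ℝ}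
    (hf : MemLp f (ENNReal.ofReal p)) (hg : MemLp g (ENNReal.ofReal q)) :
    Tendsto (fun m => fBm i j m f g) (hyperfilter ℕ : Ultrafilter ℕ) (nhds (fB i j f g)) := by
  obtain ⟨C, hC, h⟩ := fBm_bound hn hpq
  apply tendsto_nhds_limUnder
  set M := C * (lpn p f * lpn q g)
  have hc : IsCompact (Set.Icc (-M) M) := isCompact_Icc
  obtain ⟨x, -, hx⟩ := hc.ultrafilter_le_nhds ((hyperfilter ℕ).map (fun m => fBm i j m f g)) (by
    rw [Ultrafilter.coe_map, le_principal_iff]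
    refine Filter.mem_map.mpr (Filter.univ_mem' fun m => ?_)
    exact abs_le.mp (h i j f g hf hg m))
  exact ⟨x, hx⟩

theorem fB_bound (hn : 0 < n) {p q : ℝ} (hpq : p.HolderConjugate q) : ∃ C : ℝ, 0 < C ∧
    ∀ (i j : Fin n) (f g : En n → ℝ), MemLp f (ENNReal.ofReal p) → MemLp g (ENNReal.ofReal q) →
      |fB i j f g| ≤ C * (lpn p f * lpn q g) := by
  obtain ⟨C, hC, h⟩ := fBm_bound hn hpq
  refine ⟨C, hC, fun i j f g hf hg => ?_⟩
  exact le_of_tendsto (fB_tendsto hn hpq i j hf hg).abs (Eventually.of_forall fun m => h i j f g hf hg m)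

theorem fB_comm (i j : Fin n) (f g : En n → ℝ) : fB i j f g = fB i j g f := by
  unfold fB fBm
  simp only [gT_comm _ _ f g]

theorem fB_lin (hn : 0 < n) {p q : ℝ} (hpq : p.HolderConjugate q) (i j : Fin n) {f₁ f₂ g : En n → ℝ}
    (hf₁ : MemLp f₁ (ENNReal.ofReal p)) (hf₂ : MemLp f₂ (ENNReal.ofReal p))
    (hg : MemLp g (ENNReal.ofReal q)) (a b : ℝ) :
    fB i j (fun x => a * f₁ x + b * f₂ x) g = a * fB i j f₁ g + b * fB i j f₂ g := by
  have h0 := fB_tendsto hn hpq i j ((hf₁.const_mul a).add (hf₂.const_mul b)) hg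
  have h1 := ((fB_tendsto hn hpq i j hf₁ hg).const_mul a).add ((fB_tendsto hn hpq i j hf₂ hg).const_mul b)
  refine tendsto_nhds_unique h0 (h1.congr fun m => ?_)
  unfold fBm
  exact (gT_lin hpq hf₁ hf₂ hg a b _).symm

theorem fB_weak (hn : 0 < n) {p q : ℝ} (hpq : p.HolderConjugate q) (i j : Fin n) {v g ψ : En n → ℝ} {l : Fin n}
    (hv : MemLp v (ENNReal.ofReal p)) (hg : MemLp g (ENNReal.ofReal p)) (h : WD v g l)
    (hψ : IsTestFun Set.univ ψ) :
    fB i j v (fun x => fderiv ℝ ψ x (basisVec l)) = - fB i j g ψ := by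
  have h0 := fB_tendsto hn hpq i j hv (test_memLp (test_deriv hψ (basisVec l)) _)
  have h1 := (fB_tendsto hn hpq i j hg (test_memLp hψ _)).neg
  refine tendsto_nhds_unique h0 (h1.congr fun m => ?_)
  unfold fBm
  exact (gT_weak hpq hv hg h hψ _).symm

/-- complexified Schwartz function -/
def cxS {f : En n → ℝ} (hf : IsTestFun Set.univ f) : 𝓢(En n, ℂ) :=
  (hf.2.1.toSchwartzMap hf.1).postcompCLM Complex.ofRealCLM

theorem cxS_apply {f : En n → ℝ} (hf : IsTestFun Set.univ f) (x : En n) : cxS hf x = f x := rfl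

theorem fB_fourier (hn : 0 < n) (i j : Fin n) {f g : En n → ℝ}
    (hf : IsTestFun Set.univ f) (hg : IsTestFun Set.univ g) :
    fB i j f g = (∫ ξ, ((ξ i * ξ j / ‖ξ‖ ^ 2 : ℝ) : ℂ) * inner ℂ (𝓕 (cxS hf) ξ) (𝓕 (cxS hg) ξ)).re := by
  have h := gT_tendsto (σ := ss i j) (w := ww) (v := vv) ww_nonneg (ww_sum hn) (ss_sum i j) vv_sum
    (ssvv_sum i j) (fun ξ => ξ i * ξ j / ‖ξ‖ ^ 2) (fun ξ hξ => ?_) hn (cxS_apply hf) (cxS_apply hg)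
  · exact (h.mono_left Nat.hyperfilter_le_atTop).limUnder_eq
  · rw [vv_sq hn, ssvv_sq hn]
    have hn' : (0 : ℝ) < n := by positivity
    refine ⟨by positivity, ?_⟩
    rw [mul_div_mul_left]; positivity

theorem fB_symm_test (hn : 0 < n) (i j : Fin n) {f g : En n → ℝ}
    (hf : IsTestFun Set.univ f) (hg : IsTestFun Set.univ g) : fB i j f g = fB j i f g := by
  rw [fB_fourier hn i j hf hg, fB_fourier hn j i hf hg]
  simp only [mul_comm]

theorem fourier_test_deriv {ψ : En n → ℝ} (hψ : IsTestFun Set.univ ψ) (l : Fin n) (ξ : En n) :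
    𝓕 (cxS (test_deriv hψ (basisVec l))) ξ = 2 * Real.pi * Complex.I * (ξ l * 𝓕 (cxS hψ) ξ) := by
  have e : cxS (test_deriv hψ (basisVec l)) = LineDeriv.lineDerivOp (basisVec l) (cxS hψ) := by
    ext x
    rw [SchwartzMap.lineDerivOp_apply_eq_fderiv, cxS_apply]
    have h1 : HasFDerivAt (cxS hψ : En n → ℂ) (Complex.ofRealCLM.comp (fderiv ℝ ψ x)) x :=
      Complex.ofRealCLM.hasFDerivAt.comp x (test_diff hψ x).hasFDerivAt
    rw [h1.fderiv]; rfl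
  rw [e, SchwartzMap.fourier_lineDerivOp_eq]
  have hh : (fun x : En n => inner ℝ x (basisVec l)).HasTemperateGrowth := ((innerSL ℝ).flip (basisVec l)).hasTemperateGrowth
  rw [_root_.smul_apply, SchwartzMap.smulLeftCLM_apply_apply hh]
  simp [basisVec, EuclideanSpace.inner_single_right]

theorem fB_deriv_test (hn : 0 < n) (i j l : Fin n) {f ψ : En n → ℝ}
    (hf : IsTestFun Set.univ f) (hψ : IsTestFun Set.univ ψ) :
    fB i j f (fun x => fderiv ℝ ψ x (basisVec l)) = fB l j f (fun x => fderiv ℝ ψ x (basisVec i)) := by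
  rw [fB_fourier hn i j hf (test_deriv hψ _), fB_fourier hn l j hf (test_deriv hψ _)]
  congr 2
  funext ξ
  rw [fourier_test_deriv hψ, fourier_test_deriv hψ]
  simp only [RCLike.inner_apply]
  push_cast
  ring

theorem fB_trace_test (hn : 0 < n) {f g : En n → ℝ}
    (hf : IsTestFun Set.univ f) (hg : IsTestFun Set.univ g) : ∑ i, fB i i f g = ∫ x, f x * g x := by
  simp only [fB_fourier hn _ _ hf hg]
  have hI := schwartz_inner_integrable (𝓕 (cxS hf)) (𝓕 (cxS hg))
  have hI' : ∀ i, Integrable fun ξ : En n => ((ξ i * ξ i / ‖ξ‖ ^ 2 : ℝ) : ℂ) * inner ℂ (𝓕 (cxS hf) ξ) (𝓕 (cxS hg) ξ) := by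
    intro i
    refine Integrable.bdd_mul (c := 1) hI ?_ ?_
    · refine Measurable.aestronglyMeasurable ?_
      fun_prop
    · refine Eventually.of_forall fun ξ => ?_
      rw [Complex.norm_real, Real.norm_of_nonneg (div_nonneg (mul_self_nonneg _) (by positivity))]
      refine div_le_one_of_le₀ ?_ (by positivity)
      rw [EuclideanSpace.norm_sq_eq, ← sq]
      have := Finset.single_le_sum (f := fun i => ‖ξ i‖ ^ 2) (fun i _ => by positivity) (Finset.mem_univ i)
      simpa using this
  rw [← Complex.re_sum, ← integral_finsetSum _ fun i _ => hI' i]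
  have : Nonempty (Fin n) := ⟨⟨0, hn⟩⟩
  have h0 : ∀ᵐ ξ : En n, ξ ≠ 0 := by rw [ae_iff]; simp
  have e : ∫ ξ : En n, ∑ i, ((ξ i * ξ i / ‖ξ‖ ^ 2 : ℝ) : ℂ) * inner ℂ (𝓕 (cxS hf) ξ) (𝓕 (cxS hg) ξ)
      = ∫ ξ, inner ℂ (𝓕 (cxS hf) ξ) (𝓕 (cxS hg) ξ) := by
    refine integral_congr_ae ?_
    filter_upwards [h0] with ξ hξ
    rw [← Finset.sum_mul, ← Complex.ofReal_sum, ← Finset.sum_div]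
    have : ∑ i, ξ i * ξ i = ‖ξ‖ ^ 2 := by
      rw [EuclideanSpace.norm_sq_eq]; exact Finset.sum_congr rfl fun i _ => by rw [Real.norm_eq_abs, sq_abs, sq]
    rw [this, div_self (by positivity)]; simp
  rw [e, SchwartzMap.integral_inner_fourier_fourier]
  have e2 : ∀ x, inner ℂ (cxS hf x) (cxS hg x) = ((f x * g x : ℝ) : ℂ) := by
    intro x; rw [cxS_apply, cxS_apply]; simp [mul_comm]
  simp only [e2, integral_complex_ofReal, Complex.ofReal_re]
end

theorem lpn_congr {p : ℝ} {f g : En n → ℝ} (h : f =ᵐ[volume] g) : lpn p f = lpn p g := by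
  unfold lpn; rw [eLpNorm_congr_ae h]

theorem gf_holder {p q : ℝ} (hpq : p.HolderConjugate q) {f g : En n → ℝ}
    (hf : MemLp f (ENNReal.ofReal p)) (hg : MemLp g (ENNReal.ofReal q)) :
    |∫ x, f x * g x| ≤ lpn p f * lpn q g := by
  have h := integral_mul_norm_le_Lp_mul_Lq hpq hf hg
  have e1 : lpn p f = (∫ x, ‖f x‖ ^ p) ^ (1 / p) := by
    have := lpn_pow hpq.lt hf
    simp only [Real.norm_eq_abs]
    rw [← this, ← Real.rpow_mul (lpn_nonneg _ _), mul_one_div_cancel hpq.ne_zero, Real.rpow_one]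
  have e2 : lpn q g = (∫ x, ‖g x‖ ^ q) ^ (1 / q) := by
    have := lpn_pow hpq.symm.lt hg
    simp only [Real.norm_eq_abs]
    rw [← this, ← Real.rpow_mul (lpn_nonneg _ _), mul_one_div_cancel hpq.symm.ne_zero, Real.rpow_one]
  rw [e1, e2]
  refine (abs_integral_le_integral_abs).trans (le_trans (le_of_eq ?_) h)
  simp [abs_mul]

theorem gf_dense {p : ℝ} (hp : 1 < p) {f : En n → ℝ} (hf : MemLp f (ENNReal.ofReal p)) {ε : ℝ} (hε : 0 < ε) :
    ∃ φ, IsTestFun Set.univ φ ∧ lpn p (fun x => 1 * f x + (-1) * φ x) ≤ ε := by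
  obtain ⟨g, h1, h2, h3⟩ := hf.exist_eLpNorm_sub_le (by simp) (by simpa using hp.le) hε
  refine ⟨g, ⟨h2, h1, Set.subset_univ _⟩, ?_⟩
  have e : (fun x => 1 * f x + (-1) * g x) = f - g := by funext x; simp [sub_eq_add_neg]
  unfold lpn
  rw [e]
  exact ENNReal.toReal_le_of_le_ofReal hε.le h3

theorem gf_density {p : ℝ} (hp : 1 < p) {Λ : (En n → ℝ) → ℝ} {C : ℝ} (hC : 0 ≤ C)
    (hlin : ∀ f g, MemLp f (ENNReal.ofReal p) → MemLp g (ENNReal.ofReal p) →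
      Λ (fun x => 1 * f x + (-1) * g x) = Λ f - Λ g)
    (hb : ∀ f, MemLp f (ENNReal.ofReal p) → |Λ f| ≤ C * lpn p f)
    (h0 : ∀ f, IsTestFun Set.univ f → Λ f = 0) {f : En n → ℝ} (hf : MemLp f (ENNReal.ofReal p)) : Λ f = 0 := by
  have : |Λ f| ≤ 0 := by
    refine le_of_forall_pos_le_add fun ε hε => ?_
    obtain ⟨φ, hφ, h1⟩ := gf_dense hp hf (ε := ε / (C + 1)) (by positivity)
    have h2 := hlin f φ hf (test_memLp hφ _)
    rw [h0 φ hφ, sub_zero] at h2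
    rw [← h2, zero_add]
    calc _ ≤ C * (ε / (C + 1)) := (hb (fun x => 1 * f x + (-1) * φ x) ((hf.const_mul 1).add ((test_memLp hφ _).const_mul (-1)))).trans (by gcongr)
      _ ≤ (C + 1) * (ε / (C + 1)) := by gcongr; linarith
      _ = ε := by field_simp
  exact abs_eq_zero.mp (le_antisymm this (abs_nonneg _))

theorem fB_symm (hn : 0 < n) {p q : ℝ} (hpq : p.HolderConjugate q) (i j : Fin n) {f ψ : En n → ℝ}
    (hf : MemLp f (ENNReal.ofReal p)) (hψ : IsTestFun Set.univ ψ) : fB i j f ψ = fB j i f ψ := by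
  obtain ⟨C, hC, hb⟩ := fB_bound hn hpq
  have hψ' := test_memLp hψ (ENNReal.ofReal q)
  have := gf_density hpq.lt (Λ := fun f => fB i j f ψ - fB j i f ψ) (C := 2 * C * lpn q ψ)
    (by have := lpn_nonneg q ψ; positivity) ?_ ?_ ?_ hf
  · linarith
  · intro f g hf hg
    simp only [fB_lin hn hpq _ _ hf hg hψ']; ring
  · intro f hf
    have h1 := hb i j f ψ hf hψ'
    have h2 := hb j i f ψ hf hψ'
    refine (abs_sub _ _).trans ?_
    linarith
  · intro f hf
    simp only [fB_symm_test hn i j hf hψ, sub_self]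

theorem fB_deriv (hn : 0 < n) {p q : ℝ} (hpq : p.HolderConjugate q) (i j l : Fin n) {f ψ : En n → ℝ}
    (hf : MemLp f (ENNReal.ofReal p)) (hψ : IsTestFun Set.univ ψ) :
    fB i j f (fun x => fderiv ℝ ψ x (basisVec l)) = fB l j f (fun x => fderiv ℝ ψ x (basisVec i)) := by
  obtain ⟨C, hC, hb⟩ := fB_bound hn hpq
  have hl := test_memLp (test_deriv hψ (basisVec l)) (ENNReal.ofReal q)
  have hi := test_memLp (test_deriv hψ (basisVec i)) (ENNReal.ofReal q)
  have := gf_density hpq.lt (Λ := fun f => fB i j f (fun x => fderiv ℝ ψ x (basisVec l)) - fB l j f (fun x => fderiv ℝ ψ x (basisVec i)))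
    (C := C * lpn q (fun x => fderiv ℝ ψ x (basisVec l)) + C * lpn q (fun x => fderiv ℝ ψ x (basisVec i)))
    (by have := lpn_nonneg q (fun x => fderiv ℝ ψ x (basisVec l)); have := lpn_nonneg q (fun x => fderiv ℝ ψ x (basisVec i)); positivity) ?_ ?_ ?_ hf
  · linarith
  · intro f g hf hg
    simp only [fB_lin hn hpq _ _ hf hg hl, fB_lin hn hpq _ _ hf hg hi]; ring
  · intro f hf
    have h1 := hb i j f _ hf hl
    have h2 := hb l j f _ hf hi
    refine (abs_sub _ _).trans ?_
    linarith
  · intro f hf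
    simp only [fB_deriv_test hn i j l hf hψ, sub_self]

theorem fB_trace (hn : 0 < n) {p q : ℝ} (hpq : p.HolderConjugate q) {f ψ : En n → ℝ}
    (hf : MemLp f (ENNReal.ofReal p)) (hψ : IsTestFun Set.univ ψ) : ∑ i, fB i i f ψ = ∫ x, f x * ψ x := by
  obtain ⟨C, hC, hb⟩ := fB_bound hn hpq
  have hψ' := test_memLp hψ (ENNReal.ofReal q)
  have := gf_density hpq.lt (Λ := fun f => ∑ i, fB i i f ψ - ∫ x, f x * ψ x) (C := (n * C + 1) * lpn q ψ)
    (by have := lpn_nonneg q ψ; positivity) ?_ ?_ ?_ hf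
  · linarith
  · intro f g hf hg
    simp only [fB_lin hn hpq _ _ hf hg hψ']
    have : ∫ x, (1 * f x + -1 * g x) * ψ x = (∫ x, f x * ψ x) - ∫ x, g x * ψ x := by
      rw [← integral_sub (gf_integrable_mul hpq hf hψ') (gf_integrable_mul hpq hg hψ')]
      congr 1; funext x; ring
    rw [this, Finset.sum_add_distrib, ← Finset.mul_sum, ← Finset.mul_sum]
    ring
  · intro f hf
    refine (abs_sub _ _).trans ?_
    have h1 : |∑ i, fB i i f ψ| ≤ n * (C * (lpn p f * lpn q ψ)) := by
      refine (Finset.abs_sum_le_sum_abs _ _).trans ((Finset.sum_le_sum fun i _ => hb i i f ψ hf hψ').trans ?_)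
      simp
    have h2 := gf_holder hpq hf hψ'
    linarith
  · intro f hf
    simp only [fB_trace_test hn hf hψ, sub_self]

theorem fB_congr_right (hn : 0 < n) {p q : ℝ} (hpq : p.HolderConjugate q) (i j : Fin n) {f g g' : En n → ℝ}
    (hf : MemLp f (ENNReal.ofReal p)) (hg : MemLp g (ENNReal.ofReal q)) (h : g =ᵐ[volume] g') :
    fB i j f g = fB i j f g' := by
  obtain ⟨C, hC, hb⟩ := fB_bound hn hpq
  have hg' : MemLp g' (ENNReal.ofReal q) := hg.ae_eq h
  have h1 := hb i j f (fun x => 1 * g x + (-1) * g' x) hf ((hg.const_mul 1).add (hg'.const_mul (-1)))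
  have h2 : lpn q (fun x => 1 * g x + (-1) * g' x) = 0 := by
    have : (fun x => 1 * g x + (-1) * g' x) =ᵐ[volume] (fun _ => 0) := by
      filter_upwards [h] with x hx; rw [hx]; ring
    rw [lpn_congr this]; simp [lpn]
  rw [h2, mul_zero, mul_zero, fB_comm, fB_lin hn hpq.symm i j hg hg' hf, fB_comm i j g, fB_comm i j g'] at h1
  have := abs_eq_zero.mp (le_antisymm h1 (abs_nonneg _))
  linarith

theorem gf_22 : (2 : ℝ).HolderConjugate 2 := Real.HolderConjugate.two_two

theorem gf_of2 : ENNReal.ofReal 2 = 2 := by simp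

theorem fB_rep2 (hn : 0 < n) (i j : Fin n) {f : En n → ℝ} (hf : MemLp f 2) :
    ∃ F : En n → ℝ, MemLp F 2 ∧ ∀ g, MemLp g 2 → ∫ x, F x * g x = fB i j f g := by
  obtain ⟨C, hC, hb⟩ := fB_bound hn gf_22
  simp only [gf_of2] at hb
  have hlin : ∀ g₁ g₂ : En n → ℝ, MemLp g₁ 2 → MemLp g₂ 2 → ∀ a b : ℝ,
      fB i j f (fun x => a * g₁ x + b * g₂ x) = a * fB i j f g₁ + b * fB i j f g₂ := by
    intro g₁ g₂ h₁ h₂ a b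
    have := fB_lin hn gf_22 i j (by rwa [gf_of2]) (by rwa [gf_of2]) (g := f) (by rwa [gf_of2]) a b (f₁ := g₁) (f₂ := g₂)
    rw [fB_comm, this, fB_comm i j f, fB_comm i j f]
  have hcongr : ∀ g g' : En n → ℝ, MemLp g 2 → g =ᵐ[volume] g' → fB i j f g = fB i j f g' := by
    intro g g' hg h
    exact fB_congr_right hn gf_22 i j (by rwa [gf_of2]) (by rwa [gf_of2]) h
  let L : Lp ℝ 2 (volume : Measure (En n)) →ₗ[ℝ] ℝ :=
    { toFun := fun g => fB i j f g
      map_add' := by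
        intro g₁ g₂
        have e := hcongr _ (fun x => 1 * g₁ x + 1 * g₂ x) (Lp.memLp (g₁ + g₂)) (by
          filter_upwards [Lp.coeFn_add g₁ g₂] with x hx; rw [hx]; simp)
        rw [e, hlin _ _ (Lp.memLp _) (Lp.memLp _)]; simp
      map_smul' := by
        intro c g
        have e := hcongr _ (fun x => c * g x + 0 * g x) (Lp.memLp (c • g)) (by
          filter_upwards [Lp.coeFn_smul c g] with x hx; rw [hx]; simp)
        rw [e, hlin _ _ (Lp.memLp _) (Lp.memLp _)]; simp }
  let L' := L.mkContinuous (C * lpn 2 f) (by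
    intro g
    have := hb i j f g hf (Lp.memLp g)
    rw [Real.norm_eq_abs]
    refine this.trans (le_of_eq ?_)
    rw [Lp.norm_def, lpn, lpn, gf_of2]; ring)
  let F := (InnerProductSpace.toDual ℝ (Lp ℝ 2 (volume : Measure (En n)))).symm L'
  refine ⟨F, Lp.memLp F, fun g hg => ?_⟩
  have h1 : inner ℝ F (hg.toLp g) = L' (hg.toLp g) := InnerProductSpace.toDual_symm_apply
  rw [L2.inner_def] at h1
  have h2 : L' (hg.toLp g) = fB i j f g := hcongr _ _ (Lp.memLp _) hg.coeFn_toLp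
  rw [← h2, ← h1]
  refine integral_congr_ae ?_
  filter_upwards [hg.coeFn_toLp] with x hx
  rw [hx]; simp [mul_comm]

theorem gf_dual_meas {p q : ℝ} (hpq : p.HolderConjugate q) {F : En n → ℝ} (hF : Measurable F) {M : ℝ} (hM : 0 ≤ M)
    (h : ∀ g, MemLp g 2 → MemLp g (ENNReal.ofReal q) → |∫ x, F x * g x| ≤ M * lpn q g) :
    MemLp F (ENNReal.ofReal p) ∧ lpn p F ≤ M := by
  have hp1 := hpq.lt
  have hp0 := hpq.pos
  set A : ℕ → Set (En n) := fun K => {x | |F x| ≤ K} ∩ closedBall 0 K with hA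
  have hAm : ∀ K, MeasurableSet (A K) := fun K =>
    (measurableSet_le hF.abs measurable_const).inter measurableSet_closedBall
  have hAf : ∀ K, volume (A K) < ⊤ := fun K =>
    (measure_mono Set.inter_subset_right).trans_lt measure_closedBall_lt_top
  set G : En n → ℝ := fun x => |F x| ^ (p - 2) * F x with hG
  have hGm : Measurable G := by fun_prop
  have hGabs : ∀ x, |G x| = |F x| ^ (p - 1) := by
    intro x
    simp only [hG]
    rw [abs_mul, abs_of_nonneg (by positivity : (0:ℝ) ≤ |F x| ^ (p - 2))]
    by_cases h0 : F x = 0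
    · rw [h0, abs_zero, mul_zero, Real.zero_rpow (by linarith)]
    · have : 0 < |F x| := abs_pos.mpr h0
      nth_rewrite 2 [← Real.rpow_one |F x|]
      rw [← Real.rpow_add this]; congr 1; ring
  have hFG : ∀ x, F x * G x = |F x| ^ p := by
    intro x
    simp only [hG]
    by_cases h0 : F x = 0
    · rw [h0, abs_zero, zero_mul, Real.zero_rpow (by linarith)]
    · have : 0 < |F x| := abs_pos.mpr h0
      have e : F x * (|F x| ^ (p - 2) * F x) = |F x| ^ (p - 2) * |F x| ^ (2 : ℝ) := by
        rw [Real.rpow_two, sq_abs]; ring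
      rw [e, ← Real.rpow_add this]; congr 1; ring
  have hGq : ∀ x, |G x| ^ q = |F x| ^ p := by
    intro x
    rw [hGabs, ← Real.rpow_mul (abs_nonneg _)]
    congr 1
    exact hpq.sub_one_mul_conj
  have hGK : ∀ K (r : ℝ≥0∞), MemLp ((A K).indicator G) r := by
    intro K r
    rw [memLp_indicator_iff_restrict (hAm K)]
    have : IsFiniteMeasure (volume.restrict (A K)) := ⟨by rw [Measure.restrict_apply_univ]; exact hAf K⟩
    refine MemLp.of_bound hGm.aestronglyMeasurable ((K : ℝ) ^ (p - 1)) ?_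
    refine (ae_restrict_iff' (hAm K)).mpr (Eventually.of_forall fun x hx => ?_)
    rw [Real.norm_eq_abs, hGabs]
    exact Real.rpow_le_rpow (abs_nonneg _) hx.1 (by linarith)
  have hmain : ∀ K, ∫ x in A K, |F x| ^ p ≤ M ^ p := by
    intro K
    have h1 := h _ (hGK K 2) (hGK K _)
    have e1 : ∫ x, F x * (A K).indicator G x = ∫ x in A K, |F x| ^ p := by
      rw [← integral_indicator (hAm K)]
      congr 1; funext x
      by_cases hx : x ∈ A K <;> simp [hx, hFG]
    have e2 : lpn q ((A K).indicator G) ^ q = ∫ x in A K, |F x| ^ p := by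
      rw [lpn_pow hpq.symm.lt (hGK K _), ← integral_indicator (hAm K)]
      congr 1; funext x
      by_cases hx : x ∈ A K
      · simp [hx, hGq]
      · simp [hx, Real.zero_rpow hpq.symm.ne_zero]
    rw [e1] at h1
    set I := ∫ x in A K, |F x| ^ p with hI
    have hI0 : 0 ≤ I := integral_nonneg fun x => by positivity
    rw [abs_of_nonneg hI0] at h1
    set B := lpn q ((A K).indicator G) with hB
    have hB0 : 0 ≤ B := lpn_nonneg _ _
    have h2 : B ^ q ≤ M * B := by rw [e2]; exact h1
    rcases hB0.eq_or_lt with h0 | h0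
    · rw [← e2, ← h0, Real.zero_rpow hpq.symm.ne_zero]; positivity
    · have h3 : B ^ (q - 1) ≤ M := by
        rw [Real.rpow_sub_one h0.ne', div_le_iff₀ h0]; exact h2
      rw [← e2]
      have h4 : B ^ q = (B ^ (q - 1)) ^ p := by
        rw [← Real.rpow_mul hB0, hpq.symm.sub_one_mul_conj]
      rw [h4]
      exact Real.rpow_le_rpow (by positivity) h3 hp0.le
  have hlint : ∀ K, ∫⁻ x in A K, ‖F x‖ₑ ^ p ≤ ENNReal.ofReal (M ^ p) := by
    intro K
    have hInteg : IntegrableOn (fun x => |F x| ^ p) (A K) := by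
      have := (gf_memLp_abs_pow hpq.symm.lt (hGK K (ENNReal.ofReal q)))
      rw [← integrable_indicator_iff (hAm K)]
      refine this.congr (Eventually.of_forall fun x => ?_)
      by_cases hx : x ∈ A K
      · simp [hx, hGq]
      · simp [hx, Real.zero_rpow hpq.symm.ne_zero]
    have e : ∫⁻ x in A K, ‖F x‖ₑ ^ p = ∫⁻ x in A K, ENNReal.ofReal (|F x| ^ p) := by
      congr 1; funext x
      rw [← ENNReal.ofReal_rpow_of_nonneg (abs_nonneg _) hp0.le, ← Real.norm_eq_abs, ofReal_norm_eq_enorm]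
    rw [e, ← ofReal_integral_eq_lintegral_ofReal hInteg (Eventually.of_forall fun x => by positivity)]
    exact ENNReal.ofReal_le_ofReal (hmain K)
  have hU : ⋃ K, A K = Set.univ := by
    refine Set.eq_univ_of_forall fun x => Set.mem_iUnion.mpr ?_
    obtain ⟨K, hK⟩ := exists_nat_ge (max |F x| ‖x‖)
    exact ⟨K, (le_max_left _ _).trans hK, by rw [mem_closedBall_zero_iff]; exact (le_max_right _ _).trans hK⟩
  have htot : ∫⁻ x, ‖F x‖ₑ ^ p ≤ ENNReal.ofReal (M ^ p) := by
    rw [← setLIntegral_univ, ← hU, setLIntegral_iUnion_of_directed]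
    · exact iSup_le hlint
    · refine (monotone_nat_of_le_succ fun K x hx => ?_).directed_le
      refine ⟨?_, closedBall_subset_closedBall (by push_cast; linarith) hx.2⟩
      have := hx.1
      simp only [Set.mem_setOf_eq] at this ⊢
      push_cast; linarith
  have hnorm : eLpNorm F (ENNReal.ofReal p) volume ≤ ENNReal.ofReal M := by
    rw [eLpNorm_eq_lintegral_rpow_enorm_toReal (by simpa using hp0) (by simp), ENNReal.toReal_ofReal hp0.le]
    calc _ ≤ (ENNReal.ofReal (M ^ p)) ^ (1 / p) := by gcongr
      _ = ENNReal.ofReal M := by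
        rw [ENNReal.ofReal_rpow_of_nonneg (by positivity) (by positivity), ← Real.rpow_mul hM, mul_one_div_cancel hp0.ne', Real.rpow_one]
  exact ⟨⟨hF.aestronglyMeasurable, hnorm.trans_lt ENNReal.ofReal_lt_top⟩, ENNReal.toReal_le_of_le_ofReal hM hnorm⟩

theorem gf_dual {p q : ℝ} (hpq : p.HolderConjugate q) {F : En n → ℝ} (hF : AEStronglyMeasurable F volume) {M : ℝ} (hM : 0 ≤ M)
    (h : ∀ g, MemLp g 2 → MemLp g (ENNReal.ofReal q) → |∫ x, F x * g x| ≤ M * lpn q g) :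
    MemLp F (ENNReal.ofReal p) ∧ lpn p F ≤ M := by
  have e := hF.ae_eq_mk
  have := gf_dual_meas hpq hF.stronglyMeasurable_mk.measurable hM (fun g h2 hq => by
    have h1 := h g h2 hq
    rwa [integral_congr_ae (g := fun x => hF.mk F x * g x) (by filter_upwards [e] with x hx; rw [hx])] at h1)
  exact ⟨this.1.ae_eq e.symm, by rw [lpn_congr e]; exact this.2⟩

theorem fB_rep (hn : 0 < n) {p q : ℝ} (hpq : p.HolderConjugate q) (i j : Fin n) {f : En n → ℝ}
    (hf : MemLp f (ENNReal.ofReal p)) : ∃ F : En n → ℝ, MemLp F (ENNReal.ofReal p) ∧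
      ∀ ψ, IsTestFun Set.univ ψ → ∫ x, F x * ψ x = fB i j f ψ := by
  obtain ⟨C, hC, hb⟩ := fB_bound hn hpq
  have hp1 : Fact (1 ≤ ENNReal.ofReal p) := ⟨by simpa using hpq.lt.le⟩
  choose φ hφ hφn using fun m : ℕ => gf_dense hpq.lt hf (ε := 1 / ((m : ℝ) + 1)) (by positivity)
  choose F hF2 hFr using fun m => fB_rep2 hn i j (test_memLp (hφ m) 2)
  have hdiff : ∀ m m', MemLp (fun x => F m x - F m' x) (ENNReal.ofReal p) ∧
      lpn p (fun x => F m x - F m' x) ≤ C * lpn p (fun x => 1 * φ m x + (-1) * φ m' x) := by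
    intro m m'
    refine gf_dual hpq ((hF2 m).1.sub (hF2 m').1) (mul_nonneg hC.le (lpn_nonneg _ _)) fun g h2 hq => ?_
    have e : ∫ x, (F m x - F m' x) * g x = fB i j (fun x => 1 * φ m x + (-1) * φ m' x) g := by
      rw [fB_lin hn hpq i j (test_memLp (hφ m) _) (test_memLp (hφ m') _) hq, ← hFr m g h2, ← hFr m' g h2]
      have I1 := gf_integrable_mul gf_22 (by rw [gf_of2]; exact hF2 m) (by rw [gf_of2]; exact h2)
      have I2 := gf_integrable_mul gf_22 (by rw [gf_of2]; exact hF2 m') (by rw [gf_of2]; exact h2)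
      rw [one_mul, neg_one_mul, ← sub_eq_add_neg, ← integral_sub I1 I2]
      congr 1; funext x; ring
    change |∫ x, (F m x - F m' x) * g x| ≤ _
    rw [e, mul_assoc]
    exact hb i j _ g (((test_memLp (hφ m) _).const_mul 1).add ((test_memLp (hφ m') _).const_mul (-1))) hq
  have hFp : ∀ m, MemLp (F m) (ENNReal.ofReal p) := by
    intro m
    refine (gf_dual hpq (hF2 m).1 (mul_nonneg hC.le (lpn_nonneg p (φ m))) fun g h2 hq => ?_).1
    rw [hFr m g h2, mul_assoc]
    exact hb i j _ g (test_memLp (hφ m) _) hq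
  have hφd : ∀ m m', lpn p (fun x => 1 * φ m x + (-1) * φ m' x) ≤ 1 / ((m : ℝ) + 1) + 1 / ((m' : ℝ) + 1) := by
    intro m m'
    have M1 : ∀ m, MemLp (fun x => 1 * f x + (-1) * φ m x) (ENNReal.ofReal p) := fun m =>
      (hf.const_mul 1).add ((test_memLp (hφ m) _).const_mul (-1))
    have e : (fun x => 1 * φ m x + (-1) * φ m' x) = (fun x => 1 * f x + (-1) * φ m' x) - (fun x => 1 * f x + (-1) * φ m x) := by
      funext x; simp only [Pi.sub_apply]; ring
    have h1 := eLpNorm_sub_le (M1 m').1 (M1 m).1 hp1.out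
    rw [e]
    have h2 : lpn p ((fun x => 1 * f x + (-1) * φ m' x) - (fun x => 1 * f x + (-1) * φ m x)) ≤ lpn p (fun x => 1 * f x + (-1) * φ m' x) + lpn p (fun x => 1 * f x + (-1) * φ m x) := by
      unfold lpn
      rw [← ENNReal.toReal_add (M1 m').2.ne (M1 m).2.ne]
      exact ENNReal.toReal_mono (ENNReal.add_ne_top.mpr ⟨(M1 m').2.ne, (M1 m).2.ne⟩) h1
    linarith [hφn m, hφn m']
  let U : ℕ → Lp ℝ (ENNReal.ofReal p) (volume : Measure (En n)) := fun m => (hFp m).toLp (F m)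
  have hdist : ∀ m m', dist (U m) (U m') = lpn p (fun x => F m x - F m' x) := by
    intro m m'
    rw [dist_eq_norm, ← MemLp.toLp_sub, Lp.norm_toLp]
    rfl
  have hcau : CauchySeq U := by
    have hlim : Tendsto (fun m : ℕ => C * (1 / ((m : ℝ) + 1) + 1 / ((m : ℝ) + 1))) atTop (nhds 0) := by
      have := (tendsto_one_div_add_atTop_nhds_zero_nat (𝕜 := ℝ)).add (tendsto_one_div_add_atTop_nhds_zero_nat (𝕜 := ℝ))
      simpa using this.const_mul C
    refine cauchySeq_of_le_tendsto_0 (fun m => C * (1 / ((m : ℝ) + 1) + 1 / ((m : ℝ) + 1))) ?_ hlim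
    intro a b K ha hb'
    rw [hdist]
    refine (hdiff a b).2.trans (mul_le_mul_of_nonneg_left ((hφd a b).trans ?_) hC.le)
    gcongr
  obtain ⟨V, hV⟩ := cauchySeq_tendsto_of_complete hcau
  refine ⟨V, Lp.memLp V, fun ψ hψ => ?_⟩
  have hψq := test_memLp hψ (ENNReal.ofReal q)
  have t1 : Tendsto (fun m => ∫ x, F m x * ψ x) atTop (nhds (∫ x, V x * ψ x)) := by
    rw [tendsto_iff_dist_tendsto_zero]
    have hd : Tendsto (fun m => dist (U m) V * lpn q ψ) atTop (nhds 0) := by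
      have := (tendsto_iff_dist_tendsto_zero.mp hV).mul_const (lpn q ψ)
      simpa using this
    refine squeeze_zero (fun _ => dist_nonneg) (fun m => ?_) hd
    have Mm : MemLp (fun x => F m x - V x) (ENNReal.ofReal p) := (hFp m).sub (Lp.memLp V)
    have e1 : (∫ x, F m x * ψ x) - ∫ x, V x * ψ x = ∫ x, (F m x - V x) * ψ x := by
      rw [← integral_sub (gf_integrable_mul hpq (hFp m) hψq) (gf_integrable_mul hpq (Lp.memLp V) hψq)]
      congr 1; funext x; ring
    rw [Real.dist_eq, e1]
    refine (gf_holder hpq Mm hψq).trans (le_of_eq ?_)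
    congr 1
    rw [Lp.dist_def]
    refine lpn_congr ?_
    filter_upwards [(hFp m).coeFn_toLp] with x hx
    simp only [Pi.sub_apply, U]
    rw [hx]
  have t2 : Tendsto (fun m => fB i j (φ m) ψ) atTop (nhds (fB i j f ψ)) := by
    rw [tendsto_iff_dist_tendsto_zero]
    have hd : Tendsto (fun m : ℕ => C * (1 / ((m : ℝ) + 1) * lpn q ψ)) atTop (nhds 0) := by
      have := ((tendsto_one_div_add_atTop_nhds_zero_nat (𝕜 := ℝ)).mul_const (lpn q ψ)).const_mul C
      simpa using this
    refine squeeze_zero (fun _ => dist_nonneg) (fun m => ?_) hd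
    rw [dist_comm, Real.dist_eq]
    have e : fB i j f ψ - fB i j (φ m) ψ = fB i j (fun x => 1 * f x + (-1) * φ m x) ψ := by
      rw [fB_lin hn hpq i j hf (test_memLp (hφ m) _) hψq]; ring
    rw [e]
    refine (hb i j (fun x => 1 * f x + (-1) * φ m x) ψ ((hf.const_mul 1).add ((test_memLp (hφ m) _).const_mul (-1))) hψq).trans ?_
    have := hφn m
    have := lpn_nonneg q ψ
    gcongr
  refine tendsto_nhds_unique t1 (t2.congr fun m => ?_)
  exact (hFr m ψ (test_memLp hψ 2)).symm

/-- Sign of the position of `i` relative to `s`. -/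
def sgn (s : Finset (Fin n)) (i : Fin n) : ℝ := (-1 : ℝ) ^ (s.filter (fun j => j < i)).card

theorem sgn_sq (s : Finset (Fin n)) (i : Fin n) : sgn s i * sgn s i = 1 := by
  unfold sgn
  rw [← pow_add, ← two_mul, pow_mul]; simp

theorem sgn_insert {s : Finset (Fin n)} {l : Fin n} (hl : l ∉ s) (j : Fin n) :
    sgn (insert l s) j = if l < j then - sgn s j else sgn s j := by
  unfold sgn
  rw [Finset.filter_insert]
  split_ifs with h
  · rw [Finset.card_insert_of_notMem (by simp [hl]), pow_succ]; ring
  · rfl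

theorem sgn_erase {s : Finset (Fin n)} {l : Fin n} (hl : l ∈ s) (j : Fin n) :
    sgn (s.erase l) j = if l < j then - sgn s j else sgn s j := by
  have := sgn_insert (Finset.notMem_erase l s) j
  rw [Finset.insert_erase hl] at this
  rw [this]
  split_ifs <;> simp

/-- Exterior multiplication on coefficient functions. -/
def eOp (l : Fin n) (W : Finset (Fin n) → ℝ) : Finset (Fin n) → ℝ := fun s =>
  if l ∈ s then sgn s l * W (s.erase l) else 0

/-- Interior multiplication on coefficient functions. -/
def iOp (l : Fin n) (W : Finset (Fin n) → ℝ) : Finset (Fin n) → ℝ := fun s =>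
  if l ∈ s then 0 else sgn s l * W (insert l s)

theorem eOp_sum {ι : Type*} (t : Finset ι) (l : Fin n) (W : ι → Finset (Fin n) → ℝ) :
    eOp l (∑ a ∈ t, W a) = ∑ a ∈ t, eOp l (W a) := by
  funext s
  simp only [eOp, Finset.sum_apply]
  split_ifs
  · rw [Finset.mul_sum]
  · simp

theorem iOp_sum {ι : Type*} (t : Finset ι) (l : Fin n) (W : ι → Finset (Fin n) → ℝ) :
    iOp l (∑ a ∈ t, W a) = ∑ a ∈ t, iOp l (W a) := by
  funext s
  simp only [iOp, Finset.sum_apply]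
  split_ifs
  · simp
  · rw [Finset.mul_sum]

theorem iOp_neg (l : Fin n) (W : Finset (Fin n) → ℝ) : iOp l (-W) = - iOp l W := by
  funext s
  simp only [iOp, Pi.neg_apply]
  split_ifs <;> simp

theorem eOp_anti (l j : Fin n) (W : Finset (Fin n) → ℝ) : eOp l (eOp j W) = - eOp j (eOp l W) := by
  funext s
  simp only [eOp, Pi.neg_apply]
  rcases lt_trichotomy l j with h | h | h
  · by_cases hl : l ∈ s <;> by_cases hj : j ∈ s <;>
      simp [hl, hj, h.ne, h.ne', sgn_erase, h, h.not_gt, Finset.erase_right_comm (a := l) (b := j)] 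
    ring
  · subst h; simp
  · by_cases hl : l ∈ s <;> by_cases hj : j ∈ s <;>
      simp [hl, hj, h.ne, h.ne', sgn_erase, h, h.not_gt, Finset.erase_right_comm (a := l) (b := j)] 
    ring

theorem iOp_anti (l j : Fin n) (W : Finset (Fin n) → ℝ) : iOp l (iOp j W) = - iOp j (iOp l W) := by
  funext s
  simp only [iOp, Pi.neg_apply]
  rcases lt_trichotomy l j with h | h | h
  · by_cases hl : l ∈ s <;> by_cases hj : j ∈ s <;>
      simp [hl, hj, h.ne, h.ne', sgn_insert, h, h.not_gt, Finset.insert_comm l j] 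
    ring
  · subst h; simp
  · by_cases hl : l ∈ s <;> by_cases hj : j ∈ s <;>
      simp [hl, hj, h.ne, h.ne', sgn_insert, h, h.not_gt, Finset.insert_comm l j] 
    ring

theorem eOp_iOp (l i : Fin n) (W : Finset (Fin n) → ℝ) :
    eOp l (iOp i W) = (if i = l then W else 0) - iOp i (eOp l W) := by
  funext s
  simp only [eOp, iOp, Pi.sub_apply]
  rcases lt_trichotomy l i with h | h | h
  · by_cases hl : l ∈ s <;> by_cases hi : i ∈ s <;>
      simp [hl, hi, h.ne, h.ne', sgn_erase, sgn_insert, h, h.not_gt, Finset.erase_insert_of_ne] 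
    ring
  · subst h
    by_cases hl : l ∈ s <;> simp [hl, sgn_erase, sgn_insert, ← mul_assoc, sgn_sq]
  · by_cases hl : l ∈ s <;> by_cases hi : i ∈ s <;>
      simp [hl, hi, h.ne, h.ne', sgn_erase, sgn_insert, h, h.not_gt, Finset.erase_insert_of_ne] 
    ring

theorem eOp_adj (l : Fin n) (V W : Finset (Fin n) → ℝ) :
    ∑ s, V s * eOp l W s = ∑ s, iOp l V s * W s := by
  have h1 : ∑ s, V s * eOp l W s = ∑ s with l ∈ s, V s * (sgn s l * W (s.erase l)) := by
    rw [Finset.sum_filter]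
    refine Finset.sum_congr rfl fun s _ => ?_
    simp only [eOp]; split_ifs <;> simp
  have h2 : ∑ s, iOp l V s * W s = ∑ s with l ∉ s, sgn s l * V (insert l s) * W s := by
    rw [Finset.sum_filter]
    refine Finset.sum_congr rfl fun s _ => ?_
    simp only [iOp]
    by_cases h : l ∈ s <;> simp [h]
  rw [h1, h2]
  refine Finset.sum_nbij' (fun s => s.erase l) (fun s => insert l s) ?_ ?_ ?_ ?_ ?_
  · intro s hs; simp
  · intro s hs; simp
  · intro s hs; simp at hs; simp [hs]
  · intro s hs; simp at hs; simp [hs]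
  · intro s hs
    simp at hs
    simp [hs, sgn_erase, Finset.insert_erase]
    ring

/-- Extension by zero of the coefficients to all finite index sets. -/
def ex (w : Form n N k) (r : Fin N) (s : Finset (Fin n)) : ℝ :=
  if h : s.card = k then w (⟨s, h⟩, r) else 0

theorem ex_inj {v w : Form n N k} (h : ∀ r, ex v r = ex w r) : v = w := by
  funext ⟨⟨s, hs⟩, r⟩
  have := congrFun (h r) s
  simpa [ex, hs] using this

theorem ex_extD (G : Fin n → Form n N k) (r : Fin N) : ex (extD G) r = ∑ i, eOp i (ex (G i) r) := by
  funext s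
  rw [Finset.sum_apply]
  unfold ex extD eOp
  by_cases h : s.card = k + 1
  · rw [dif_pos h]
    refine Finset.sum_congr rfl fun i _ => ?_
    by_cases hi : i ∈ s
    · have : (s.erase i).card = k := by simp [Finset.card_erase_of_mem hi, h]
      simp [hi, this, sgn]
    · simp [hi]
  · rw [dif_neg h]
    symm
    refine Finset.sum_eq_zero fun i _ => ?_
    by_cases hi : i ∈ s
    · have : (s.erase i).card ≠ k := by
        have := Finset.card_erase_add_one hi
        omega
      rw [if_pos hi]; beta_reduce; rw [dif_neg this, mul_zero]
    · simp [hi]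

theorem ex_codiff (G : Fin n → Form n N (k + 1)) (r : Fin N) :
    ex (codiff G) r = - ∑ i, iOp i (ex (G i) r) := by
  funext s
  rw [Pi.neg_apply, Finset.sum_apply]
  unfold ex codiff iOp
  by_cases h : s.card = k
  · rw [dif_pos h]
    congr 1
    refine Finset.sum_congr rfl fun i _ => ?_
    by_cases hi : i ∈ s
    · simp [hi]
    · have : (insert i s).card = k + 1 := by simp [Finset.card_insert_of_notMem hi, h]
      simp [hi, this, sgn]
  · rw [dif_neg h]
    symm
    rw [neg_eq_zero]
    refine Finset.sum_eq_zero fun i _ => ?_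
    by_cases hi : i ∈ s
    · simp [hi]
    · have : (insert i s).card ≠ k + 1 := by
        rw [Finset.card_insert_of_notMem hi]; omega
      rw [if_neg hi]; beta_reduce; rw [dif_neg this, mul_zero]

theorem ex_neg (w : Form n N k) (r : Fin N) : ex (-w) r = - ex w r := by
  funext s; simp only [ex, Pi.neg_apply]; split_ifs <;> simp

theorem ex_zero (r : Fin N) : ex (0 : Form n N k) r = 0 := by
  funext s; simp [ex]

theorem ex_sum {ι : Type*} (t : Finset ι) (w : ι → Form n N k) (r : Fin N) :
    ex (∑ a ∈ t, w a) r = ∑ a ∈ t, ex (w a) r := by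
  funext s; rw [Finset.sum_apply]; simp only [ex, Finset.sum_apply]; split_ifs <;> simp

theorem finner_ex (v w : Form n N k) : finner v w = ∑ r, ∑ s, ex v r s * ex w r s := by
  unfold finner
  rw [Fintype.sum_prod_type, Finset.sum_comm]
  refine Finset.sum_congr rfl fun r _ => ?_
  have : ∑ s, ex v r s * ex w r s = ∑ s with s.card = k, ex v r s * ex w r s := by
    rw [Finset.sum_filter]
    refine Finset.sum_congr rfl fun s _ => ?_
    split_ifs with h
    · rfl
    · simp [ex, h]
  rw [this, ← Finset.sum_subtype_of_mem (p := fun s : Finset (Fin n) => s.card = k) _ (by simp)]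
  refine Finset.sum_congr (by ext s; simp [s.2]) fun s _ => ?_
  simp [ex, s.2]

/-- Double sum of antisymmetric operators against a symmetric array vanishes. -/
theorem sum_anti {M : Type*} [AddCommGroup M] [Module ℝ M] (A : Fin n → Fin n → M)
    (h : ∀ i j, A i j = - A j i) : ∑ i, ∑ j, A i j = 0 := by
  have h1 : ∑ i, ∑ j, A i j = - ∑ i, ∑ j, A i j := by
    conv_lhs => rw [Finset.sum_comm]
    rw [← Finset.sum_neg_distrib]
    refine Finset.sum_congr rfl fun i _ => ?_
    rw [← Finset.sum_neg_distrib]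
    exact Finset.sum_congr rfl fun j _ => h j i
  have h2 : (2 : ℝ) • ∑ i, ∑ j, A i j = 0 := by
    rw [two_smul]; exact add_eq_zero_iff_eq_neg.mpr h1
  exact (smul_eq_zero.mp h2).resolve_left two_ne_zero

theorem alg_one (H : Fin n → Fin n → Fin n → Form n N k) (G' : Fin n → Form n N k)
    (h1 : ∀ i j l, H i j l = H j i l) (h2 : ∀ i j l, H i j l = H l j i)
    (htr : ∀ l, ∑ i, H i i l = G' l) :
    extD (fun l => -codiff (fun i => extD (fun j => H i j l))) = extD G' := by
  refine ex_inj fun r => ?_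
  simp only [ex_extD, ex_neg, ex_codiff, neg_neg, eOp_sum, iOp_sum, eOp_iOp, Finset.sum_sub_distrib,
    ← htr, ex_sum]
  have z : ∑ l, ∑ i, ∑ j, iOp i (eOp l (eOp j (ex (H i j l) r))) = 0 := by
    rw [Finset.sum_comm]
    refine Finset.sum_eq_zero fun i _ => ?_
    refine sum_anti _ fun l j => ?_
    rw [eOp_anti, iOp_neg, show H i j l = H i l j by rw [h1, h2, h1]]
  rw [z, sub_zero]
  simp only [Finset.sum_ite_irrel]
  have : ∀ l : Fin n, ∑ i, (∑ j, if i = l then eOp j (ex (H i j l) r) else 0) = ∑ j, eOp j (ex (H l j l) r) := by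
    intro l
    rw [Finset.sum_comm]
    simp
  simp only [Finset.sum_const_zero, Finset.sum_ite_eq', Finset.mem_univ, if_true]
  rw [Finset.sum_comm]
  refine Finset.sum_congr rfl fun j _ => Finset.sum_congr rfl fun l _ => ?_
  rw [h1 l j l, h2 j l l]

theorem alg_two (K : Fin n → Fin n → Form n N (k + 1 + 1)) (h : ∀ i l, K i l = K l i) :
    codiff (fun l => -codiff (fun i => K i l)) = 0 := by
  refine ex_inj fun r => ?_
  simp only [ex_neg, ex_codiff, neg_neg, iOp_sum, ex_zero]
  rw [neg_eq_zero]
  refine sum_anti _ fun l i => ?_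
  rw [iOp_anti, h]

/-- Interior multiplication of forms. -/
def inm (l : Fin n) (w : Form n N (k + 1)) : Form n N k := -codiff (fun i => if i = l then w else 0)

theorem ex_inm (l : Fin n) (w : Form n N (k + 1)) (r : Fin N) : ex (inm l w) r = iOp l (ex w r) := by
  unfold inm
  rw [ex_neg, ex_codiff, neg_neg, Finset.sum_eq_single l]
  · simp
  · intro b _ hb
    rw [if_neg hb, ex_zero]
    funext s; simp [iOp]
  · simp

theorem codiff_inm (G : Fin n → Form n N (k + 1)) : codiff G = - ∑ l, inm l (G l) := by
  refine ex_inj fun r => ?_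
  simp only [ex_neg, ex_codiff, ex_sum, ex_inm]

theorem finner_extD (w : Form n N (k + 1)) (G : Fin n → Form n N k) :
    finner w (extD G) = ∑ l, finner (inm l w) (G l) := by
  simp only [finner_ex, ex_extD, ex_inm, ← eOp_adj, Finset.sum_apply, Finset.mul_sum]
  rw [Finset.sum_comm' (t' := Finset.univ) (s' := fun _ => Finset.univ) (by simp)]
  symm
  rw [Finset.sum_comm]
  conv_rhs => rw [Finset.sum_comm]
  refine Finset.sum_congr rfl fun r _ => ?_
  rw [Finset.sum_comm]

theorem extD_add (G G' : Fin n → Form n N k) : extD (fun i q => G i q + G' i q) = extD G + extD G' := by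
  funext q
  simp only [extD, Pi.add_apply, ← Finset.sum_add_distrib]
  refine Finset.sum_congr rfl fun i _ => ?_
  split_ifs
  · ring
  · simp

theorem extD_smul (c : ℝ) (G : Fin n → Form n N k) : extD (fun i q => c * G i q) = c • extD G := by
  funext q
  simp only [extD, Pi.smul_apply, smul_eq_mul, Finset.mul_sum]
  refine Finset.sum_congr rfl fun i _ => ?_
  split_ifs
  · ring
  · simp

theorem codiff_add (G G' : Fin n → Form n N (k + 1)) : codiff (fun i => G i + G' i) = codiff G + codiff G' := by
  funext q
  simp only [codiff, Pi.add_apply, ← Finset.sum_add_distrib, ← neg_add]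
  congr 1
  refine Finset.sum_congr rfl fun i _ => ?_
  split_ifs
  · simp
  · ring

theorem codiff_smul (c : ℝ) (G : Fin n → Form n N (k + 1)) : codiff (fun i => c • G i) = c • codiff G := by
  funext q
  simp only [codiff, Pi.smul_apply, smul_eq_mul, mul_neg, Finset.mul_sum]
  congr 1
  refine Finset.sum_congr rfl fun i _ => ?_
  split_ifs
  · simp
  · ring

/-- The algebraic part of the projection onto coclosed forms. -/
def Pop : (Fin n × Fin n × (FormIdx n k × Fin N) → ℝ) →ₗ[ℝ] Form n N k where
  toFun f := -codiff (fun i => extD (fun j q => f (i, j, q)))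
  map_add' f g := by
    simp only [Pi.add_apply, extD_add, codiff_add, neg_add]
  map_smul' c f := by
    simp only [Pi.smul_apply, smul_eq_mul, extD_smul, codiff_smul, RingHom.id_apply, smul_neg]

/-- Interior multiplication as a linear map. -/
def inmL (l : Fin n) : Form n N (k + 1) →ₗ[ℝ] Form n N k where
  toFun w := inm l w
  map_add' f g := by
    unfold inm
    rw [← neg_add, ← codiff_add]
    congr 2; funext i; split_ifs <;> simp
  map_smul' c f := by
    unfold inm
    rw [RingHom.id_apply, smul_neg, ← codiff_smul]
    congr 2; funext i; split_ifs <;> simp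

/-- Coordinate of a linear map. -/
def coL {A B : Type*} (L : (A → ℝ) →ₗ[ℝ] (B → ℝ)) (b : B) : (A → ℝ) →ₗ[ℝ] ℝ := (LinearMap.proj b).comp L

theorem lin_rep {A : Type*} [Fintype A] [DecidableEq A] (L : (A → ℝ) →ₗ[ℝ] ℝ) :
    ∃ c : A → ℝ, ∀ f, L f = ∑ a, f a * c a :=
  ⟨_, fun f => LinearMap.pi_apply_eq_sum_univ L f⟩

theorem lin_memLp {A : Type*} [Fintype A] [DecidableEq A] (L : (A → ℝ) →ₗ[ℝ] ℝ) {P : ℝ≥0∞}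
    {F : En n → A → ℝ} (h : ∀ a, MemLp (fun x => F x a) P) : MemLp (fun x => L (F x)) P := by
  obtain ⟨c, hc⟩ := lin_rep L
  simp_rw [hc]
  exact memLp_finsetSum _ fun a _ => (h a).mul_const _

theorem lin_WD {A : Type*} [Fintype A] [DecidableEq A] (L : (A → ℝ) →ₗ[ℝ] ℝ) {p q : ℝ}
    (hpq : p.HolderConjugate q) {l : Fin n}
    {F H : En n → A → ℝ} (hF : ∀ a, MemLp (fun x => F x a) (ENNReal.ofReal p))
    (hH : ∀ a, MemLp (fun x => H x a) (ENNReal.ofReal p))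
    (h : ∀ a, WD (fun x => F x a) (fun x => H x a) l) :
    WD (fun x => L (F x)) (fun x => L (H x)) l := by
  intro ψ hψ
  obtain ⟨c, hc⟩ := lin_rep L
  simp_rw [hc, Finset.sum_mul]
  rw [integral_finsetSum, integral_finsetSum, ← Finset.sum_neg_distrib]
  · refine Finset.sum_congr rfl fun a _ => ?_
    simp_rw [mul_right_comm _ (c _)]
    rw [integral_mul_const, integral_mul_const, h a ψ hψ]; ring
  · intro a _
    simp_rw [mul_right_comm _ (c _)]
    exact (gf_integrable_mul hpq (hH a) (test_memLp hψ _)).mul_const _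
  · intro a _
    simp_rw [mul_right_comm _ (c _)]
    exact (gf_integrable_mul hpq (hF a) (test_memLp (test_deriv hψ _) _)).mul_const _

theorem ae_eq_test {p : ℝ} (hp : 1 < p) {F F' : En n → ℝ} (hF : MemLp F (ENNReal.ofReal p))
    (hF' : MemLp F' (ENNReal.ofReal p))
    (h : ∀ ψ, IsTestFun Set.univ ψ → ∫ x, F x * ψ x = ∫ x, F' x * ψ x) : F =ᵐ[volume] F' := by
  have hp1 : 1 ≤ ENNReal.ofReal p := by simpa using hp.le
  refine ae_eq_of_integral_contDiff_smul_eq (hF.locallyIntegrable hp1) (hF'.locallyIntegrable hp1) fun g hg hc => ?_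
  have := h g ⟨hg, hc, Set.subset_univ _⟩
  simpa only [smul_eq_mul, mul_comm] using this

theorem gf_global (hn : 0 < n) {p : ℝ} (hp : 1 < p) (v : En n → Form n N k)
    (G : En n → Fin n → Form n N k) (hv : ∀ q, MemLp (fun x => v x q) (ENNReal.ofReal p))
    (hG : ∀ l q, MemLp (fun x => G x l q) (ENNReal.ofReal p))
    (hw : ∀ l q, WD (fun x => v x q) (fun x => G x l q) l) :
    ∃ (ut : En n → Form n N k) (Gt : En n → Fin n → Form n N k),
      (∀ q, MemLp (fun x => ut x q) (ENNReal.ofReal p)) ∧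
      (∀ l q, MemLp (fun x => Gt x l q) (ENNReal.ofReal p)) ∧
      (∀ l q, WD (fun x => ut x q) (fun x => Gt x l q) l) ∧
      (∀ᵐ x, extD (Gt x) = extD (G x)) ∧
      (∀ (j : ℕ) (h : j + 1 = k) (ψ : En n → Form n N j), IsTestForm Set.univ ψ →
        ∫ x, finner (ut x) (cast (congrArg (Form n N) h) (extD (smoothGrad ψ x))) = 0) := by
  obtain ⟨p', hpq⟩ : ∃ p', p.HolderConjugate p' := ⟨_, Real.HolderConjugate.conjExponent hp⟩
  choose S hS hSr using fun i j q => fB_rep hn hpq i j (hv q)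
  choose H hH hHr using fun i j l q => fB_rep hn hpq i j (hG l q)
  have hSW : ∀ i j l q, WD (S i j q) (H i j l q) l := by
    intro i j l q ψ hψ
    rw [hSr i j q _ (test_deriv hψ _), hHr i j l q ψ hψ]
    exact fB_weak hn hpq i j (hv q) (hG l q) (hw l q) hψ
  have s1 : ∀ i j l q, H i j l q =ᵐ[volume] H j i l q := by
    intro i j l q
    refine ae_eq_test hp (hH _ _ _ _) (hH _ _ _ _) fun ψ hψ => ?_
    rw [hHr i j l q ψ hψ, hHr j i l q ψ hψ]
    exact fB_symm hn hpq i j (hG l q) hψ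
  have s2 : ∀ i j l q, H i j l q =ᵐ[volume] H l j i q := by
    intro i j l q
    refine ae_eq_test hp (hH _ _ _ _) (hH _ _ _ _) fun ψ hψ => ?_
    rw [hHr i j l q ψ hψ, hHr l j i q ψ hψ]
    have e1 := fB_weak hn hpq i j (hv q) (hG l q) (hw l q) hψ
    have e2 := fB_weak hn hpq l j (hv q) (hG i q) (hw i q) hψ
    have e3 := fB_deriv hn hpq i j l (hv q) hψ
    linarith
  have s3 : ∀ l q, (fun x => ∑ i, H i i l q x) =ᵐ[volume] fun x => G x l q := by
    intro l q
    refine ae_eq_test hp (memLp_finsetSum _ fun i _ => hH _ _ _ _) (hG l q) fun ψ hψ => ?_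
    rw [← fB_trace hn hpq (hG l q) hψ]
    simp_rw [Finset.sum_mul]
    rw [integral_finsetSum]
    · exact Finset.sum_congr rfl fun i _ => hHr i i l q ψ hψ
    · intro i _
      exact gf_integrable_mul hpq (hH _ _ _ _) (test_memLp hψ _)
  let SS : En n → (Fin n × Fin n × (FormIdx n k × Fin N)) → ℝ := fun x a => S a.1 a.2.1 a.2.2 x
  let HH : Fin n → En n → (Fin n × Fin n × (FormIdx n k × Fin N)) → ℝ := fun l x a => H a.1 a.2.1 l a.2.2 x
  have hsym : ∀ᵐ x, (∀ i j l q, H i j l q x = H j i l q x) ∧ (∀ i j l q, H i j l q x = H l j i q x) ∧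
      ∀ l q, ∑ i, H i i l q x = G x l q := by
    refine Filter.Eventually.and ?_ (Filter.Eventually.and ?_ ?_)
    · simp only [eventually_all]; exact s1
    · simp only [eventually_all]; exact s2
    · simp only [eventually_all]; exact s3
  have mu : ∀ q, MemLp (fun x => Pop (SS x) q) (ENNReal.ofReal p) := fun q =>
    lin_memLp (coL Pop q) (F := SS) fun a => hS _ _ _
  have mG : ∀ l q, MemLp (fun x => Pop (HH l x) q) (ENNReal.ofReal p) := fun l q =>
    lin_memLp (coL Pop q) (F := HH l) fun a => hH _ _ _ _
  have wG : ∀ l q, WD (fun x => Pop (SS x) q) (fun x => Pop (HH l x) q) l := fun l q =>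
    lin_WD (coL Pop q) hpq (F := SS) (H := HH l) (fun a => hS _ _ _) (fun a => hH _ _ _ _)
      fun a => hSW _ _ _ _
  refine ⟨fun x => Pop (SS x), fun x l => Pop (HH l x), mu, mG, wG, ?_, ?_⟩
  · filter_upwards [hsym] with x hx
    refine alg_one (fun i j l q => H i j l q x) (G x) (fun i j l => ?_) (fun i j l => ?_) fun l => ?_
    · funext q; exact hx.1 i j l q
    · funext q; exact hx.2.1 i j l q
    · funext q; rw [Finset.sum_apply]; exact hx.2.2 l q
  · intro j h ψ hψ
    subst h
    simp only [cast_eq]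
    have hψq : ∀ q, IsTestFun Set.univ (fun x => ψ x q) := fun q =>
      ⟨hψ.1 q, hψ.2.1.comp_left (g := fun w : Form n N j => w q) rfl, Set.subset_univ _⟩
    have mi : ∀ l q, MemLp (fun x => inm l (Pop (SS x)) q) (ENNReal.ofReal p) := fun l q =>
      lin_memLp (coL (inmL l) q) (F := fun x => Pop (SS x)) mu
    have mi' : ∀ l q, MemLp (fun x => inm l (Pop (HH l x)) q) (ENNReal.ofReal p) := fun l q =>
      lin_memLp (coL (inmL l) q) (F := fun x => Pop (HH l x)) (mG l)
    have wi : ∀ l q, WD (fun x => inm l (Pop (SS x)) q) (fun x => inm l (Pop (HH l x)) q) l := fun l q =>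
      lin_WD (coL (inmL l) q) hpq (F := fun x => Pop (SS x)) (H := fun x => Pop (HH l x)) mu (mG l) (wG l)
    have key : ∀ᵐ x, ∀ q, ∑ l, inm l (Pop (HH l x)) q = 0 := by
      filter_upwards [hsym] with x hx q
      have h0 := alg_two (fun i l => extD (fun j q => H i j l q x)) (by
        intro i l
        congr 1; funext j q; exact hx.2.1 i j l q)
      rw [codiff_inm, neg_eq_zero] at h0
      have := congrFun h0 q
      rw [Finset.sum_apply] at this
      exact this
    simp_rw [finner_extD, finner]
    rw [integral_finsetSum]
    · have : ∀ l, ∫ x, ∑ q, inm l (Pop (SS x)) q * smoothGrad ψ x l q =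
          - ∫ x, ∑ q, inm l (Pop (HH l x)) q * ψ x q := by
        intro l
        rw [integral_finsetSum, integral_finsetSum, ← Finset.sum_neg_distrib]
        · exact Finset.sum_congr rfl fun q _ => wi l q _ (hψq q)
        · intro q _; exact gf_integrable_mul hpq (mi' l q) (test_memLp (hψq q) _)
        · intro q _; exact gf_integrable_mul hpq (mi l q) (test_memLp (test_deriv (hψq q) _) _)
      simp_rw [this]
      rw [Finset.sum_neg_distrib, neg_eq_zero, ← integral_finsetSum]
      · refine integral_eq_zero_of_ae ?_
        filter_upwards [key] with x hx
        rw [Finset.sum_comm]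
        refine Finset.sum_eq_zero fun q _ => ?_
        rw [← Finset.sum_mul, hx q, zero_mul]
      · intro l _
        exact integrable_finsetSum _ fun q _ => gf_integrable_mul hpq (mi' l q) (test_memLp (hψq q) _)
    · intro l _
      exact integrable_finsetSum _ fun q _ => gf_integrable_mul hpq (mi l q) (test_memLp (test_deriv (hψq q) _) _)

theorem gf_global' (n : ℕ) {N k : ℕ} {p : ℝ} (hp : 1 < p) (v : En n → Form n N k)
    (G : En n → Fin n → Form n N k) (hv : ∀ q, MemLp (fun x => v x q) (ENNReal.ofReal p))
    (hG : ∀ l q, MemLp (fun x => G x l q) (ENNReal.ofReal p))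
    (hw : ∀ l q, WD (fun x => v x q) (fun x => G x l q) l) :
    ∃ (ut : En n → Form n N k) (Gt : En n → Fin n → Form n N k),
      (∀ q, MemLp (fun x => ut x q) (ENNReal.ofReal p)) ∧
      (∀ l q, MemLp (fun x => Gt x l q) (ENNReal.ofReal p)) ∧
      (∀ l q, WD (fun x => ut x q) (fun x => Gt x l q) l) ∧
      (∀ᵐ x, extD (Gt x) = extD (G x)) ∧
      (∀ (j : ℕ) (h : j + 1 = k) (ψ : En n → Form n N j), IsTestForm Set.univ ψ →
        ∫ x, finner (ut x) (cast (congrArg (Form n N) h) (extD (smoothGrad ψ x))) = 0) := by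
  rcases Nat.eq_zero_or_pos n with h0 | hn
  · subst h0
    refine ⟨fun _ _ => 0, fun _ _ _ => 0, fun _ => MemLp.zero', fun _ _ => MemLp.zero', fun l => l.elim0, ?_, ?_⟩
    · filter_upwards with x
      congr 1; funext l; exact l.elim0
    · intro j h ψ _
      simp [finner]
  · exact gf_global hn hp v G hv hG hw

theorem sqrt_sum_le {A : Type*} [Fintype A] (f : A → ℝ) : Real.sqrt (∑ a, f a ^ 2) ≤ ∑ a, |f a| := by
  rw [Real.sqrt_le_left (Finset.sum_nonneg fun _ _ => abs_nonneg _)]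
  simp_rw [← sq_abs (f _)]
  exact Finset.sum_sq_le_sq_sum_of_nonneg fun _ _ => abs_nonneg _

theorem abs_le_sqrt_sum {A : Type*} [Fintype A] (f : A → ℝ) (a : A) : |f a| ≤ Real.sqrt (∑ a, f a ^ 2) := by
  refine Real.abs_le_sqrt ?_
  exact Finset.single_le_sum (f := fun a => f a ^ 2) (fun _ _ => sq_nonneg _) (Finset.mem_univ a)

theorem int_norm_of_memLp {A : Type*} [Fintype A] {p : ℝ} (hp : 1 < p) {F : En n → A → ℝ}
    (h : ∀ a, MemLp (fun x => F x a) (ENNReal.ofReal p)) :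
    Integrable (fun x => Real.sqrt (∑ a, F x a ^ 2) ^ p) := by
  have m : AEStronglyMeasurable (fun x => Real.sqrt (∑ a, F x a ^ 2)) volume := by
    refine Real.continuous_sqrt.comp_aestronglyMeasurable ?_
    exact Finset.aestronglyMeasurable_fun_sum _ fun a _ => (h a).1.pow 2
  have s : MemLp (fun x => ∑ a, |F x a|) (ENNReal.ofReal p) := memLp_finsetSum _ fun a _ => (h a).abs
  have t : MemLp (fun x => Real.sqrt (∑ a, F x a ^ 2)) (ENNReal.ofReal p) := by
    refine s.of_le m (Eventually.of_forall fun x => ?_)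
    rw [Real.norm_eq_abs, Real.norm_eq_abs, abs_of_nonneg (Real.sqrt_nonneg _)]
    exact (sqrt_sum_le _).trans (le_abs_self _)
  have := t.integrable_norm_rpow (by simp; linarith) (by simp)
  rw [ENNReal.toReal_ofReal (by linarith)] at this
  simpa only [Real.norm_eq_abs, abs_of_nonneg (Real.sqrt_nonneg _)] using this

theorem memLp_of_int_norm {A : Type*} [Fintype A] {p : ℝ} (hp : 1 < p) {F : En n → A → ℝ} {D : Set (En n)}
    (hm : ∀ a, AEStronglyMeasurable (fun x => F x a) (volume.restrict D))
    (h : IntegrableOn (fun x => Real.sqrt (∑ a, F x a ^ 2) ^ p) D) (a : A) :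
    MemLp (fun x => F x a) (ENNReal.ofReal p) (volume.restrict D) := by
  rw [← integrable_norm_rpow_iff (hm a) (by simp; linarith) (by simp), ENNReal.toReal_ofReal (by linarith)]
  refine h.mono' ?_ (Eventually.of_forall fun x => ?_)
  · exact ((hm a).norm.aemeasurable.pow_const p).aestronglyMeasurable
  · rw [Real.norm_eq_abs, abs_of_nonneg (by positivity)]
    exact Real.rpow_le_rpow (norm_nonneg _) (abs_le_sqrt_sum (F x) a) (by linarith)

theorem cut_memLp {P : ℝ≥0∞} {c g : En n → ℝ} {D : Set (En n)} (hD : MeasurableSet D)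
    (hc : IsTestFun Set.univ c) (h0 : ∀ x, x ∉ D → c x = 0) (hg : MemLp g P (volume.restrict D)) :
    MemLp (fun x => c x * g x) P := by
  have e : (fun x => c x * g x) = fun x => c x * D.indicator g x := by
    funext x
    by_cases hx : x ∈ D
    · simp [hx]
    · simp [hx, h0 x hx]
  rw [e]
  rw [← memLp_indicator_iff_restrict hD] at hg
  obtain ⟨C, hC⟩ := hc.1.continuous.bounded_above_of_compact_support hc.2.1
  refine hg.of_le_mul (c := C) (hc.1.continuous.aestronglyMeasurable.mul hg.1) (Eventually.of_forall fun x => ?_)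
  rw [norm_mul]
  exact mul_le_mul_of_nonneg_right (hC x) (norm_nonneg _)

theorem cut_WD {p : ℝ} (hp : 1 < p) {η u g : En n → ℝ} {Ω : Set (En n)} {l : Fin n}
    (hη : IsTestFun Ω η) (h : HasWeakPartial Ω u g l)
    (m1 : MemLp (fun x => η x * u x) (ENNReal.ofReal p)) (m2 : MemLp (fun x => η x * g x) (ENNReal.ofReal p))
    (m3 : MemLp (fun x => fderiv ℝ η x (basisVec l) * u x) (ENNReal.ofReal p)) :
    WD (fun x => η x * u x) (fun x => η x * g x + fderiv ℝ η x (basisVec l) * u x) l := by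
  obtain ⟨p', hpq⟩ : ∃ p', p.HolderConjugate p' := ⟨_, Real.HolderConjugate.conjExponent hp⟩
  intro ψ hψ
  have I1 := gf_integrable_mul hpq m1 (test_memLp (test_deriv hψ (basisVec l)) _)
  have I2 := gf_integrable_mul hpq m2 (test_memLp hψ _)
  have I3 := gf_integrable_mul hpq m3 (test_memLp hψ _)
  have ht : IsTestFun Ω (fun x => η x * ψ x) :=
    ⟨hη.1.mul hψ.1, hη.2.1.mul_right, (tsupport_mul_subset_left).trans hη.2.2⟩
  have h1 := h _ ht
  have hz : ∀ x, x ∉ Ω → x ∉ tsupport (fun x => η x * ψ x) := fun x hx hx' => hx (ht.2.2 hx')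
  rw [setIntegral_eq_integral_of_forall_compl_eq_zero, setIntegral_eq_integral_of_forall_compl_eq_zero] at h1
  · have e1 : ∀ x, u x * fderiv ℝ (fun x => η x * ψ x) x (basisVec l) =
        η x * u x * fderiv ℝ ψ x (basisVec l) + fderiv ℝ η x (basisVec l) * u x * ψ x := by
      intro x
      have d1 : DifferentiableAt ℝ η x := (hη.1.differentiable (by simp)).differentiableAt
      have d2 : DifferentiableAt ℝ ψ x := (hψ.1.differentiable (by simp)).differentiableAt
      have := d1.hasFDerivAt.mul d2.hasFDerivAt
      rw [show (fun x => η x * ψ x) = η * ψ from rfl, this.fderiv]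
      simp
      ring
    simp_rw [e1] at h1
    rw [integral_add I1 I3] at h1
    simp_rw [add_mul]
    rw [integral_add I2 I3]
    have e2 : ∫ x, g x * (η x * ψ x) = ∫ x, η x * g x * ψ x := by
      congr 1; funext x; ring
    rw [e2] at h1
    linarith
  · intro x hx
    rw [image_eq_zero_of_notMem_tsupport (hz x hx), mul_zero]
  · intro x hx
    rw [fderiv_of_notMem_tsupport ℝ (hz x hx)]; simp

theorem extD_grad_zero {φ : En n → Form n N k} {x : En n} (hx : x ∉ tsupport φ) :
    extD (smoothGrad φ x) = 0 := by
  have : smoothGrad φ x = fun _ _ => 0 := by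
    funext i q
    have : x ∉ tsupport (fun y => φ y q) := fun h =>
      hx (tsupport_comp_subset (g := fun w : Form n N k => w q) rfl φ h)
    rw [smoothGrad, fderiv_of_notMem_tsupport ℝ this]; simp
  rw [this]
  funext q
  simp [extD]

theorem finner_zero (w : Form n N k) : finner w 0 = 0 := by simp [finner]

/-- **Gauge fixing lemma.** Let `u ∈ W^{1,p}_loc(Ω)` be a local weak solution of
`δ(a(x)|du|^{p-2}du) = f` in `Ω`. Then for any ball `B_R ⊂⊂ Ω` there exists a coclosed
form `ũ ∈ W^{1,p}(B_R)` which is also a local weak solution of the same system in `B_R`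
and satisfies `δũ = 0` and `dũ = du` a.e. in `B_R`. -/
theorem gauge_fixing_lemma
    (n N k : ℕ) (Ω : Set (En n)) (hΩ : IsOpen Ω) (p : ℝ) (hp : 1 < p)
    (a : En n → ℝ) (f : En n → Form n N k)
    (u : En n → Form n N k) (G : En n → Fin n → Form n N k)
    (hu : MemW1pLoc Ω p u G)
    (hsol : IsLocalWeakSolution Ω p a u G f) :
    ∀ (x₀ : En n) (R : ℝ), 0 < R → closure (ball x₀ R) ⊆ Ω →
      ∃ (ut : En n → Form n N k) (Gt : En n → Fin n → Form n N k),
        MemW1p (ball x₀ R) p ut Gt ∧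
        WeaklyCoclosed (ball x₀ R) ut ∧
        (∀ᵐ x ∂volume.restrict (ball x₀ R), extD (Gt x) = extD (G x)) ∧
        IsLocalWeakSolution (ball x₀ R) p a ut Gt f := by
  intro x₀ R hR hB
  rw [closure_ball x₀ hR.ne'] at hB
  obtain ⟨δ, hδ, hδΩ⟩ := (isCompact_closedBall x₀ R).exists_cthickening_subset_open hΩ hB
  rw [cthickening_closedBall hδ.le hR.le] at hδΩ
  set D := closedBall x₀ (δ + R) with hDdef
  have hDm : MeasurableSet D := isClosed_closedBall.measurableSet
  have hDc : IsCompact D := isCompact_closedBall _ _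
  let bump : ContDiffBump x₀ := ⟨R, δ + R, hR, by linarith⟩
  let η : En n → ℝ := bump
  have hts : tsupport η = D := bump.tsupport_eq
  have hη : IsTestFun Ω η := ⟨bump.contDiff, bump.hasCompactSupport, hts.trans_subset hδΩ⟩
  have hηu : IsTestFun Set.univ η := ⟨hη.1, hη.2.1, Set.subset_univ _⟩
  have hη0 : ∀ x, x ∉ D → η x = 0 := fun x hx => image_eq_zero_of_notMem_tsupport (hts ▸ hx)
  have hdη0 : ∀ l x, x ∉ D → fderiv ℝ η x (basisVec l) = 0 := fun l x hx => by
    rw [fderiv_of_notMem_tsupport ℝ (hts ▸ hx)]; simp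
  have hη1 : ∀ x ∈ ball x₀ R, η x = 1 := fun x hx => bump.one_of_mem_closedBall (ball_subset_closedBall hx)
  have hdη1 : ∀ l, ∀ x ∈ ball x₀ R, fderiv ℝ η x (basisVec l) = 0 := by
    intro l x hx
    have : η =ᶠ[nhds x] fun _ => (1 : ℝ) := by
      filter_upwards [isOpen_ball.mem_nhds hx] with y hy using hη1 y hy
    rw [this.fderiv_eq]; simp
  obtain ⟨hw, hum, hGm, hInteg⟩ := hu
  obtain ⟨iu, iG⟩ := hInteg D hδΩ hDc
  have mu : ∀ q, MemLp (fun x => u x q) (ENNReal.ofReal p) (volume.restrict D) :=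
    memLp_of_int_norm hp (fun q => (hum q).mono_measure (Measure.restrict_mono hδΩ le_rfl)) iu
  have mG : ∀ l q, MemLp (fun x => G x l q) (ENNReal.ofReal p) (volume.restrict D) := by
    intro l q
    refine memLp_of_int_norm hp (F := fun x (b : Fin n × (FormIdx n k × Fin N)) => G x b.1 b.2)
      (fun b => (hGm b.1 b.2).mono_measure (Measure.restrict_mono hδΩ le_rfl)) ?_ (l, q)
    simp_rw [Fintype.sum_prod_type (γ := ℝ) (f := fun b : Fin n × (FormIdx n k × Fin N) => _)]
    exact iG
  have c1 : ∀ q, MemLp (fun x => η x * u x q) (ENNReal.ofReal p) := fun q => cut_memLp hDm hηu hη0 (mu q)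
  have c2 : ∀ l q, MemLp (fun x => η x * G x l q) (ENNReal.ofReal p) := fun l q => cut_memLp hDm hηu hη0 (mG l q)
  have c3 : ∀ l q, MemLp (fun x => fderiv ℝ η x (basisVec l) * u x q) (ENNReal.ofReal p) := fun l q =>
    cut_memLp hDm (test_deriv hηu _) (hdη0 l) (mu q)
  obtain ⟨ut, Gt, h1, h2, h3, h4, h5⟩ := gf_global' n hp (fun x q => η x * u x q)
    (fun x l q => η x * G x l q + fderiv ℝ η x (basisVec l) * u x q) c1 (fun l q => (c2 l q).add (c3 l q))
    (fun l q => cut_WD hp hη (hw l q) (c1 q) (c2 l q) (c3 l q))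
  have hBΩ : ball x₀ R ⊆ Ω := ball_subset_closedBall.trans hB
  have hae : ∀ᵐ x ∂volume.restrict (ball x₀ R), extD (Gt x) = extD (G x) := by
    filter_upwards [ae_restrict_of_ae h4, ae_restrict_mem measurableSet_ball] with x hx hxB
    rw [hx]
    congr 1; funext l q
    rw [hη1 x hxB, hdη1 l x hxB]; ring
  refine ⟨ut, Gt, ⟨?_, ?_, ?_, ?_, ?_⟩, ?_, hae, ?_⟩
  · intro l q φ hφ
    have hz : ∀ x, x ∉ ball x₀ R → x ∉ tsupport φ := fun x hx hx' => hx (hφ.2.2 hx')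
    rw [setIntegral_eq_integral_of_forall_compl_eq_zero, setIntegral_eq_integral_of_forall_compl_eq_zero]
    · exact h3 l q φ ⟨hφ.1, hφ.2.1, Set.subset_univ _⟩
    · intro x hx
      rw [image_eq_zero_of_notMem_tsupport (hz x hx), mul_zero]
    · intro x hx
      rw [fderiv_of_notMem_tsupport ℝ (hz x hx)]; simp
  · exact fun q => (h1 q).1.restrict
  · exact fun l q => (h2 l q).1.restrict
  · exact (int_norm_of_memLp hp h1).integrableOn
  · have := int_norm_of_memLp hp (F := fun x (b : Fin n × (FormIdx n k × Fin N)) => Gt x b.1 b.2)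
      (fun b => h2 b.1 b.2)
    simp_rw [Fintype.sum_prod_type (γ := ℝ) (f := fun b : Fin n × (FormIdx n k × Fin N) => _)] at this
    exact this.integrableOn
  · intro j h ψ hψ
    rw [setIntegral_eq_integral_of_forall_compl_eq_zero]
    · exact h5 j h ψ ⟨hψ.1, hψ.2.1, Set.subset_univ _⟩
    · intro x hx
      subst h
      rw [extD_grad_zero (fun hx' => hx (hψ.2.2 hx'))]
      exact finner_zero _
  · intro φ hφ
    have hz : ∀ x, x ∉ ball x₀ R → x ∉ tsupport φ := fun x hx hx' => hx (hφ.2.2 hx')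
    have hs := hsol φ ⟨hφ.1, hφ.2.1, hφ.2.2.trans hBΩ⟩
    rw [setIntegral_eq_of_subset_of_forall_sdiff_eq_zero hΩ.measurableSet hBΩ,
      setIntegral_eq_of_subset_of_forall_sdiff_eq_zero hΩ.measurableSet hBΩ] at hs
    · rw [← hs]
      refine integral_congr_ae ?_
      filter_upwards [hae] with x hx
      rw [hx]
    · intro x hx
      rw [image_eq_zero_of_notMem_tsupport (hz x hx.2)]; exact finner_zero _
    · intro x hx
      rw [extD_grad_zero (hz x hx.2)]; exact finner_zero _
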